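/- Let M be a compact manifold with boundary whose boundary components all have amenable fundamental group. Then the ideal simplicial volume of M equals the classical simplicial volume: ‖M‖_I = ‖M‖. -/

import Mathlib

open scoped BigOperators
open Topology
noncomputable section

/-! ### Quasicones and marked spaces -/

/-- `B` is a *quasicone* with apex `b`: there is a homotopy `H` from the identity to the
constant map at `b` with `H ⁻¹' {b} = ({b} × I) ∪ (B × {1})`. -/
def IsQuasicone {B : Type*} [TopologicalSpace B] (b : B) : Prop :=
  ∃ H : C(B × unitInterval, B),
    (∀ x, H (x, 0) = x) ∧ (∀ x, H (x, 1) = b) ∧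
    (∀ x t, H (x, t) = b ↔ x = b ∨ t = 1)

/-- A *marked space* `(X, B)`: `B` is closed in `X` and every `b ∈ B` has a closed
quasiconical neighbourhood `F b` with apex `b`, the `F b` being pairwise disjoint. -/
structure IsMarkedSpace (X : Type*) [TopologicalSpace X] (B : Set X) : Prop where
  closed : IsClosed B
  quasicones : ∃ F : B → Set X,
    (∀ b : B, IsClosed (F b)) ∧ (∀ b : B, F b ∈ nhds (b : X)) ∧
    (∀ b b' : B, b ≠ b' → Disjoint (F b) (F b')) ∧
    (∀ b : B, ∃ hb : (b : X) ∈ F b, IsQuasicone (⟨(b : X), hb⟩ : F b))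

/-! ### Singular chains -/

/-- The topological standard `n`-simplex. -/
abbrev TopSimplex (n : ℕ) : Type := ↥(stdSimplex ℝ (Fin (n + 1)))

/-- Singular `n`-simplices in `X`. -/
abbrev SingularSimplex (X : Type*) [TopologicalSpace X] (n : ℕ) := C(TopSimplex n, X)

/-- Singular `n`-chains in `X` with coefficients in `R`. -/
abbrev SingularChain (R : Type*) [Ring R] (X : Type*) [TopologicalSpace X] (n : ℕ) :=
  SingularSimplex X n →₀ R

/-- The `i`-th coface map, on barycentric coordinates. -/
def cofaceFun {n : ℕ} (i : Fin (n + 2)) (x : Fin (n + 1) → ℝ) : Fin (n + 2) → ℝ :=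
  fun j => ∑ k : Fin (n + 1), if i.succAbove k = j then x k else 0

lemma cofaceFun_mem {n : ℕ} (i : Fin (n + 2)) {x : Fin (n + 1) → ℝ}
    (hx : x ∈ stdSimplex ℝ (Fin (n + 1))) : cofaceFun i x ∈ stdSimplex ℝ (Fin (n + 2)) := by
  constructor
  · intro j
    refine Finset.sum_nonneg fun k _ => ?_
    split_ifs
    · exact hx.1 k
    · exact le_rfl
  · unfold cofaceFun
    rw [Finset.sum_comm]
    simp only [Finset.sum_ite_eq, Finset.mem_univ, if_true]
    exact hx.2

/-- The `i`-th face inclusion `Δⁿ → Δⁿ⁺¹`. -/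
def coface {n : ℕ} (i : Fin (n + 2)) : C(TopSimplex n, TopSimplex (n + 1)) where
  toFun x := ⟨cofaceFun i (x : Fin (n + 1) → ℝ), cofaceFun_mem i x.2⟩
  continuous_toFun := by
    refine Continuous.subtype_mk ?_ _
    refine continuous_pi fun j => ?_
    unfold cofaceFun
    refine continuous_finset_sum _ fun k _ => ?_
    by_cases h : i.succAbove k = j
    · simp only [if_pos h]
      exact (continuous_apply k).comp continuous_subtype_val
    · simp only [if_neg h]
      exact continuous_const

/-- The boundary of a single `(n+1)`-simplex. -/
def boundaryOf (R : Type*) [Ring R] {X : Type*} [TopologicalSpace X] {n : ℕ}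
    (σ : SingularSimplex X (n + 1)) : SingularChain R X n :=
  ∑ i : Fin (n + 2), Finsupp.single (σ.comp (coface i)) ((-1 : R) ^ (i : ℕ))

/-- The singular boundary operator. -/
def boundary (R : Type*) [Ring R] (X : Type*) [TopologicalSpace X] (n : ℕ) :
    SingularChain R X (n + 1) →ₗ[R] SingularChain R X n :=
  Finsupp.lsum ℕ fun σ => LinearMap.toSpanSingleton R _ (boundaryOf R σ)

/-- Push-forward of chains along a continuous map. -/
def pushChain (R : Type*) [Ring R] {X Y : Type*} [TopologicalSpace X] [TopologicalSpace Y]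
    (f : C(X, Y)) (n : ℕ) : SingularChain R X n →ₗ[R] SingularChain R Y n :=
  Finsupp.lmapDomain R R fun σ : SingularSimplex X n => f.comp σ

/-- The face of `Δⁿ` spanned by the vertices in `S`. -/
def faceSet (n : ℕ) (S : Finset (Fin (n + 1))) : Set (TopSimplex n) :=
  {x | ∀ j ∉ S, (x : Fin (n + 1) → ℝ) j = 0}

/-- A subset of `Δⁿ` which is a union of (not necessarily proper) faces. -/
def IsSimplicialSubcomplex {n : ℕ} (A : Set (TopSimplex n)) : Prop :=
  ∃ 𝒮 : Set (Finset (Fin (n + 1))), A = ⋃ S ∈ 𝒮, faceSet n S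

/-- A singular simplex is *admissible* if the preimage of `B` is a union of faces. -/
def Admissible {X : Type*} [TopologicalSpace X] (B : Set X) {n : ℕ}
    (σ : SingularSimplex X n) : Prop :=
  IsSimplicialSubcomplex (σ ⁻¹' B)

/-- The submodule generated by admissible simplices. -/
def admissibleChains (R : Type*) [Ring R] (X : Type*) [TopologicalSpace X] (B : Set X)
    (n : ℕ) : Submodule R (SingularChain R X n) :=
  Submodule.span R {c | ∃ σ : SingularSimplex X n, Admissible B σ ∧ c = Finsupp.single σ 1}

/-- The submodule generated by simplices supported in `B`. -/
def chainsIn (R : Type*) [Ring R] (X : Type*) [TopologicalSpace X] (B : Set X)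
    (n : ℕ) : Submodule R (SingularChain R X n) :=
  Submodule.span R {c | ∃ σ : SingularSimplex X n, Set.range ⇑σ ⊆ B ∧ c = Finsupp.single σ 1}

/-- Cycles of the marked chain complex `C^M_*(X,B;R) = Ĉ^M_*(X,B;R)/C_*(B;R)`:
admissible chains whose boundary is supported in `B`. -/
def markedCycles (R : Type*) [Ring R] (X : Type*) [TopologicalSpace X] (B : Set X) :
    (n : ℕ) → Submodule R (SingularChain R X n)
  | 0 => admissibleChains R X B 0
  | (n + 1) => admissibleChains R X B (n + 1) ⊓
      Submodule.comap (boundary R X n) (chainsIn R X B n)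

/-- Boundaries of the marked chain complex. -/
def markedBoundaries (R : Type*) [Ring R] (X : Type*) [TopologicalSpace X] (B : Set X)
    (n : ℕ) : Submodule R (SingularChain R X n) :=
  Submodule.map (boundary R X n) (admissibleChains R X B (n + 1)) ⊔ chainsIn R X B n

/-- Relative cycles of the pair `(X, B)`. -/
def relativeCycles (R : Type*) [Ring R] (X : Type*) [TopologicalSpace X] (B : Set X) :
    (n : ℕ) → Submodule R (SingularChain R X n)
  | 0 => ⊤
  | (n + 1) => Submodule.comap (boundary R X n) (chainsIn R X B n)

/-- Relative boundaries of the pair `(X, B)`. -/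
def relativeBoundaries (R : Type*) [Ring R] (X : Type*) [TopologicalSpace X] (B : Set X)
    (n : ℕ) : Submodule R (SingularChain R X n) :=
  Submodule.map (boundary R X n) ⊤ ⊔ chainsIn R X B n

/-- The ℓ¹-norm of a real singular chain. -/
def l1Norm {X : Type*} [TopologicalSpace X] {n : ℕ} (c : SingularChain ℝ X n) : ℝ :=
  c.sum fun _ r => |r|

/-! ### The marked space associated to a manifold with boundary, and simplicial volumes -/

/-- The relation collapsing each connected component of `bd` to a point. -/
def collapseRel (X : Type*) (bd : Set X) [TopologicalSpace X] : X → X → Prop := fun a b =>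
  a = b ∨ (a ∈ bd ∧ b ∈ bd ∧ connectedComponentIn bd a = connectedComponentIn bd b)

/-- The quotient of `X` obtained by collapsing each connected component of `bd`
to a point. -/
abbrev Collapse (X : Type*) [TopologicalSpace X] (bd : Set X) : Type _ :=
  Quot (collapseRel X bd)

/-- The natural projection onto the collapsed space. -/
def collapseMap (X : Type*) [TopologicalSpace X] (bd : Set X) : C(X, Collapse X bd) :=
  ⟨Quot.mk _, continuous_quot_mk⟩

/-- The marked points: the images of the components of `bd`. -/
def collapsedBoundary (X : Type*) [TopologicalSpace X] (bd : Set X) : Set (Collapse X bd) :=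
  (collapseMap X bd) '' bd

/-- `ζ` is a relative fundamental cycle: it is a relative cycle which is not a relative
boundary, and whose class generates `H_n(X, bd; ℝ)`. -/
def IsFundamentalClassData (X : Type*) [TopologicalSpace X] (bd : Set X) (n : ℕ)
    (ζ : SingularChain ℝ X n) : Prop :=
  ζ ∈ relativeCycles ℝ X bd n ∧ ζ ∉ relativeBoundaries ℝ X bd n ∧
    ∀ z ∈ relativeCycles ℝ X bd n, ∃ r : ℝ, z - r • ζ ∈ relativeBoundaries ℝ X bd n

/-- `bd` admits a closed collar inside `X`. -/
def HasBoundaryCollar (X : Type*) [TopologicalSpace X] (bd : Set X) : Prop :=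
  ∃ φ : C((↥bd) × unitInterval, X), IsClosedEmbedding φ ∧ (∀ x : bd, φ (x, 0) = (x : X)) ∧
    Set.range φ ∈ nhdsSet bd ∧ ∀ (x : bd) (t : unitInterval), φ (x, t) ∈ bd ↔ t = 0

/-- Encoding of "`X` is a compact connected oriented topological `n`-manifold with
boundary `bd` and (real) relative fundamental cycle `ζ`". -/
structure IsCptMfdBdry (X : Type*) [TopologicalSpace X] (bd : Set X) (n : ℕ)
    (ζ : SingularChain ℝ X n) : Prop where
  compact : CompactSpace X
  connected : ConnectedSpace X
  bd_closed : IsClosed bd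
  collar : HasBoundaryCollar X bd
  fund : IsFundamentalClassData X bd n ζ

/-- Gromov's simplicial volume `‖M‖`: the infimum of the ℓ¹-norms of the relative cycles
representing the (class of the) relative fundamental cycle `ζ`. -/
def simplicialVolume (X : Type*) [TopologicalSpace X] (bd : Set X) (n : ℕ)
    (ζ : SingularChain ℝ X n) : ℝ :=
  sInf { r | ∃ z, z ∈ relativeCycles ℝ X bd n ∧
    z - ζ ∈ relativeBoundaries ℝ X bd n ∧ r = l1Norm z }

/-- The push-forward of the fundamental cycle to the marked space associated to `(X, bd)`. -/
def idealFundamentalRep (X : Type*) [TopologicalSpace X] (bd : Set X) (n : ℕ)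
    (ζ : SingularChain ℝ X n) : SingularChain ℝ (Collapse X bd) n :=
  pushChain ℝ (collapseMap X bd) n ζ

/-- `z` is a marked cycle representing the ideal fundamental class `[M, ∂M]^M`. -/
def IdealRepresents (X : Type*) [TopologicalSpace X] (bd : Set X) (n : ℕ)
    (ζ : SingularChain ℝ X n) (z : SingularChain ℝ (Collapse X bd) n) : Prop :=
  z ∈ markedCycles ℝ (Collapse X bd) (collapsedBoundary X bd) n ∧
    z - idealFundamentalRep X bd n ζ ∈
      relativeBoundaries ℝ (Collapse X bd) (collapsedBoundary X bd) n

/-- The ideal simplicial volume `‖M‖_I`: the infimum of the ℓ¹-norms of the marked cycles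
representing the ideal fundamental class. -/
def idealSimplicialVolume (X : Type*) [TopologicalSpace X] (bd : Set X) (n : ℕ)
    (ζ : SingularChain ℝ X n) : ℝ :=
  sInf { r | ∃ z, IdealRepresents X bd n ζ z ∧ r = l1Norm z }

/-- A group is amenable if it admits a left-invariant, finitely additive probability mean
on all its subsets. -/
def IsAmenable (G : Type*) [Group G] : Prop :=
  ∃ m : Set G → ℝ, (∀ A, 0 ≤ m A) ∧ m Set.univ = 1 ∧
    (∀ A B : Set G, Disjoint A B → m (A ∪ B) = m A + m B) ∧
    (∀ (g : G) (A : Set G), m ((g * ·) '' A) = m A)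

namespace SimplicialVolume

/-! ### Ordered chains -/

/-- Ordered chains on a vertex set. -/
abbrev OChain (V : Type*) (n : ℕ) := (Fin (n + 1) → V) →₀ ℝ

variable {V W : Type*} {n : ℕ}

/-- The boundary of ordered chains. -/
def oBoundary (V : Type*) (n : ℕ) : OChain V (n + 1) →ₗ[ℝ] OChain V n :=
  Finsupp.linearCombination ℝ fun v =>
    ∑ i : Fin (n + 2), (-1 : ℝ) ^ (i : ℕ) • Finsupp.single (v ∘ i.succAbove) 1

/-- The cone operator on ordered chains. -/
def oCone (p : V) (n : ℕ) : OChain V n →ₗ[ℝ] OChain V (n + 1) :=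
  Finsupp.lmapDomain ℝ ℝ fun v => Fin.cons (α := fun _ => V) p v

/-- The augmentation of ordered chains. -/
def oAug (V : Type*) : OChain V 0 →ₗ[ℝ] ℝ := Finsupp.linearCombination ℝ fun _ => 1

/-- Functoriality of ordered chains. -/
def oMap (g : V → W) (n : ℕ) : OChain V n →ₗ[ℝ] OChain W n :=
  Finsupp.lmapDomain ℝ ℝ fun v => g ∘ v

lemma oBoundary_single (v : Fin (n + 2) → V) :
    oBoundary V n (Finsupp.single v 1) =
      ∑ i : Fin (n + 2), (-1 : ℝ) ^ (i : ℕ) • Finsupp.single (v ∘ i.succAbove) 1 := by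
  simp [oBoundary]

lemma oCone_single (p : V) (v : Fin (n + 1) → V) :
    oCone p n (Finsupp.single v 1) = Finsupp.single (Fin.cons (α := fun _ => V) p v) 1 := by
  simp [oCone, Finsupp.mapDomain_single]

lemma oMap_single (g : V → W) (v : Fin (n + 1) → V) :
    oMap g n (Finsupp.single v 1) = Finsupp.single (g ∘ v) 1 := by
  simp [oMap, Finsupp.mapDomain_single]

lemma oAug_single (v : Fin 1 → V) : oAug V (Finsupp.single v 1) = 1 := by
  simp [oAug]

lemma ochain_hom_ext {M : Type*} [AddCommMonoid M] [Module ℝ M] {S : Type*}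
    {f g : (S →₀ ℝ) →ₗ[ℝ] M}
    (h : ∀ v, f (Finsupp.single v 1) = g (Finsupp.single v 1)) : f = g :=
  Finsupp.lhom_ext' fun v => LinearMap.ext_ring (h v)

lemma cons_comp_succAbove_succ (p : V) (v : Fin (n + 2) → V) (i : Fin (n + 2)) :
    (Fin.cons (α := fun _ => V) p v) ∘ i.succ.succAbove =
      Fin.cons (α := fun _ => V) p (v ∘ i.succAbove) := by
  funext j
  refine Fin.cases ?_ (fun j => ?_) j <;> simp

lemma oBoundary_cone (p : V) (c : OChain V (n + 1)) :
    oBoundary V (n + 1) (oCone p (n + 1) c) = c - oCone p n (oBoundary V n c) := by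
  have : (oBoundary V (n + 1)).comp (oCone p (n + 1)) =
      LinearMap.id - (oCone p n).comp (oBoundary V n) := by
    refine ochain_hom_ext fun v => ?_
    simp only [LinearMap.comp_apply, LinearMap.sub_apply, LinearMap.id_apply, oCone_single,
      oBoundary_single, map_sum, map_smul]
    rw [Fin.sum_univ_succ]
    simp only [cons_comp_succAbove_succ, Fin.val_succ, pow_succ, mul_neg, mul_one, neg_smul,
      Finset.sum_neg_distrib, Fin.val_zero, pow_zero, one_smul, sub_eq_add_neg]
    congr 1
  exact LinearMap.congr_fun this c

lemma oBoundary_cone_zero (p : V) (c : OChain V 0) :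
    oBoundary V 0 (oCone p 0 c) = c - oAug V c • Finsupp.single (fun _ => p) 1 := by
  have : (oBoundary V 0).comp (oCone p 0) =
      LinearMap.id - (oAug V).smulRight (Finsupp.single (fun _ => p) 1) := by
    refine ochain_hom_ext fun v => ?_
    simp only [LinearMap.comp_apply, LinearMap.sub_apply, LinearMap.id_apply, oCone_single,
      oBoundary_single, LinearMap.smulRight_apply, oAug_single]
    rw [Fin.sum_univ_two]
    have h0 : (Fin.cons (α := fun _ => V) p v) ∘ (0 : Fin 2).succAbove = v := by
      funext j; simp
    have h1 : (Fin.cons (α := fun _ => V) p v) ∘ (1 : Fin 2).succAbove = fun _ => p := by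
      funext j
      have : j = 0 := Subsingleton.elim _ _
      subst this
      simp
    rw [h0, h1]
    simp [sub_eq_add_neg]
  exact LinearMap.congr_fun this c

lemma oAug_boundary (c : OChain V 1) : oAug V (oBoundary V 0 c) = 0 := by
  have : (oAug V).comp (oBoundary V 0) = 0 := by
    refine ochain_hom_ext fun v => ?_
    simp [oBoundary_single, oAug_single, Fin.sum_univ_two]
  exact LinearMap.congr_fun this c

lemma single_eq_cone (v : Fin (n + 2) → V) :
    (Finsupp.single v 1 : OChain V (n + 1)) =
      oCone (v 0) n (Finsupp.single (Fin.tail v) 1) := by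
  rw [oCone_single, Fin.cons_self_tail]

lemma oBoundary_oBoundary (c : OChain V (n + 2)) :
    oBoundary V n (oBoundary V (n + 1) c) = 0 := by
  induction n with
  | zero =>
    have : (oBoundary V 0).comp (oBoundary V 1) = 0 := by
      refine ochain_hom_ext fun v => ?_
      rw [single_eq_cone, LinearMap.comp_apply, oBoundary_cone, map_sub, oBoundary_cone_zero,
        oAug_boundary]
      simp
    exact LinearMap.congr_fun this c
  | succ n ih =>
    have : (oBoundary V (n + 1)).comp (oBoundary V (n + 2)) = 0 := by
      refine ochain_hom_ext fun v => ?_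
      rw [single_eq_cone, LinearMap.comp_apply, oBoundary_cone, map_sub, oBoundary_cone, ih]
      simp
    exact LinearMap.congr_fun this c

lemma oMap_oBoundary (g : V → W) (c : OChain V (n + 1)) :
    oMap g n (oBoundary V n c) = oBoundary W n (oMap g (n + 1) c) := by
  have : (oMap g n).comp (oBoundary V n) = (oBoundary W n).comp (oMap g (n + 1)) := by
    refine ochain_hom_ext fun v => ?_
    simp only [LinearMap.comp_apply, oBoundary_single, map_sum, map_smul, oMap_single,
      Function.comp_assoc]
  exact LinearMap.congr_fun this c

lemma oMap_oCone (g : V → W) (p : V) (c : OChain V n) :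
    oMap g (n + 1) (oCone p n c) = oCone (g p) n (oMap g n c) := by
  have : (oMap g (n + 1)).comp (oCone p n) = (oCone (g p) n).comp (oMap g n) := by
    refine ochain_hom_ext fun v => ?_
    simp only [LinearMap.comp_apply, oCone_single, oMap_single]
    congr 1
    funext j
    refine Fin.cases ?_ (fun j => ?_) j <;> simp
  exact LinearMap.congr_fun this c

lemma oMap_oMap {U : Type*} (g : V → W) (g' : W → U) (c : OChain V n) :
    oMap g' n (oMap g n c) = oMap (g' ∘ g) n c := by
  have : (oMap g' n).comp (oMap g n) = oMap (g' ∘ g) n := by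
    refine ochain_hom_ext fun v => ?_
    simp [oMap_single, Function.comp_assoc]
  exact LinearMap.congr_fun this c

lemma oAug_oMap (g : V → W) (c : OChain V 0) : oAug W (oMap g 0 c) = oAug V c := by
  have : (oAug W).comp (oMap g 0) = oAug V := by
    refine ochain_hom_ext fun v => ?_
    simp [oMap_single, oAug_single]
  exact LinearMap.congr_fun this c

/-! ### Homotopies by acyclic models -/

/-- The homotopy obtained by coning off a chain map inductively. -/
def oHomotopy (p : ∀ n, (Fin (n + 1) → V) → W) (φ : ∀ n, OChain V n →ₗ[ℝ] OChain W n) :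
    ∀ n, OChain V n →ₗ[ℝ] OChain W (n + 1)
  | 0 => Finsupp.linearCombination ℝ fun v => oCone (p 0 v) 0 (φ 0 (Finsupp.single v 1))
  | n + 1 => Finsupp.linearCombination ℝ fun v => oCone (p (n + 1) v) (n + 1)
      (φ (n + 1) (Finsupp.single v 1) -
        oHomotopy p φ n (oBoundary V n (Finsupp.single v 1)))

section Homotopy

variable (p : ∀ n, (Fin (n + 1) → V) → W) (φ : ∀ n, OChain V n →ₗ[ℝ] OChain W n)

lemma oHomotopy_zero_single (v : Fin 1 → V) :
    oHomotopy p φ 0 (Finsupp.single v 1) = oCone (p 0 v) 0 (φ 0 (Finsupp.single v 1)) := by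
  simp [oHomotopy]

lemma oHomotopy_succ_single (v : Fin (n + 2) → V) :
    oHomotopy p φ (n + 1) (Finsupp.single v 1) = oCone (p (n + 1) v) (n + 1)
      (φ (n + 1) (Finsupp.single v 1) -
        oHomotopy p φ n (oBoundary V n (Finsupp.single v 1))) := by
  simp [oHomotopy]

variable {φ}

lemma oBoundary_oHomotopy_zero (haug : ∀ c, oAug W (φ 0 c) = 0) (c : OChain V 0) :
    oBoundary W 0 (oHomotopy p φ 0 c) = φ 0 c := by
  have : (oBoundary W 0).comp (oHomotopy p φ 0) = φ 0 := by
    refine ochain_hom_ext fun v => ?_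
    rw [LinearMap.comp_apply, oHomotopy_zero_single, oBoundary_cone_zero, haug]
    simp
  exact LinearMap.congr_fun this c

lemma oBoundary_oHomotopy_succ (haug : ∀ c, oAug W (φ 0 c) = 0)
    (hφ : ∀ n c, oBoundary W n (φ (n + 1) c) = φ n (oBoundary V n c)) (c : OChain V (n + 1)) :
    oBoundary W (n + 1) (oHomotopy p φ (n + 1) c) =
      φ (n + 1) c - oHomotopy p φ n (oBoundary V n c) := by
  induction n with
  | zero =>
    have : (oBoundary W 1).comp (oHomotopy p φ 1) =
        φ 1 - (oHomotopy p φ 0).comp (oBoundary V 0) := by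
      refine ochain_hom_ext fun v => ?_
      rw [LinearMap.comp_apply, oHomotopy_succ_single, oBoundary_cone, map_sub (oBoundary W 0),
        hφ, oBoundary_oHomotopy_zero p haug]
      simp
    exact LinearMap.congr_fun this c
  | succ n ih =>
    have : (oBoundary W (n + 2)).comp (oHomotopy p φ (n + 2)) =
        φ (n + 2) - (oHomotopy p φ (n + 1)).comp (oBoundary V (n + 1)) := by
      refine ochain_hom_ext fun v => ?_
      rw [LinearMap.comp_apply, oHomotopy_succ_single, oBoundary_cone,
        map_sub (oBoundary W (n + 1)), hφ, ih, oBoundary_oBoundary]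
      simp
    exact LinearMap.congr_fun this c

lemma oMap_oHomotopy {V' W' : Type*} {p' : ∀ n, (Fin (n + 1) → V') → W'}
    {φ' : ∀ n, OChain V' n →ₗ[ℝ] OChain W' n} (g : V → V') (g' : W → W')
    (hp : ∀ n v, g' (p n v) = p' n (g ∘ v))
    (hφ : ∀ n c, oMap g' n (φ n c) = φ' n (oMap g n c)) (c : OChain V n) :
    oMap g' (n + 1) (oHomotopy p φ n c) = oHomotopy p' φ' n (oMap g n c) := by
  induction n with
  | zero =>
    have : (oMap g' 1).comp (oHomotopy p φ 0) = (oHomotopy p' φ' 0).comp (oMap g 0) := by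
      refine ochain_hom_ext fun v => ?_
      simp only [LinearMap.comp_apply, oHomotopy_zero_single, oMap_single, oMap_oCone, hp, hφ]
    exact LinearMap.congr_fun this c
  | succ n ih =>
    have : (oMap g' (n + 2)).comp (oHomotopy p φ (n + 1)) =
        (oHomotopy p' φ' (n + 1)).comp (oMap g (n + 1)) := by
      refine ochain_hom_ext fun v => ?_
      simp only [LinearMap.comp_apply, oHomotopy_succ_single, oMap_single, oMap_oCone, hp, hφ,
        map_sub, ih, oMap_oBoundary]
    exact LinearMap.congr_fun this c

end Homotopy

/-! ### Subdivision of ordered chains -/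

/-- Subdivision with respect to a choice of barycenters. -/
def oSd (p : ∀ n, (Fin (n + 1) → V) → V) : ∀ n, OChain V n →ₗ[ℝ] OChain V n
  | 0 => LinearMap.id
  | n + 1 => Finsupp.linearCombination ℝ fun v => oCone (p (n + 1) v) n
      (oSd p n (oBoundary V n (Finsupp.single v 1)))

lemma oSd_succ_single (p : ∀ n, (Fin (n + 1) → V) → V) (v : Fin (n + 2) → V) :
    oSd p (n + 1) (Finsupp.single v 1) = oCone (p (n + 1) v) n
      (oSd p n (oBoundary V n (Finsupp.single v 1))) := by
  simp [oSd]

lemma oBoundary_oSd (p : ∀ n, (Fin (n + 1) → V) → V) (c : OChain V (n + 1)) :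
    oBoundary V n (oSd p (n + 1) c) = oSd p n (oBoundary V n c) := by
  induction n with
  | zero =>
    have : (oBoundary V 0).comp (oSd p 1) = (oSd p 0).comp (oBoundary V 0) := by
      refine ochain_hom_ext fun v => ?_
      rw [LinearMap.comp_apply, oSd_succ_single, oBoundary_cone_zero]
      simp [oSd, oAug_boundary]
    exact LinearMap.congr_fun this c
  | succ n ih =>
    have : (oBoundary V (n + 1)).comp (oSd p (n + 2)) =
        (oSd p (n + 1)).comp (oBoundary V (n + 1)) := by
      refine ochain_hom_ext fun v => ?_
      rw [LinearMap.comp_apply, oSd_succ_single, oBoundary_cone, ih, oBoundary_oBoundary]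
      simp
    exact LinearMap.congr_fun this c

lemma oMap_oSd {p : ∀ n, (Fin (n + 1) → V) → V} {p' : ∀ n, (Fin (n + 1) → W) → W}
    (g : V → W) (hp : ∀ n v, g (p n v) = p' n (g ∘ v)) (c : OChain V n) :
    oMap g n (oSd p n c) = oSd p' n (oMap g n c) := by
  induction n with
  | zero => rfl
  | succ n ih =>
    have : (oMap g (n + 1)).comp (oSd p (n + 1)) = (oSd p' (n + 1)).comp (oMap g (n + 1)) := by
      refine ochain_hom_ext fun v => ?_
      simp only [LinearMap.comp_apply, oSd_succ_single, oMap_single, oMap_oCone, hp, ih,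
        oMap_oBoundary]
    exact LinearMap.congr_fun this c

/-- The homotopy between the identity and subdivision. -/
def oT (p : ∀ n, (Fin (n + 1) → V) → V) (n : ℕ) : OChain V n →ₗ[ℝ] OChain V (n + 1) :=
  oHomotopy p (fun n => LinearMap.id - oSd p n) n

lemma oBoundary_oT_zero (p : ∀ n, (Fin (n + 1) → V) → V) (c : OChain V 0) :
    oBoundary V 0 (oT p 0 c) = c - oSd p 0 c :=
  oBoundary_oHomotopy_zero p (φ := fun n => LinearMap.id - oSd p n)
    (fun c => by simp [oSd]) c

lemma oBoundary_oT_succ (p : ∀ n, (Fin (n + 1) → V) → V) (c : OChain V (n + 1)) :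
    oBoundary V (n + 1) (oT p (n + 1) c) = c - oSd p (n + 1) c - oT p n (oBoundary V n c) :=
  oBoundary_oHomotopy_succ p (φ := fun n => LinearMap.id - oSd p n)
    (fun c => by simp [oSd]) (fun n c => by simp [oBoundary_oSd]) c

lemma oMap_oT {p : ∀ n, (Fin (n + 1) → V) → V} {p' : ∀ n, (Fin (n + 1) → W) → W}
    (g : V → W) (hp : ∀ n v, g (p n v) = p' n (g ∘ v)) (c : OChain V n) :
    oMap g (n + 1) (oT p n c) = oT p' n (oMap g n c) :=
  oMap_oHomotopy _ g g hp (fun n c => by simp [oMap_oSd g hp]) c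

/-- The prism operator on ordered chains. -/
def oPrism (V : Type*) (n : ℕ) : OChain V n →ₗ[ℝ] OChain (unitInterval × V) (n + 1) :=
  oHomotopy (fun _ v => (0, v 0)) (fun n => oMap (fun x => (1, x)) n - oMap (fun x => (0, x)) n) n

lemma oBoundary_oPrism_zero (c : OChain V 0) :
    oBoundary _ 0 (oPrism V 0 c) = oMap (fun x => (1, x)) 0 c - oMap (fun x => (0, x)) 0 c :=
  oBoundary_oHomotopy_zero _
    (φ := fun n => oMap (fun x : V => ((1 : unitInterval), x)) n - oMap (fun x => (0, x)) n)
    (fun c => by simp [oAug_oMap]) c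

lemma oBoundary_oPrism_succ (c : OChain V (n + 1)) :
    oBoundary _ (n + 1) (oPrism V (n + 1) c) =
      oMap (fun x => (1, x)) (n + 1) c - oMap (fun x => (0, x)) (n + 1) c
        - oPrism V n (oBoundary V n c) :=
  oBoundary_oHomotopy_succ _
    (φ := fun n => oMap (fun x : V => ((1 : unitInterval), x)) n - oMap (fun x => (0, x)) n)
    (fun c => by simp [oAug_oMap]) (fun n c => by simp [oMap_oBoundary]) c

lemma oMap_oPrism (g : V → W) (c : OChain V n) :
    oMap (Prod.map id g) (n + 1) (oPrism V n c) = oPrism W n (oMap g n c) :=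
  oMap_oHomotopy _ g (Prod.map id g) (fun _ _ => rfl)
    (fun n c => by simp only [LinearMap.sub_apply, map_sub, oMap_oMap]; rfl) c

/-! ### Affine simplices -/

/-- The vertices of the standard simplex. -/
def vert (n : ℕ) (i : Fin (n + 1)) : TopSimplex n := ⟨Pi.single i 1, single_mem_stdSimplex ℝ i⟩

/-- The barycenter of the standard simplex. -/
def center (n : ℕ) : TopSimplex n :=
  ⟨fun _ => 1 / ((n : ℝ) + 1), fun _ => by positivity, by
    simp; field_simp⟩

section Affine

variable {E : Type*} [NormedAddCommGroup E] [NormedSpace ℝ E] {K : Set E} {n : ℕ}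

/-- The affine simplex with given vertices in a convex set. -/
def aff (hK : Convex ℝ K) (v : Fin (n + 1) → K) : C(TopSimplex n, K) where
  toFun x := ⟨∑ i, x.1 i • (v i).1,
    hK.sum_mem (fun i _ => x.2.1 i) x.2.2 (fun i _ => (v i).2)⟩
  continuous_toFun := by
    refine Continuous.subtype_mk ?_ _
    refine continuous_finsetSum _ fun i _ => ?_
    exact ((continuous_apply i).comp continuous_subtype_val).smul continuous_const

lemma aff_coe (hK : Convex ℝ K) (v : Fin (n + 1) → K) (x : TopSimplex n) :
    (aff hK v x).1 = ∑ i, x.1 i • (v i).1 := rfl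

lemma coface_coe (i : Fin (n + 2)) (x : TopSimplex n) (j : Fin (n + 2)) :
    (coface i x).1 j = ∑ k : Fin (n + 1), if i.succAbove k = j then x.1 k else 0 := rfl

lemma aff_comp_coface (hK : Convex ℝ K) (v : Fin (n + 2) → K) (i : Fin (n + 2)) :
    (aff hK v).comp (coface i) = aff hK (v ∘ i.succAbove) := by
  ext x : 1
  apply Subtype.ext
  rw [ContinuousMap.comp_apply, aff_coe, aff_coe]
  simp only [coface_coe, Finset.sum_smul]
  rw [Finset.sum_comm]
  refine Finset.sum_congr rfl fun k _ => ?_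
  simp [ite_smul]

lemma aff_vert (hK : Convex ℝ K) (v : Fin (n + 1) → K) (i : Fin (n + 1)) :
    aff hK v (vert n i) = v i := by
  apply Subtype.ext
  rw [aff_coe]
  simp [vert, Pi.single_apply, ite_smul]

/-- Affine simplices in the standard simplex. -/
def affS {n m : ℕ} (v : Fin (n + 1) → TopSimplex m) : C(TopSimplex n, TopSimplex m) :=
  aff (convex_stdSimplex ℝ (Fin (m + 1))) v

lemma affS_coe {m : ℕ} (v : Fin (n + 1) → TopSimplex m) (x : TopSimplex n) (j : Fin (m + 1)) :
    (affS v x).1 j = ∑ i, x.1 i * (v i).1 j := by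
  rw [affS, aff_coe]; simp

lemma affS_vert {m : ℕ} (v : Fin (n + 1) → TopSimplex m) (i : Fin (n + 1)) :
    affS v (vert n i) = v i := aff_vert _ v i

lemma affS_comp_coface {m : ℕ} (v : Fin (n + 2) → TopSimplex m) (i : Fin (n + 2)) :
    (affS v).comp (coface i) = affS (v ∘ i.succAbove) := aff_comp_coface _ v i

lemma affS_vert_eq_id : affS (vert n) = ContinuousMap.id _ := by
  ext x : 1
  apply Subtype.ext
  funext j
  rw [affS_coe]
  simp [vert, Pi.single_apply]

lemma affS_comp_affS {m l : ℕ} (w : Fin (m + 1) → TopSimplex l) (v : Fin (n + 1) → TopSimplex m) :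
    (affS w).comp (affS v) = affS (affS w ∘ v) := by
  ext x : 1
  apply Subtype.ext
  funext j
  rw [ContinuousMap.comp_apply, affS_coe, affS_coe]
  simp only [affS_coe, Finset.sum_mul, Function.comp_apply, Finset.mul_sum, mul_assoc]
  rw [Finset.sum_comm]

lemma coface_eq_affS (i : Fin (n + 2)) : coface i = affS (vert (n + 1) ∘ i.succAbove) := by
  rw [← affS_comp_coface, affS_vert_eq_id, ContinuousMap.id_comp]

lemma coface_vert (i : Fin (n + 2)) : coface i ∘ vert n = vert (n + 1) ∘ i.succAbove := by
  funext j
  rw [coface_eq_affS]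
  exact affS_vert _ j

/-- The barycenter of a tuple of points of the standard simplex. -/
def bary {m : ℕ} (n : ℕ) (v : Fin (n + 1) → TopSimplex m) : TopSimplex m := affS v (center n)

lemma affS_bary {m l : ℕ} (w : Fin (m + 1) → TopSimplex l) (n : ℕ)
    (v : Fin (n + 1) → TopSimplex m) : affS w (bary n v) = bary n (affS w ∘ v) := by
  unfold bary
  rw [← affS_comp_affS]
  rfl

end Affine

/-! ### Realization of ordered chains -/

/-- A coherent way of turning ordered tuples into singular simplices. -/
structure Realization (V : Type*) (D : Type*) [TopologicalSpace D] where
  map : ∀ n, (Fin (n + 1) → V) → C(TopSimplex n, D)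
  face : ∀ n v i, (map (n + 1) v).comp (coface i) = map n (v ∘ i.succAbove)

variable {X : Type*} [TopologicalSpace X] {n : ℕ}

lemma boundary_single (σ : SingularSimplex X (n + 1)) :
    boundary ℝ X n (Finsupp.single σ 1) =
      ∑ i : Fin (n + 2), (-1 : ℝ) ^ (i : ℕ) • Finsupp.single (σ.comp (coface i)) 1 := by
  simp [boundary, boundaryOf]

/-- Realization of chains, followed by a continuous map. -/
def Realization.chain {V D : Type*} [TopologicalSpace D] (R : Realization V D) (G : C(D, X))
    (n : ℕ) : OChain V n →ₗ[ℝ] SingularChain ℝ X n :=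
  Finsupp.lmapDomain ℝ ℝ fun v => G.comp (R.map n v)

section Realization

variable {V D : Type*} [TopologicalSpace D] (R : Realization V D) (G : C(D, X))

lemma Realization.chain_single (v : Fin (n + 1) → V) :
    R.chain G n (Finsupp.single v 1) = Finsupp.single (G.comp (R.map n v)) 1 := by
  simp [Realization.chain, Finsupp.mapDomain_single]

lemma Realization.boundary_chain (c : OChain V (n + 1)) :
    boundary ℝ X n (R.chain G (n + 1) c) = R.chain G n (oBoundary V n c) := by
  have : (boundary ℝ X n).comp (R.chain G (n + 1)) = (R.chain G n).comp (oBoundary V n) := by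
    refine ochain_hom_ext fun v => ?_
    simp only [LinearMap.comp_apply, oBoundary_single, map_sum, map_smul, R.chain_single,
      boundary_single, ContinuousMap.comp_assoc, R.face]
  exact LinearMap.congr_fun this c

lemma Realization.chain_mem_span (P : SingularSimplex X n → Prop) (c : OChain V n)
    (h : ∀ v ∈ c.support, P (G.comp (R.map n v))) :
    R.chain G n c ∈ Submodule.span ℝ {c | ∃ σ : SingularSimplex X n, P σ ∧
      c = Finsupp.single σ 1} := by
  have : R.chain G n c = c.sum fun v r => r • Finsupp.single (G.comp (R.map n v)) 1 := by
    simp [Realization.chain, Finsupp.mapDomain]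
  rw [this]
  exact Submodule.sum_mem _ fun v hv =>
    Submodule.smul_mem _ _ (Submodule.subset_span ⟨_, h v hv, rfl⟩)

lemma Realization.chain_mem_chainsIn {B : Set X} (h : Set.range G ⊆ B) (c : OChain V n) :
    R.chain G n c ∈ chainsIn ℝ X B n :=
  R.chain_mem_span G (fun σ => Set.range σ ⊆ B) c fun v _ => by
    rintro _ ⟨x, rfl⟩
    exact h ⟨_, rfl⟩

end Realization

/-- Affine realization in a standard simplex. -/
def simplexReal (m : ℕ) : Realization (TopSimplex m) (TopSimplex m) where
  map _ v := affS v
  face _ v i := affS_comp_coface v i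

lemma convex_unitInterval : Convex ℝ (unitInterval : Set ℝ) := convex_Icc 0 1

/-- Affine realization in a prism. -/
def prismReal (m : ℕ) : Realization (unitInterval × TopSimplex m) (unitInterval × TopSimplex m) where
  map _ v := (aff convex_unitInterval fun i => (v i).1).prodMk (affS fun i => (v i).2)
  face n v i := by
    have h1 := aff_comp_coface convex_unitInterval (fun i => (v i).1) i
    have h2 := affS_comp_coface (fun i => (v i).2) i
    ext x : 1
    exact Prod.ext (congrArg (fun f => f x) h1) (congrArg (fun f => f x) h2)

lemma simplexReal_chain_oMap {m l : ℕ} (σ : C(TopSimplex l, X)) (w : Fin (m + 1) → TopSimplex l)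
    (c : OChain (TopSimplex m) n) :
    (simplexReal l).chain σ n (oMap (affS w) n c) =
      (simplexReal m).chain (σ.comp (affS w)) n c := by
  have : ((simplexReal l).chain σ n).comp (oMap (affS w) n) =
      (simplexReal m).chain (σ.comp (affS w)) n := by
    refine ochain_hom_ext fun v => ?_
    rw [LinearMap.comp_apply, oMap_single, Realization.chain_single, Realization.chain_single,
      ContinuousMap.comp_assoc]
    exact congrArg (fun s => Finsupp.single (σ.comp s) 1) (affS_comp_affS w v).symm
  exact LinearMap.congr_fun this c

lemma simplexReal_chain_vert (σ : SingularSimplex X n) :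
    (simplexReal n).chain σ n (Finsupp.single (vert n) 1) = Finsupp.single σ 1 := by
  rw [Realization.chain_single]
  congr 1
  exact (congrArg σ.comp affS_vert_eq_id).trans (ContinuousMap.comp_id σ)

lemma boundary_boundary (c : SingularChain ℝ X (n + 2)) :
    boundary ℝ X n (boundary ℝ X (n + 1) c) = 0 := by
  have : (boundary ℝ X n).comp (boundary ℝ X (n + 1)) = 0 := by
    refine ochain_hom_ext fun σ => ?_
    rw [LinearMap.comp_apply, ← simplexReal_chain_vert, Realization.boundary_chain,
      Realization.boundary_chain, oBoundary_oBoundary]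
    simp
  exact LinearMap.congr_fun this c

/-! ### Natural operators on singular chains -/

/-- The operator on singular chains induced by an operator on ordered chains of simplices. -/
def natOp (X : Type*) [TopologicalSpace X] {n k : ℕ}
    (φ : OChain (TopSimplex n) n →ₗ[ℝ] OChain (TopSimplex n) k) :
    SingularChain ℝ X n →ₗ[ℝ] SingularChain ℝ X k :=
  Finsupp.linearCombination ℝ fun σ =>
    (simplexReal n).chain σ k (φ (Finsupp.single (vert n) 1))

lemma natOp_single {k : ℕ} (φ : OChain (TopSimplex n) n →ₗ[ℝ] OChain (TopSimplex n) k)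
    (σ : SingularSimplex X n) :
    natOp X φ (Finsupp.single σ 1) =
      (simplexReal n).chain σ k (φ (Finsupp.single (vert n) 1)) := by
  simp [natOp]

lemma natOp_chain {k m : ℕ} (φ : ∀ m, OChain (TopSimplex m) n →ₗ[ℝ] OChain (TopSimplex m) k)
    (hφ : ∀ (m l) (w : Fin (m + 1) → TopSimplex l) c,
      oMap (affS w) k (φ m c) = φ l (oMap (affS w) n c))
    (σ : C(TopSimplex m, X)) (c : OChain (TopSimplex m) n) :
    natOp X (φ n) ((simplexReal m).chain σ n c) = (simplexReal m).chain σ k (φ m c) := by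
  have : (natOp X (φ n)).comp ((simplexReal m).chain σ n) =
      ((simplexReal m).chain σ k).comp (φ m) := by
    refine ochain_hom_ext fun v => ?_
    rw [LinearMap.comp_apply, Realization.chain_single, natOp_single]
    have h : (Finsupp.single v 1 : OChain (TopSimplex m) n) =
        oMap (affS v) n (Finsupp.single (vert n) 1) := by
      rw [oMap_single]
      congr 1
      funext i
      exact (affS_vert v i).symm
    rw [LinearMap.comp_apply, h, ← hφ, simplexReal_chain_oMap]
    rfl
  exact LinearMap.congr_fun this c

/-- Barycentric subdivision of singular chains. -/
def Sd (X : Type*) [TopologicalSpace X] (n : ℕ) : SingularChain ℝ X n →ₗ[ℝ] SingularChain ℝ X n :=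
  natOp X (oSd bary n)

/-- The homotopy from the identity to barycentric subdivision. -/
def sdT (X : Type*) [TopologicalSpace X] (n : ℕ) :
    SingularChain ℝ X n →ₗ[ℝ] SingularChain ℝ X (n + 1) :=
  natOp X (oT bary n)

lemma Sd_chain {m : ℕ} (σ : C(TopSimplex m, X)) (c : OChain (TopSimplex m) n) :
    Sd X n ((simplexReal m).chain σ n c) = (simplexReal m).chain σ n (oSd bary n c) :=
  natOp_chain (fun m => oSd (bary (m := m)) n)
    (fun _ _ w c => oMap_oSd (affS w) (fun n v => affS_bary w n v) c) σ c

lemma sdT_chain {m : ℕ} (σ : C(TopSimplex m, X)) (c : OChain (TopSimplex m) n) :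
    sdT X n ((simplexReal m).chain σ n c) = (simplexReal m).chain σ (n + 1) (oT bary n c) :=
  natOp_chain (fun m => oT (bary (m := m)) n)
    (fun _ _ w c => oMap_oT (affS w) (fun n v => affS_bary w n v) c) σ c

lemma boundary_Sd (c : SingularChain ℝ X (n + 1)) :
    boundary ℝ X n (Sd X (n + 1) c) = Sd X n (boundary ℝ X n c) := by
  have : (boundary ℝ X n).comp (Sd X (n + 1)) = (Sd X n).comp (boundary ℝ X n) := by
    refine ochain_hom_ext fun σ => ?_
    rw [LinearMap.comp_apply, LinearMap.comp_apply, ← simplexReal_chain_vert, Sd_chain,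
      Realization.boundary_chain, Realization.boundary_chain, Sd_chain, oBoundary_oSd]
  exact LinearMap.congr_fun this c

lemma boundary_sdT_zero (c : SingularChain ℝ X 0) :
    boundary ℝ X 0 (sdT X 0 c) = c - Sd X 0 c := by
  have : (boundary ℝ X 0).comp (sdT X 0) = LinearMap.id - Sd X 0 := by
    refine ochain_hom_ext fun σ => ?_
    rw [LinearMap.comp_apply, LinearMap.sub_apply, ← simplexReal_chain_vert, sdT_chain,
      Realization.boundary_chain, oBoundary_oT_zero, Sd_chain, map_sub]
    rfl
  exact LinearMap.congr_fun this c

lemma boundary_sdT_succ (c : SingularChain ℝ X (n + 1)) :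
    boundary ℝ X (n + 1) (sdT X (n + 1) c) =
      c - Sd X (n + 1) c - sdT X n (boundary ℝ X n c) := by
  have : (boundary ℝ X (n + 1)).comp (sdT X (n + 1)) =
      LinearMap.id - Sd X (n + 1) - (sdT X n).comp (boundary ℝ X n) := by
    refine ochain_hom_ext fun σ => ?_
    simp only [LinearMap.comp_apply, LinearMap.sub_apply]
    rw [← simplexReal_chain_vert, sdT_chain, Realization.boundary_chain, oBoundary_oT_succ,
      Sd_chain, Realization.boundary_chain, sdT_chain, map_sub, map_sub]
    rfl
  exact LinearMap.congr_fun this c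

/-! ### Prisms -/

/-- The slice of a homotopy at a given time. -/
def slice {D : Type*} [TopologicalSpace D] (G : C(unitInterval × D, X)) (t : unitInterval) :
    C(D, X) := G.comp ((ContinuousMap.const _ t).prodMk (ContinuousMap.id _))

@[simp] lemma slice_apply {D : Type*} [TopologicalSpace D] (G : C(unitInterval × D, X))
    (t : unitInterval) (x : D) : slice G t x = G (t, x) := rfl

/-- Restriction of a homotopy along a map. -/
def restr {D D' : Type*} [TopologicalSpace D] [TopologicalSpace D'] (G : C(unitInterval × D, X))
    (s : C(D', D)) : C(unitInterval × D', X) := G.comp ((ContinuousMap.id _).prodMap s)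

@[simp] lemma restr_apply {D D' : Type*} [TopologicalSpace D] [TopologicalSpace D']
    (G : C(unitInterval × D, X)) (s : C(D', D)) (t : unitInterval) (x : D') :
    restr G s (t, x) = G (t, s x) := rfl

/-- The prism chain of a homotopy. -/
def prism (G : C(unitInterval × TopSimplex n, X)) : SingularChain ℝ X (n + 1) :=
  (prismReal n).chain G (n + 1) (oPrism _ n (Finsupp.single (vert n) 1))

lemma prismReal_chain_oMap_const {m : ℕ} (G : C(unitInterval × TopSimplex m, X))
    (t : unitInterval) (c : OChain (TopSimplex m) n) :
    (prismReal m).chain G n (oMap (fun x => (t, x)) n c) =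
      (simplexReal m).chain (slice G t) n c := by
  have : ((prismReal m).chain G n).comp (oMap (fun x => (t, x)) n) =
      (simplexReal m).chain (slice G t) n := by
    refine ochain_hom_ext fun v => ?_
    rw [LinearMap.comp_apply, oMap_single, Realization.chain_single, Realization.chain_single]
    congr 1
    ext x : 1
    have : aff convex_unitInterval (fun _ : Fin (n + 1) => t) x = t := by
      apply Subtype.ext
      rw [aff_coe, ← Finset.sum_smul, x.2.2, one_smul]
    exact congrArg (fun a => G (a, affS v x)) this
  exact LinearMap.congr_fun this c

lemma prismReal_chain_oMap {m l : ℕ} (G : C(unitInterval × TopSimplex l, X))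
    (w : Fin (m + 1) → TopSimplex l) (c : OChain (unitInterval × TopSimplex m) n) :
    (prismReal l).chain G n (oMap (Prod.map id (affS w)) n c) =
      (prismReal m).chain (restr G (affS w)) n c := by
  have : ((prismReal l).chain G n).comp (oMap (Prod.map id (affS w)) n) =
      (prismReal m).chain (restr G (affS w)) n := by
    refine ochain_hom_ext fun v => ?_
    rw [LinearMap.comp_apply, oMap_single, Realization.chain_single, Realization.chain_single]
    congr 1
    ext x : 1
    have h := congrArg (fun f => f x) (affS_comp_affS w (fun i => (v i).2))
    exact congrArg (fun a => G (aff convex_unitInterval (fun i => (v i).1) x, a)) h.symm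
  exact LinearMap.congr_fun this c

lemma boundary_prism_zero (G : C(unitInterval × TopSimplex 0, X)) :
    boundary ℝ X 0 (prism G) =
      Finsupp.single (slice G 1) 1 - Finsupp.single (slice G 0) 1 := by
  rw [prism, Realization.boundary_chain, oBoundary_oPrism_zero, map_sub,
    prismReal_chain_oMap_const, prismReal_chain_oMap_const, simplexReal_chain_vert,
    simplexReal_chain_vert]

lemma boundary_prism_succ (G : C(unitInterval × TopSimplex (n + 1), X)) :
    boundary ℝ X (n + 1) (prism G) =
      Finsupp.single (slice G 1) 1 - Finsupp.single (slice G 0) 1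
        - ∑ i : Fin (n + 2), (-1 : ℝ) ^ (i : ℕ) • prism (restr G (coface i)) := by
  rw [prism, Realization.boundary_chain, oBoundary_oPrism_succ, map_sub, map_sub,
    prismReal_chain_oMap_const, prismReal_chain_oMap_const, simplexReal_chain_vert,
    simplexReal_chain_vert, oBoundary_single, map_sum, map_sum]
  congr 1
  refine Finset.sum_congr rfl fun i _ => ?_
  rw [map_smul, map_smul, ← coface_vert, ← oMap_single, ← oMap_oPrism, prism]
  congr 1
  rw [coface_eq_affS]
  exact prismReal_chain_oMap G _ _

lemma prism_mem_chainsIn {B : Set X} (G : C(unitInterval × TopSimplex n, X))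
    (h : Set.range G ⊆ B) : prism G ∈ chainsIn ℝ X B (n + 1) :=
  Realization.chain_mem_chainsIn _ _ h _

/-! ### Evaluation of cochains -/

/-- Linear extension of a cochain. -/
def ev (f : SingularSimplex X n → ℝ) : SingularChain ℝ X n →ₗ[ℝ] ℝ :=
  Finsupp.linearCombination ℝ f

lemma ev_single (f : SingularSimplex X n → ℝ) (σ : SingularSimplex X n) :
    ev f (Finsupp.single σ 1) = f σ := by simp [ev]

lemma abs_ev_le {f : SingularSimplex X n → ℝ} {C : ℝ} (hf : ∀ σ, |f σ| ≤ C)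
    (c : SingularChain ℝ X n) : |ev f c| ≤ C * l1Norm c := by
  rw [ev, Finsupp.linearCombination_apply, Finsupp.sum, l1Norm, Finsupp.sum, Finset.mul_sum]
  refine (Finset.abs_sum_le_sum_abs _ _).trans (Finset.sum_le_sum fun σ _ => ?_)
  rw [smul_eq_mul, abs_mul, mul_comm]
  exact mul_le_mul_of_nonneg_right (hf σ) (abs_nonneg _)

lemma ev_eq_zero_of_span {f : SingularSimplex X n → ℝ} {P : SingularSimplex X n → Prop}
    (hf : ∀ σ, P σ → f σ = 0) {c : SingularChain ℝ X n}
    (hc : c ∈ Submodule.span ℝ {c | ∃ σ : SingularSimplex X n, P σ ∧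
      c = Finsupp.single σ 1}) : ev f c = 0 := by
  have : Submodule.span ℝ {c | ∃ σ : SingularSimplex X n, P σ ∧
      c = Finsupp.single σ 1} ≤ LinearMap.ker (ev f) := by
    rw [Submodule.span_le]
    rintro _ ⟨σ, h, rfl⟩
    exact (ev_single f σ).trans (hf σ h)
  exact this hc

lemma l1Norm_nonneg (c : SingularChain ℝ X n) : 0 ≤ l1Norm c :=
  Finset.sum_nonneg fun _ _ => abs_nonneg _

lemma l1Norm_mapDomain_le {S : Type*} (g : S → SingularSimplex X n) (c : S →₀ ℝ) :
    l1Norm (Finsupp.mapDomain g c) ≤ c.sum fun _ r => |r| := by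
  classical
  have key : ∀ σ, |Finsupp.mapDomain g c σ| ≤ ∑ v ∈ c.support, |Finsupp.single (g v) (c v) σ| :=
    fun σ => by
      rw [Finsupp.mapDomain, Finsupp.sum, Finsupp.finsetSum_apply]
      exact Finset.abs_sum_le_sum_abs _ _
  rw [l1Norm, Finsupp.sum]
  refine (Finset.sum_le_sum fun σ _ => key σ).trans ?_
  rw [Finset.sum_comm]
  refine Finset.sum_le_sum fun v _ => ?_
  refine (Finset.sum_le_sum (g := fun σ => if g v = σ then |c v| else 0)
    fun σ _ => ?_).trans ?_
  · rw [Finsupp.single_apply]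
    split_ifs <;> simp
  · rw [Finset.sum_ite_eq]
    split_ifs
    · exact le_rfl
    · exact abs_nonneg _

/-! ### Mesh of the subdivision and small chains -/

section Mesh

variable {n m : ℕ}

lemma dist_affS_le (v : Fin (n + 1) → TopSimplex m) (c : TopSimplex m) {r : ℝ}
    (h : ∀ i, dist (v i) c ≤ r) (x : TopSimplex n) : dist (affS v x) c ≤ r := by
  have hx : (affS v x).1 ∈ Metric.closedBall c.1 r := by
    refine (convex_closedBall c.1 r).sum_mem (fun i _ => x.2.1 i) x.2.2 fun i _ => ?_
    exact h i
  exact hx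

lemma dist_bary_le (v : Fin (n + 1) → TopSimplex m) {D : ℝ}
    (hD : ∀ i j, dist (v i) (v j) ≤ D) (j : Fin (n + 1)) :
    dist (bary n v) (v j) ≤ n / (n + 1) * D := by
  have hn : (0 : ℝ) < n + 1 := by positivity
  have h1 : (bary n v).1 - (v j).1 = ∑ i, (1 / ((n : ℝ) + 1)) • ((v i).1 - (v j).1) := by
    simp only [smul_sub, Finset.sum_sub_distrib, Finset.sum_const, Finset.card_univ,
      Fintype.card_fin]
    congr 1
    rw [← Nat.cast_smul_eq_nsmul ℝ, smul_smul]
    rw [show ((n + 1 : ℕ) : ℝ) * (1 / (n + 1)) = 1 by push_cast; field_simp, one_smul]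
  rw [Subtype.dist_eq, dist_eq_norm, h1]
  refine (norm_sum_le _ _).trans ?_
  have h2 : ∀ i, ‖(1 / ((n : ℝ) + 1)) • ((v i).1 - (v j).1)‖ ≤
      if i = j then 0 else (1 / (n + 1)) * D := fun i => by
    split_ifs with hij
    · simp [hij]
    · rw [norm_smul, Real.norm_of_nonneg (by positivity)]
      refine mul_le_mul_of_nonneg_left ?_ (by positivity)
      rw [← dist_eq_norm]
      exact hD i j
  refine (Finset.sum_le_sum fun i _ => h2 i).trans ?_
  rw [Finset.sum_ite, Finset.sum_const_zero, Finset.sum_const, zero_add]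
  have : (Finset.univ.filter fun i => ¬ i = j).card = n := by
    rw [Finset.filter_not, Finset.card_sdiff_of_subset (Finset.filter_subset _ _)]
    simp [Finset.filter_eq']
  rw [this, nsmul_eq_mul]
  exact le_of_eq (by field_simp)

/-- Ordered chains supported on tuples with a given property. -/
abbrev oSupp {V : Type*} (P : (Fin (n + 1) → V) → Prop) : Submodule ℝ (OChain V n) :=
  Finsupp.supported ℝ ℝ {v | P v}

lemma map_mem_oSupp {V W : Type*} {k : ℕ} {P : (Fin (n + 1) → V) → Prop}
    {Q : (Fin (k + 1) → W) → Prop} (φ : OChain V n →ₗ[ℝ] OChain W k)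
    (h : ∀ v, P v → φ (Finsupp.single v 1) ∈ oSupp Q) {c : OChain V n} (hc : c ∈ oSupp P) :
    φ c ∈ oSupp Q := by
  rw [← Finsupp.sum_single c, Finsupp.sum, map_sum]
  refine Submodule.sum_mem _ fun v hv => ?_
  rw [← Finsupp.smul_single_one, map_smul]
  exact Submodule.smul_mem _ _ (h v (hc hv))

lemma single_mem_oSupp {V : Type*} {P : (Fin (n + 1) → V) → Prop} {v : Fin (n + 1) → V}
    (h : P v) : (Finsupp.single v 1 : OChain V n) ∈ oSupp P :=
  Finsupp.single_mem_supported ℝ 1 h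

lemma oSd_mesh (v : Fin (n + 1) → TopSimplex m) {D : ℝ} (hD0 : 0 ≤ D)
    (hD : ∀ i j, dist (v i) (v j) ≤ D) :
    oSd bary n (Finsupp.single v 1) ∈ oSupp fun w : Fin (n + 1) → TopSimplex m =>
      (∀ c r, (∀ i, dist (v i) c ≤ r) → ∀ j, dist (w j) c ≤ r) ∧
        ∀ i j, dist (w i) (w j) ≤ n / (n + 1) * D := by
  induction n with
  | zero =>
    refine single_mem_oSupp ⟨fun c r h => h, fun i j => ?_⟩
    have : i = j := Fin.ext (by omega)
    simp [this]
  | succ n ih =>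
    rw [oSd_succ_single, oBoundary_single, map_sum, map_sum]
    refine Submodule.sum_mem _ fun i _ => ?_
    rw [map_smul, map_smul]
    refine Submodule.smul_mem _ _ ?_
    refine map_mem_oSupp _ ?_ (ih (v ∘ i.succAbove) fun a b => hD _ _)
    rintro w ⟨hw1, hw2⟩
    rw [oCone_single]
    have hw1' : ∀ c r, (∀ i, dist (v i) c ≤ r) → ∀ j, dist (w j) c ≤ r :=
      fun c r h => hw1 c r fun i => h _
    have hb : ∀ j, dist (w j) (bary (n + 1) v) ≤ ((n + 1 : ℕ) : ℝ) / ((n + 1 : ℕ) + 1) * D :=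
      hw1' _ _ fun j => by rw [dist_comm]; exact dist_bary_le v hD j
    refine single_mem_oSupp ⟨fun c r h j => ?_, fun a b => ?_⟩
    · refine Fin.cases ?_ (fun j => ?_) j
      · exact dist_affS_le v c h _
      · exact hw1' c r h j
    · have hpos : 0 ≤ ((n + 1 : ℕ) : ℝ) / ((n + 1 : ℕ) + 1) * D := by positivity
      refine Fin.cases ?_ (fun a => ?_) a <;> refine Fin.cases ?_ (fun b => ?_) b
      · simpa using hpos
      · simp only [Fin.cons_zero, Fin.cons_succ]
        rw [dist_comm]
        exact hb b
      · simp only [Fin.cons_zero, Fin.cons_succ]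
        exact hb a
      · simp only [Fin.cons_succ]
        refine (hw2 a b).trans (mul_le_mul_of_nonneg_right ?_ hD0)
        rw [div_le_div_iff₀ (by positivity) (by positivity)]
        push_cast
        nlinarith

lemma oSd_iterate_mesh (k : ℕ) : ((oSd bary n)^[k] (Finsupp.single (vert n) 1)) ∈
      oSupp fun w : Fin (n + 1) → TopSimplex n =>
        ∀ i j, dist (w i) (w j) ≤ ((n : ℝ) / (n + 1)) ^ k := by
  induction k with
  | zero =>
    refine single_mem_oSupp fun i j => ?_
    rw [Subtype.dist_eq, pow_zero]
    refine (Metric.dist_le_diam_of_mem (bounded_stdSimplex _) (vert n i).2 (vert n j).2).trans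
      diam_stdSimplex_le
  | succ k ih =>
    rw [Function.iterate_succ_apply']
    refine map_mem_oSupp _ (fun v hv => ?_) ih
    refine Finsupp.supported_mono ?_ (oSd_mesh v (by positivity) hv)
    rintro w ⟨-, hw⟩ i j
    rw [pow_succ']
    exact hw i j

end Mesh

section Small

variable {X : Type*} [TopologicalSpace X] {n : ℕ}

lemma Sd_iterate_chain {m : ℕ} (σ : C(TopSimplex m, X)) (c : OChain (TopSimplex m) n) (k : ℕ) :
    (Sd X n)^[k] ((simplexReal m).chain σ n c) = (simplexReal m).chain σ n ((oSd bary n)^[k] c) := by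
  induction k with
  | zero => rfl
  | succ k ih => rw [Function.iterate_succ_apply', Function.iterate_succ_apply', ih, Sd_chain]

lemma eventually_Sd_small_single {N O : Set X} (hN : IsOpen N) (hO : IsOpen O)
    (hNO : N ∪ O = Set.univ) (σ : SingularSimplex X n) :
    ∀ᶠ k in Filter.atTop, (Sd X n)^[k] (Finsupp.single σ 1) ∈
      chainsIn ℝ X N n ⊔ chainsIn ℝ X O n := by
  obtain ⟨δ, hδ, hball⟩ := lebesgue_number_lemma_of_metric (s := (Set.univ : Set (TopSimplex n)))
    (c := fun b : Bool => σ ⁻¹' (if b then N else O)) isCompact_univ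
    (fun b => by cases b <;> simp <;> exact IsOpen.preimage σ.continuous ‹_›)
    (fun x _ => by
      have : σ x ∈ N ∪ O := hNO ▸ Set.mem_univ _
      rcases this with h | h
      · exact Set.mem_iUnion.2 ⟨true, by simpa using h⟩
      · exact Set.mem_iUnion.2 ⟨false, by simpa using h⟩)
  have hlim : Filter.Tendsto (fun k : ℕ => ((n : ℝ) / (n + 1)) ^ k) Filter.atTop (𝓝 0) :=
    tendsto_pow_atTop_nhds_zero_of_lt_one (by positivity)
      (by rw [div_lt_one (by positivity)]; linarith)
  filter_upwards [hlim.eventually (gt_mem_nhds hδ)] with k hk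
  rw [← simplexReal_chain_vert, Sd_iterate_chain]
  have : chainsIn ℝ X N n ⊔ chainsIn ℝ X O n =
      Submodule.span ℝ {c | ∃ τ : SingularSimplex X n,
        (Set.range τ ⊆ N ∨ Set.range τ ⊆ O) ∧ c = Finsupp.single τ 1} := by
    rw [chainsIn, chainsIn, ← Submodule.span_union]
    congr 1
    ext c
    constructor
    · rintro (⟨τ, h, rfl⟩ | ⟨τ, h, rfl⟩)
      · exact ⟨τ, Or.inl h, rfl⟩
      · exact ⟨τ, Or.inr h, rfl⟩
    · rintro ⟨τ, h | h, rfl⟩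
      · exact Or.inl ⟨τ, h, rfl⟩
      · exact Or.inr ⟨τ, h, rfl⟩
  rw [this]
  refine Realization.chain_mem_span _ _ (fun τ => Set.range τ ⊆ N ∨ Set.range τ ⊆ O) _ ?_
  intro w hw
  have hw' : ∀ i j, dist (w i) (w j) ≤ ((n : ℝ) / (n + 1)) ^ k := oSd_iterate_mesh k hw
  obtain ⟨b, hb⟩ := hball (w 0) (Set.mem_univ _)
  have hr : ∀ x, affS w x ∈ Metric.ball (w 0) δ := fun x =>
    lt_of_le_of_lt (dist_affS_le w (w 0) (fun i => hw' i 0) x) hk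
  cases b
  · right
    rintro _ ⟨x, rfl⟩
    have h := hb (hr x)
    simp only [Set.mem_preimage] at h
    exact h
  · left
    rintro _ ⟨x, rfl⟩
    have h := hb (hr x)
    simp only [Set.mem_preimage] at h
    exact h

lemma Sd_iterate_linear (k : ℕ) :
    ((Sd X n)^[k] : SingularChain ℝ X n → SingularChain ℝ X n) = ⇑((Sd X n) ^ k) :=
  (Module.End.coe_pow (Sd X n) k).symm

lemma eventually_Sd_small {N O : Set X} (hN : IsOpen N) (hO : IsOpen O)
    (hNO : N ∪ O = Set.univ) (c : SingularChain ℝ X n) :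
    ∀ᶠ k in Filter.atTop, (Sd X n)^[k] c ∈ chainsIn ℝ X N n ⊔ chainsIn ℝ X O n := by
  simp only [Sd_iterate_linear]
  induction c using Finsupp.induction_linear with
  | zero => simp
  | add a b ha hb =>
    filter_upwards [ha, hb] with k ha hb
    rw [map_add]
    exact Submodule.add_mem _ ha hb
  | single σ r =>
    filter_upwards [eventually_Sd_small_single hN hO hNO σ] with k hk
    rw [← Finsupp.smul_single_one, map_smul]
    rw [Sd_iterate_linear] at hk
    exact Submodule.smul_mem _ _ hk

lemma span_induct {Y : Type*} [TopologicalSpace Y] {k : ℕ} {P : SingularSimplex X n → Prop}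
    (φ : SingularChain ℝ X n →ₗ[ℝ] SingularChain ℝ Y k) (S : Submodule ℝ (SingularChain ℝ Y k))
    (h : ∀ σ, P σ → φ (Finsupp.single σ 1) ∈ S) {c : SingularChain ℝ X n}
    (hc : c ∈ Submodule.span ℝ {c | ∃ σ : SingularSimplex X n, P σ ∧
      c = Finsupp.single σ 1}) : φ c ∈ S := by
  have : Submodule.span ℝ {c | ∃ σ : SingularSimplex X n, P σ ∧
      c = Finsupp.single σ 1} ≤ S.comap φ := by
    rw [Submodule.span_le]
    rintro _ ⟨σ, hσ, rfl⟩
    exact h σ hσ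
  exact this hc

lemma boundary_mem_chainsIn {B : Set X} {c : SingularChain ℝ X (n + 1)}
    (hc : c ∈ chainsIn ℝ X B (n + 1)) : boundary ℝ X n c ∈ chainsIn ℝ X B n :=
  span_induct (P := fun σ => Set.range σ ⊆ B) _ _ (fun σ hσ => by
    rw [boundary_single]
    refine Submodule.sum_mem _ fun i _ => Submodule.smul_mem _ _ (Submodule.subset_span
      ⟨_, ?_, rfl⟩)
    rintro _ ⟨x, rfl⟩
    exact hσ ⟨_, rfl⟩) hc

lemma Sd_mem_chainsIn {B : Set X} {c : SingularChain ℝ X n}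
    (hc : c ∈ chainsIn ℝ X B n) : Sd X n c ∈ chainsIn ℝ X B n :=
  span_induct (P := fun σ => Set.range σ ⊆ B) _ _ (fun σ hσ => by
    rw [Sd, natOp_single]
    exact Realization.chain_mem_chainsIn _ _ hσ _) hc

lemma sdT_mem_chainsIn {B : Set X} {c : SingularChain ℝ X n}
    (hc : c ∈ chainsIn ℝ X B n) : sdT X n c ∈ chainsIn ℝ X B (n + 1) :=
  span_induct (P := fun σ => Set.range σ ⊆ B) _ _ (fun σ hσ => by
    rw [sdT, natOp_single]
    exact Realization.chain_mem_chainsIn _ _ hσ _) hc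

lemma chainsIn_mono {A B : Set X} (h : A ⊆ B) : chainsIn ℝ X A n ≤ chainsIn ℝ X B n := by
  refine Submodule.span_mono ?_
  rintro _ ⟨σ, hσ, rfl⟩
  exact ⟨σ, hσ.trans h, rfl⟩

end Small

/-! ### Natural homotopies of singular simplices -/

section NaturalHomotopy

variable {X Y : Type*} [TopologicalSpace X] [TopologicalSpace Y]

/-- A family of homotopies of singular simplices, natural with respect to faces. -/
structure NatHomotopy (X Y : Type*) [TopologicalSpace X] [TopologicalSpace Y] where
  map : ∀ n, SingularSimplex X n → C(unitInterval × TopSimplex n, Y)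
  face : ∀ n σ i, restr (map (n + 1) σ) (coface i) = map n (σ.comp (coface i))

variable (H : NatHomotopy X Y) {n : ℕ}

/-- The chain map at time `t` of a natural homotopy. -/
def NatHomotopy.at (t : unitInterval) (n : ℕ) : SingularChain ℝ X n →ₗ[ℝ] SingularChain ℝ Y n :=
  Finsupp.lmapDomain ℝ ℝ fun σ => slice (H.map n σ) t

lemma NatHomotopy.at_single (t : unitInterval) (σ : SingularSimplex X n) :
    H.at t n (Finsupp.single σ 1) = Finsupp.single (slice (H.map n σ) t) 1 := by
  simp [NatHomotopy.at, Finsupp.mapDomain_single]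

/-- The prism operator of a natural homotopy. -/
def NatHomotopy.prism (n : ℕ) : SingularChain ℝ X n →ₗ[ℝ] SingularChain ℝ Y (n + 1) :=
  Finsupp.linearCombination ℝ fun σ => SimplicialVolume.prism (H.map n σ)

lemma NatHomotopy.prism_single (σ : SingularSimplex X n) :
    H.prism n (Finsupp.single σ 1) = SimplicialVolume.prism (H.map n σ) := by
  simp [NatHomotopy.prism]

lemma NatHomotopy.boundary_prism_zero (c : SingularChain ℝ X 0) :
    boundary ℝ Y 0 (H.prism 0 c) = H.at 1 0 c - H.at 0 0 c := by
  have : (boundary ℝ Y 0).comp (H.prism 0) = H.at 1 0 - H.at 0 0 := by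
    refine ochain_hom_ext fun σ => ?_
    simp only [LinearMap.comp_apply, LinearMap.sub_apply, H.prism_single, H.at_single,
      SimplicialVolume.boundary_prism_zero]
  exact LinearMap.congr_fun this c

lemma NatHomotopy.boundary_prism_succ (c : SingularChain ℝ X (n + 1)) :
    boundary ℝ Y (n + 1) (H.prism (n + 1) c) =
      H.at 1 (n + 1) c - H.at 0 (n + 1) c - H.prism n (boundary ℝ X n c) := by
  have : (boundary ℝ Y (n + 1)).comp (H.prism (n + 1)) =
      H.at 1 (n + 1) - H.at 0 (n + 1) - (H.prism n).comp (boundary ℝ X n) := by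
    refine ochain_hom_ext fun σ => ?_
    simp only [LinearMap.comp_apply, LinearMap.sub_apply, H.prism_single, H.at_single,
      SimplicialVolume.boundary_prism_succ, H.face, boundary_single, map_sum, map_smul]
  exact LinearMap.congr_fun this c

lemma NatHomotopy.boundary_at (t : unitInterval) (c : SingularChain ℝ X (n + 1)) :
    boundary ℝ Y n (H.at t (n + 1) c) = H.at t n (boundary ℝ X n c) := by
  have : (boundary ℝ Y n).comp (H.at t (n + 1)) = (H.at t n).comp (boundary ℝ X n) := by
    refine ochain_hom_ext fun σ => ?_
    simp only [LinearMap.comp_apply, H.at_single, boundary_single, map_sum, map_smul]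
    refine Finset.sum_congr rfl fun i _ => ?_
    rw [← H.face]
    rfl
  exact LinearMap.congr_fun this c

variable {A : Set X} {B : Set Y}

lemma NatHomotopy.at_mem_chainsIn
    (hH : ∀ n (σ : SingularSimplex X n), Set.range σ ⊆ A → Set.range (H.map n σ) ⊆ B)
    (t : unitInterval) {c : SingularChain ℝ X n} (hc : c ∈ chainsIn ℝ X A n) :
    H.at t n c ∈ chainsIn ℝ Y B n :=
  span_induct (P := fun σ => Set.range σ ⊆ A) _ _ (fun σ hσ => by
    rw [H.at_single]
    refine Submodule.subset_span ⟨_, ?_, rfl⟩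
    rintro _ ⟨x, rfl⟩
    exact hH n σ hσ ⟨_, rfl⟩) hc

lemma NatHomotopy.at_mem_relativeCycles
    (hH : ∀ n (σ : SingularSimplex X n), Set.range σ ⊆ A → Set.range (H.map n σ) ⊆ B)
    (t : unitInterval) {c : SingularChain ℝ X n} (hc : c ∈ relativeCycles ℝ X A n) :
    H.at t n c ∈ relativeCycles ℝ Y B n := by
  cases n with
  | zero => trivial
  | succ n =>
    change boundary ℝ Y n _ ∈ chainsIn ℝ Y B n
    rw [H.boundary_at]
    exact H.at_mem_chainsIn hH t hc

lemma NatHomotopy.at_sub_at_mem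
    (hH : ∀ n (σ : SingularSimplex X n), Set.range σ ⊆ A → Set.range (H.map n σ) ⊆ B)
    {c : SingularChain ℝ X n} (hc : c ∈ relativeCycles ℝ X A n) :
    H.at 1 n c - H.at 0 n c ∈ relativeBoundaries ℝ Y B n := by
  cases n with
  | zero =>
    rw [← H.boundary_prism_zero]
    exact Submodule.mem_sup_left ⟨_, trivial, rfl⟩
  | succ n =>
    have h := H.boundary_prism_succ c
    have : H.at 1 (n + 1) c - H.at 0 (n + 1) c =
        boundary ℝ Y (n + 1) (H.prism (n + 1) c) + H.prism n (boundary ℝ X n c) := by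
      rw [h]; abel
    rw [this]
    refine Submodule.add_mem_sup ⟨_, trivial, rfl⟩ ?_
    refine span_induct (P := fun σ => Set.range σ ⊆ A) _ _ (fun σ hσ => ?_) hc
    rw [H.prism_single]
    exact prism_mem_chainsIn _ (hH n σ hσ)

/-- The natural homotopy induced by a homotopy of spaces. -/
def NatHomotopy.ofHomotopy (F : C(unitInterval × X, Y)) : NatHomotopy X Y where
  map _ σ := restr F σ
  face _ _ _ := rfl

lemma boundary_pushChain (f : C(X, Y)) (c : SingularChain ℝ X (n + 1)) :
    boundary ℝ Y n (pushChain ℝ f (n + 1) c) = pushChain ℝ f n (boundary ℝ X n c) :=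
  (NatHomotopy.ofHomotopy (f.comp ContinuousMap.snd)).boundary_at 0 c

lemma pushChain_single (f : C(X, Y)) (σ : SingularSimplex X n) :
    pushChain ℝ f n (Finsupp.single σ 1) = Finsupp.single (f.comp σ) 1 := by
  simp [pushChain, Finsupp.mapDomain_single]

lemma pushChain_mem_chainsIn (f : C(X, Y)) (h : ∀ x ∈ A, f x ∈ B) {c : SingularChain ℝ X n}
    (hc : c ∈ chainsIn ℝ X A n) : pushChain ℝ f n c ∈ chainsIn ℝ Y B n :=
  (NatHomotopy.ofHomotopy (f.comp ContinuousMap.snd)).at_mem_chainsIn (A := A)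
    (fun n σ hσ => by rintro _ ⟨⟨t, x⟩, rfl⟩; exact h _ (hσ ⟨x, rfl⟩)) 0 hc

lemma pushChain_mem_relativeCycles (f : C(X, Y)) (h : ∀ x ∈ A, f x ∈ B) {c : SingularChain ℝ X n}
    (hc : c ∈ relativeCycles ℝ X A n) : pushChain ℝ f n c ∈ relativeCycles ℝ Y B n :=
  (NatHomotopy.ofHomotopy (f.comp ContinuousMap.snd)).at_mem_relativeCycles (A := A)
    (fun n σ hσ => by rintro _ ⟨⟨t, x⟩, rfl⟩; exact h _ (hσ ⟨x, rfl⟩)) 0 hc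

lemma pushChain_mem_relativeBoundaries (f : C(X, Y)) (h : ∀ x ∈ A, f x ∈ B)
    {c : SingularChain ℝ X n} (hc : c ∈ relativeBoundaries ℝ X A n) :
    pushChain ℝ f n c ∈ relativeBoundaries ℝ Y B n := by
  obtain ⟨a, ⟨w, -, rfl⟩, b, hb, rfl⟩ := Submodule.mem_sup.1 hc
  rw [map_add, ← boundary_pushChain]
  exact Submodule.add_mem_sup ⟨_, trivial, rfl⟩ (pushChain_mem_chainsIn f h hb)

lemma pushChain_id (c : SingularChain ℝ X n) : pushChain ℝ (ContinuousMap.id X) n c = c := by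
  have : pushChain ℝ (ContinuousMap.id X) n = LinearMap.id :=
    ochain_hom_ext fun σ => by
      simp only [LinearMap.id_apply, pushChain_single, ContinuousMap.id_comp]
  exact LinearMap.congr_fun this c

lemma pushChain_slice_sub_mem (F : C(unitInterval × X, Y)) (h : ∀ t, ∀ x ∈ A, F (t, x) ∈ B)
    {c : SingularChain ℝ X n} (hc : c ∈ relativeCycles ℝ X A n) :
    pushChain ℝ (slice F 1) n c - pushChain ℝ (slice F 0) n c ∈ relativeBoundaries ℝ Y B n :=
  (NatHomotopy.ofHomotopy F).at_sub_at_mem (A := A)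
    (fun n σ hσ => by rintro _ ⟨⟨t, x⟩, rfl⟩; exact h _ _ (hσ ⟨x, rfl⟩)) hc

end NaturalHomotopy

/-! ### Means on groups -/

/-- `φ` is bounded by `C` in absolute value. -/
def BddBy {S : Type*} (φ : S → ℝ) (C : ℝ) : Prop := ∀ s, |φ s| ≤ C

/-- The space of bounded functions on a set. -/
def bddFun (S : Type*) : Submodule ℝ (S → ℝ) where
  carrier := {φ | ∃ C, BddBy φ C}
  add_mem' := by
    rintro φ ψ ⟨C, hC⟩ ⟨D, hD⟩
    exact ⟨C + D, fun s => (abs_add_le _ _).trans (add_le_add (hC s) (hD s))⟩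
  zero_mem' := ⟨0, fun s => by simp⟩
  smul_mem' := by
    rintro c φ ⟨C, hC⟩
    refine ⟨|c| * C, fun s => ?_⟩
    simpa [abs_mul] using mul_le_mul_of_nonneg_left (hC s) (abs_nonneg c)

/-- An asymptotically linear family of functionals bounded by the sup norm has a linear limit. -/
lemma exists_limit_mean {S ι : Type*} (F : Filter ι) [F.NeBot] (J : ι → (S → ℝ) → ℝ)
    (hbd : ∀ φ C, BddBy φ C → ∀ ε > 0, ∀ᶠ i in F, |J i φ| ≤ C + ε)
    (hadd : ∀ φ ψ, φ ∈ bddFun S → ψ ∈ bddFun S →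
      Filter.Tendsto (fun i => J i (φ + ψ) - (J i φ + J i ψ)) F (𝓝 0))
    (hsmul : ∀ (c : ℝ) φ, φ ∈ bddFun S →
      Filter.Tendsto (fun i => J i (c • φ) - c * J i φ) F (𝓝 0))
    (hone : ∀ i, J i (fun _ => 1) = 1) :
    ∃ M : (S → ℝ) →ₗ[ℝ] ℝ, M (fun _ => 1) = 1 ∧ (∀ φ C, BddBy φ C → |M φ| ≤ C) ∧
      ∀ φ ψ, φ ∈ bddFun S → ψ ∈ bddFun S →
        Filter.Tendsto (fun i => J i φ - J i ψ) F (𝓝 0) → M φ = M ψ := by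
  set U := Ultrafilter.of F
  have hU : (U : Filter ι) ≤ F := Ultrafilter.of_le F
  have hex : ∀ φ : bddFun S, ∃ r, Filter.Tendsto (fun i => J i φ.1) U (𝓝 r) := by
    rintro ⟨φ, C, hC⟩
    have hc : IsCompact (Set.Icc (-(C + 1)) (C + 1)) := isCompact_Icc
    obtain ⟨r, -, hr⟩ := isCompact_iff_ultrafilter_le_nhds.1 hc (U.map fun i => J i φ) (by
      rw [Filter.le_principal_iff]
      exact ((hbd φ C hC 1 one_pos).filter_mono hU).mono fun i hi => abs_le.1 hi)
    exact ⟨r, hr⟩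
  choose L hL using hex
  let M₀ : bddFun S →ₗ[ℝ] ℝ :=
    { toFun := L
      map_add' := fun φ ψ => by
        have h1 := ((hadd φ.1 ψ.1 φ.2 ψ.2).mono_left hU).add ((hL φ).add (hL ψ))
        simp only [sub_add_cancel, zero_add] at h1
        exact tendsto_nhds_unique (hL (φ + ψ)) h1
      map_smul' := fun c φ => by
        have h1 := ((hsmul c φ.1 φ.2).mono_left hU).add ((hL φ).const_mul c)
        simp only [sub_add_cancel, zero_add] at h1
        exact tendsto_nhds_unique (hL (c • φ)) h1 }
  obtain ⟨M, hM⟩ := LinearMap.exists_extend M₀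
  have hM' : ∀ φ (h : φ ∈ bddFun S), M φ = L ⟨φ, h⟩ := fun φ h =>
    DFunLike.congr_fun hM ⟨φ, h⟩
  refine ⟨M, ?_, ?_, ?_⟩
  · have h1 : (fun _ => 1 : S → ℝ) ∈ bddFun S := ⟨1, fun s => by simp⟩
    rw [hM' _ h1]
    refine tendsto_nhds_unique (hL _) ?_
    simp only [hone]
    exact tendsto_const_nhds
  · intro φ C hC
    rw [hM' _ ⟨C, hC⟩]
    refine le_of_forall_pos_le_add fun ε hε => ?_
    exact le_of_tendsto (hL ⟨φ, C, hC⟩).abs ((hbd φ C hC ε hε).filter_mono hU)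
  · intro φ ψ hφ hψ h
    rw [hM' _ hφ, hM' _ hψ]
    have h1 := (hL ⟨φ, hφ⟩).sub (hL ⟨ψ, hψ⟩)
    exact sub_eq_zero.1 (tendsto_nhds_unique h1 (h.mono_left hU))

/-- A group has a right-invariant mean on its bounded functions. -/
def HasMean (G : Type*) [Group G] : Prop :=
  ∃ M : (G → ℝ) →ₗ[ℝ] ℝ, M (fun _ => 1) = 1 ∧ (∀ φ C, BddBy φ C → |M φ| ≤ C) ∧
    ∀ φ, φ ∈ bddFun G → ∀ h, M (fun g => φ (g * h)) = M φ

section Amenable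
variable {G : Type*} [Group G]
open MeasureTheory

/-- The integral of a function of finite range against a finitely additive set function. -/
def finInt (m : Set G → ℝ) (f : @SimpleFunc G ⊤ ℝ) : ℝ :=
  @SimpleFunc.setToSimpleFunc G ℝ ℝ _ _ _ _ ⊤
    (fun s => m s • ContinuousLinearMap.id ℝ ℝ) f

lemma hasMean_of_isAmenable (h : IsAmenable G) : HasMean G := by
  obtain ⟨m, hpos, huniv, hadd, hinv⟩ := h
  let _ : MeasurableSpace G := ⊤
  set T : Set G → ℝ →L[ℝ] ℝ := fun s => m s • ContinuousLinearMap.id ℝ ℝ with hT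
  have hTadd : FinMeasAdditive (0 : Measure G) T := fun s t _ _ _ _ hst => by
    simp only [hT, hadd s t hst, add_smul]
  have hintegr : ∀ f : SimpleFunc G ℝ, Integrable f (0 : Measure G) := fun f => integrable_zero_measure
  have hmono : ∀ f g : SimpleFunc G ℝ, f ≤ g → finInt m f ≤ finInt m g := fun f g hfg =>
    SimpleFunc.setToSimpleFunc_mono hTadd (fun s _ _ x hx => by
      simpa [hT] using mul_nonneg (hpos s) hx) (hintegr f) (hintegr g) hfg
  have hconst : ∀ c : ℝ, finInt m (SimpleFunc.const G c) = c := fun c => by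
    simp [finInt, SimpleFunc.setToSimpleFunc_const', huniv]
  have habs : ∀ (f : SimpleFunc G ℝ) C, (∀ g, |f g| ≤ C) → |finInt m f| ≤ C := fun f C hC => by
    rw [abs_le]
    constructor
    · rw [← hconst (-C)]
      exact hmono _ _ fun g => (abs_le.1 (hC g)).1
    · rw [← hconst C]
      exact hmono _ _ fun g => (abs_le.1 (hC g)).2
  have hsum : ∀ f g : SimpleFunc G ℝ, finInt m (f + g) = finInt m f + finInt m g := fun f g =>
    SimpleFunc.setToSimpleFunc_add T hTadd (hintegr f) (hintegr g)
  have hsmul : ∀ (c : ℝ) (f : SimpleFunc G ℝ), finInt m (c • f) = c * finInt m f := fun c f =>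
    SimpleFunc.setToSimpleFunc_smul_real T hTadd c (hintegr f)
  have hsub : ∀ f g : SimpleFunc G ℝ, finInt m (f - g) = finInt m f - finInt m g := fun f g =>
    SimpleFunc.setToSimpleFunc_sub T hTadd (hintegr f) (hintegr g)
  classical
  have hfin : ∀ φ : G → ℝ, φ ∈ bddFun G → ∀ N : ℕ,
      (Set.range fun g => (⌊(N : ℝ) * φ g⌋ : ℝ) / N).Finite := by
    rintro φ ⟨C, hC⟩ N
    have h1 : (Set.range fun g => (N : ℝ) * φ g) ⊆ Set.Icc (-(N * C)) (N * C) := by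
      rintro _ ⟨g, rfl⟩
      have := abs_le.1 (hC g)
      constructor <;> nlinarith [Nat.cast_nonneg (α := ℝ) N]
    have h2 : (Set.range fun g => ⌊(N : ℝ) * φ g⌋).Finite := by
      refine (Set.finite_Icc ⌊-(N * C : ℝ)⌋ ⌊(N * C : ℝ)⌋).subset ?_
      rintro _ ⟨g, rfl⟩
      have := h1 ⟨g, rfl⟩
      exact ⟨Int.floor_mono this.1, Int.floor_mono this.2⟩
    refine (h2.image fun k : ℤ => (k : ℝ) / N).subset ?_
    rintro _ ⟨g, rfl⟩
    exact ⟨_, ⟨g, rfl⟩, rfl⟩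
  let D : ℕ → (G → ℝ) → SimpleFunc G ℝ := fun N φ =>
    if h : φ ∈ bddFun G then ⟨fun g => (⌊((N + 1 : ℕ) : ℝ) * φ g⌋ : ℝ) / (N + 1 : ℕ),
      fun _ => trivial, hfin φ h _⟩ else 0
  have hD : ∀ N φ, φ ∈ bddFun G → ∀ g,
      D N φ g = (⌊((N + 1 : ℕ) : ℝ) * φ g⌋ : ℝ) / (N + 1 : ℕ) := fun N φ h g => by
    simp only [D, dif_pos h]; rfl
  have hDle : ∀ N φ, φ ∈ bddFun G → ∀ g, |D N φ g - φ g| ≤ 1 / ((N : ℝ) + 1) := by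
    intro N φ h g
    have hN : (0 : ℝ) < (N : ℝ) + 1 := by positivity
    have h1 := Int.floor_le (((N + 1 : ℕ) : ℝ) * φ g)
    have h2 := Int.lt_floor_add_one (((N + 1 : ℕ) : ℝ) * φ g)
    rw [hD N φ h g]
    push_cast at h1 h2 ⊢
    have : (⌊((N : ℝ) + 1) * φ g⌋ : ℝ) / (N + 1) - φ g
        = ((⌊((N : ℝ) + 1) * φ g⌋ : ℝ) - (N + 1) * φ g) / (N + 1) := by
      field_simp
    rw [this, abs_div, abs_of_pos hN]
    gcongr
    rw [abs_le]; constructor <;> linarith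
  have hDinv : ∀ (f g : SimpleFunc G ℝ) (a : G), (∀ x, g x = f (a * x)) →
      finInt m g = finInt m f := by
    intro f g a hg
    have hr : g.range = f.range := by
      ext y
      simp only [SimpleFunc.mem_range, Set.mem_range]
      constructor
      · rintro ⟨x, rfl⟩; exact ⟨a * x, (hg x).symm⟩
      · rintro ⟨x, rfl⟩; exact ⟨a⁻¹ * x, by rw [hg]; simp⟩
    simp only [finInt, SimpleFunc.setToSimpleFunc]
    rw [hr]
    refine Finset.sum_congr rfl fun y _ => ?_
    have : g ⁻¹' {y} = (a⁻¹ * ·) '' (f ⁻¹' {y}) := by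
      ext x
      simp only [Set.mem_preimage, Set.mem_singleton_iff, Set.mem_image, hg]
      constructor
      · intro hx; exact ⟨a * x, hx, by simp⟩
      · rintro ⟨z, hz, rfl⟩; simpa using hz
    rw [this, hinv]
  have hlim : Filter.Tendsto (fun N : ℕ => 1 / ((N : ℝ) + 1)) Filter.atTop (𝓝 0) :=
    tendsto_one_div_add_atTop_nhds_zero_nat
  have hsq : ∀ (K : ℝ) (u : ℕ → ℝ), (∀ N : ℕ, |u N| ≤ K * (1 / ((N : ℝ) + 1))) →
      Filter.Tendsto u Filter.atTop (𝓝 0) := fun K u hu => by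
    refine squeeze_zero_norm (fun N => hu N) ?_
    simpa using hlim.const_mul K
  have hdiff : ∀ φ, φ ∈ bddFun G → ∀ (f : SimpleFunc G ℝ) (ε : ℝ) N,
      (∀ g, |f g - D N φ g| ≤ ε) → |finInt m f - finInt m (D N φ)| ≤ ε := by
    intro φ h f ε N hε
    rw [← hsub]
    exact habs _ _ fun g => by simpa using hε g
  have hbdD : ∀ φ C, BddBy φ C → ∀ N, |finInt m (D N φ)| ≤ C + 1 / ((N : ℝ) + 1) := by
    intro φ C hC N
    refine habs _ _ fun g => ?_
    have h1 := hDle N φ ⟨C, hC⟩ g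
    have h2 := hC g
    have h3 : D N φ g = φ g + (D N φ g - φ g) := by ring
    rw [h3]
    exact (abs_add_le _ _).trans (add_le_add h2 h1)
  have hbdadd : ∀ φ ψ, φ ∈ bddFun G → ψ ∈ bddFun G → φ + ψ ∈ bddFun G := fun φ ψ =>
    (bddFun G).add_mem
  have H := exists_limit_mean (S := G) (Filter.atTop : Filter ℕ) (fun N φ => finInt m (D N φ))
  refine (fun H' => ?_) (H ?_ ?_ ?_ ?_)
  · obtain ⟨M, h1, h2, h3⟩ := H'
    refine ⟨M.comp (LinearMap.funLeft ℝ ℝ fun g : G => g⁻¹), h1, fun φ C hC => h2 _ C fun g => hC _,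
      fun φ hφ h => ?_⟩
    obtain ⟨C, hC⟩ := hφ
    have e : (LinearMap.funLeft ℝ ℝ fun g : G => g⁻¹) (fun g => φ (g * h))
        = fun g => φ ((h⁻¹ * g)⁻¹) := by
      funext g; simp [LinearMap.funLeft_apply]
    simp only [LinearMap.comp_apply]
    rw [e]
    refine h3 _ _ ⟨C, fun g => hC _⟩ ⟨C, fun g => hC _⟩ ?_
    refine tendsto_const_nhds.congr fun N => ?_
    rw [eq_comm, sub_eq_zero]
    refine hDinv _ _ h⁻¹ fun g => ?_
    rw [hD N _ ⟨C, fun g => hC _⟩,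
      hD N (LinearMap.funLeft ℝ ℝ (fun g : G => g⁻¹) φ) ⟨C, fun g => hC _⟩]
    rfl
  · intro φ C hC ε hε
    filter_upwards [hlim.eventually (gt_mem_nhds hε)] with N hN
    exact (hbdD φ C hC N).trans (by linarith)
  · intro φ ψ hφ hψ
    refine hsq 3 _ fun N => ?_
    rw [← hsum, abs_sub_comm]
    refine hdiff _ (hbdadd _ _ hφ hψ) _ _ N fun g => ?_
    have a1 := abs_le.1 (hDle N φ hφ g)
    have a2 := abs_le.1 (hDle N ψ hψ g)
    have a3 := abs_le.1 (hDle N _ (hbdadd _ _ hφ hψ) g)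
    simp only [SimpleFunc.coe_add, Pi.add_apply] at a3 ⊢
    rw [abs_le]; constructor <;> linarith
  · intro c φ hφ
    refine hsq (1 + |c|) _ fun N => ?_
    rw [← hsmul, abs_sub_comm]
    refine hdiff _ ((bddFun G).smul_mem c hφ) _ _ N fun g => ?_
    have a1 := hDle N φ hφ g
    have a3 := hDle N _ ((bddFun G).smul_mem c hφ) g
    simp only [SimpleFunc.coe_smul, Pi.smul_apply, smul_eq_mul] at a3 ⊢
    have : c * D N φ g - D N (c • φ) g
        = -(D N (c • φ) g - c * φ g) + c * (D N φ g - φ g) := by ring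
    rw [this]
    refine (abs_add_le _ _).trans ?_
    rw [abs_neg, abs_mul, add_mul, one_mul]
    gcongr
  · intro N
    refine Eq.trans (congrArg _ ?_) (hconst 1)
    ext g
    rw [hD N _ ⟨1, fun g => by simp⟩]
    have : ((N : ℝ) + 1) ≠ 0 := by positivity
    have e : ⌊((N + 1 : ℕ) : ℝ) * 1⌋ = ((N + 1 : ℕ) : ℤ) := by
      rw [mul_one]; exact Int.floor_natCast _
    rw [e]
    push_cast
    simp [this]

end Amenable

section Comm
variable {G : Type*} [Group G]

/-- Average of `φ` over the first `N` powers of `g`. -/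
def powAvg (N : ℕ) (g : G) : (G → ℝ) →ₗ[ℝ] (G → ℝ) where
  toFun φ x := (∑ k ∈ Finset.range (N + 1), φ (g ^ k * x)) / (N + 1)
  map_add' φ ψ := by
    funext x; simp [Finset.sum_add_distrib, add_div]
  map_smul' c φ := by
    funext x; simp [← Finset.mul_sum, mul_div_assoc]

lemma powAvg_bddBy (N : ℕ) (g : G) {φ : G → ℝ} {C : ℝ} (h : BddBy φ C) :
    BddBy (powAvg N g φ) C := by
  intro x
  have hN : (0 : ℝ) < (N : ℝ) + 1 := by positivity
  simp only [powAvg, LinearMap.coe_mk, AddHom.coe_mk]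
  rw [abs_div, abs_of_pos hN, div_le_iff₀ hN]
  refine (Finset.abs_sum_le_sum_abs _ _).trans ?_
  refine (Finset.sum_le_card_nsmul _ _ C fun k _ => h _).trans ?_
  simp [mul_comm]

/-- Iterated averages. -/
def listAvg (N : ℕ) : List G → (G → ℝ) →ₗ[ℝ] ℝ
  | [] => LinearMap.proj 1
  | g :: l => (listAvg N l).comp (powAvg N g)

lemma abs_listAvg_le (N : ℕ) (l : List G) {φ : G → ℝ} {C : ℝ} (h : BddBy φ C) :
    |listAvg N l φ| ≤ C := by
  induction l generalizing φ with
  | nil => exact h 1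
  | cons g l ih => exact ih (powAvg_bddBy N g h)

lemma listAvg_one (N : ℕ) (l : List G) : listAvg N l (fun _ => 1) = 1 := by
  induction l with
  | nil => rfl
  | cons g l ih =>
    have : powAvg N g (fun _ => 1) = fun _ => 1 := by
      funext x
      have : ((N : ℝ) + 1) ≠ 0 := by positivity
      simp [powAvg, this]
    simp [listAvg, this, ih]

lemma powAvg_sub_bddBy (N : ℕ) (h : G) {φ : G → ℝ} {C : ℝ} (hC : BddBy φ C) :
    BddBy (powAvg N h (fun x => φ (h * x) - φ x)) (2 * C / (N + 1)) := by
  intro x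
  have hN : (0 : ℝ) < (N : ℝ) + 1 := by positivity
  simp only [powAvg, LinearMap.coe_mk, AddHom.coe_mk]
  rw [abs_div, abs_of_pos hN]
  gcongr
  have := Finset.sum_range_sub (fun k => φ (h ^ k * x)) (N + 1)
  simp only [pow_succ', mul_assoc] at this
  rw [this]
  have h1 := abs_le.1 (hC (h ^ 0 * x))
  have h2 := abs_le.1 (hC (h * (h ^ N * x)))
  rw [abs_le]; constructor <;> linarith

lemma abs_listAvg_sub_le (hcomm : ∀ a b : G, a * b = b * a) (N : ℕ) (l : List G) {h : G}
    (hl : h ∈ l) {φ : G → ℝ} {C : ℝ} (hC : BddBy φ C) :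
    |listAvg N l (fun x => φ (h * x) - φ x)| ≤ 2 * C / (N + 1) := by
  induction l generalizing φ with
  | nil => simp at hl
  | cons g l ih =>
    simp only [listAvg, LinearMap.comp_apply]
    by_cases hg : h = g
    · subst hg
      exact abs_listAvg_le N l (powAvg_sub_bddBy N h hC)
    · have hl' : h ∈ l := by simpa [hg] using hl
      have : powAvg N g (fun x => φ (h * x) - φ x)
          = fun x => powAvg N g φ (h * x) - powAvg N g φ x := by
        funext x
        simp only [powAvg, LinearMap.coe_mk, AddHom.coe_mk, Finset.sum_sub_distrib, sub_div]
        congr 2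
        refine Finset.sum_congr rfl fun k _ => ?_
        rw [← mul_assoc, ← mul_assoc, hcomm h]
      rw [this]
      exact ih hl' (powAvg_bddBy N g hC)

lemma hasMean_of_comm (hcomm : ∀ a b : G, a * b = b * a) : HasMean G := by
  classical
  obtain ⟨M, h1, h2, h3⟩ := exists_limit_mean (S := G) (Filter.atTop : Filter (Finset G × ℕ))
    (fun i φ => listAvg i.2 i.1.toList φ)
    (fun φ C hC ε hε => Filter.Eventually.of_forall fun i =>
      (abs_listAvg_le _ _ hC).trans (by linarith))
    (fun φ ψ _ _ => by simp) (fun c φ _ => by simp) (fun i => listAvg_one _ _)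
  refine ⟨M, h1, h2, ?_⟩
  rintro φ ⟨C, hC⟩ h
  refine h3 _ _ ⟨C, fun g => hC _⟩ ⟨C, hC⟩ ?_
  have hlim : Filter.Tendsto (fun i : Finset G × ℕ => 2 * C * (1 / ((i.2 : ℝ) + 1)))
      Filter.atTop (𝓝 0) := by
    have := (tendsto_one_div_add_atTop_nhds_zero_nat (𝕜 := ℝ)).const_mul (2 * C)
    rw [mul_zero] at this
    refine this.comp ?_
    rw [← Filter.prod_atTop_atTop_eq]
    exact Filter.tendsto_snd
  refine squeeze_zero_norm' ?_ hlim
  filter_upwards [Filter.eventually_ge_atTop (({h} : Finset G), 0)] with i hi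
  have hmem : h ∈ i.1.toList := by
    rw [Finset.mem_toList]
    exact hi.1 (Finset.mem_singleton_self h)
  rw [← map_sub, mul_one_div, Real.norm_eq_abs]
  have := abs_listAvg_sub_le hcomm i.2 _ hmem hC
  simp only [hcomm h] at this
  exact this

lemma HasMean.of_surjective {H : Type*} [Group H] (f : G →* H) (hf : Function.Surjective f)
    (hG : HasMean G) : HasMean H := by
  obtain ⟨M, h1, h2, h3⟩ := hG
  refine ⟨M.comp (LinearMap.funLeft ℝ ℝ f), h1, fun φ C hC => h2 _ C fun g => hC _, ?_⟩
  rintro φ ⟨C, hC⟩ h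
  obtain ⟨g, rfl⟩ := hf h
  have := h3 (fun x => φ (f x)) ⟨C, fun x => hC _⟩ g
  simp only [map_mul] at this
  exact this

end Comm

/-! ### Faces of simplices and order statistics of barycentric coordinates -/

/-- The map of simplices induced by a map of vertices. -/
def faceMap {d k : ℕ} (g : Fin (d + 1) → Fin (k + 1)) : C(TopSimplex d, TopSimplex k) :=
  affS fun i => vert k (g i)

section Faces
variable {d k l : ℕ}

lemma vert_apply (i j : Fin (k + 1)) : (vert k i).1 j = if j = i then 1 else 0 := by
  simp [vert, Pi.single_apply]

lemma faceMap_apply_of_injective {g : Fin (d + 1) → Fin (k + 1)} (hg : Function.Injective g)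
    (x : TopSimplex d) (i : Fin (d + 1)) : (faceMap g x).1 (g i) = x.1 i := by
  rw [faceMap, affS_coe]
  simp [vert_apply, hg.eq_iff]

lemma faceMap_apply_of_notMem {g : Fin (d + 1) → Fin (k + 1)} (x : TopSimplex d)
    {j : Fin (k + 1)} (hj : j ∉ Set.range g) : (faceMap g x).1 j = 0 := by
  rw [faceMap, affS_coe]
  refine Finset.sum_eq_zero fun i _ => ?_
  rw [vert_apply, if_neg, mul_zero]
  rintro rfl
  exact hj ⟨i, rfl⟩

lemma faceMap_comp (g : Fin (k + 1) → Fin (l + 1)) (e : Fin (d + 1) → Fin (k + 1)) :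
    (faceMap g).comp (faceMap e) = faceMap (g ∘ e) := by
  rw [faceMap, faceMap, affS_comp_affS]
  congr 1
  funext i
  simp [affS_vert]

lemma faceMap_faceMap (g : Fin (k + 1) → Fin (l + 1)) (e : Fin (d + 1) → Fin (k + 1))
    (x : TopSimplex d) : faceMap g (faceMap e x) = faceMap (g ∘ e) x := by
  rw [← faceMap_comp]; rfl

lemma coface_eq_faceMap (i : Fin (k + 2)) : coface i = faceMap i.succAbove := by
  rw [coface_eq_affS]; rfl

lemma faceMap_vert (g : Fin (d + 1) → Fin (k + 1)) (i : Fin (d + 1)) :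
    faceMap g (vert d i) = vert k (g i) := affS_vert _ i

/-- The set of vertices with nonzero barycentric coordinate. -/
def vsupp (x : TopSimplex k) : Finset (Fin (k + 1)) := {i | x.1 i ≠ 0}

lemma mem_vsupp {x : TopSimplex k} {i : Fin (k + 1)} : i ∈ vsupp x ↔ x.1 i ≠ 0 := by
  simp [vsupp]

lemma vsupp_faceMap {g : Fin (d + 1) ↪ Fin (k + 1)} (x : TopSimplex d) :
    vsupp (faceMap g x) = (vsupp x).map g := by
  ext j
  rw [mem_vsupp, Finset.mem_map]
  constructor
  · intro h
    have : j ∈ Set.range g := by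
      by_contra hj
      exact h (faceMap_apply_of_notMem x hj)
    obtain ⟨i, rfl⟩ := this
    rw [faceMap_apply_of_injective g.injective] at h
    exact ⟨i, mem_vsupp.2 h, rfl⟩
  · rintro ⟨i, hi, rfl⟩
    rw [faceMap_apply_of_injective g.injective]
    exact mem_vsupp.1 hi

lemma mem_faceSet_iff {x : TopSimplex k} {S : Finset (Fin (k + 1))} :
    x ∈ faceSet k S ↔ vsupp x ⊆ S := by
  simp only [faceSet, Set.mem_ofPred_eq, Finset.subset_iff, mem_vsupp]
  exact forall_congr' fun j => not_imp_comm

/-- A retraction onto a face of the simplex. -/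
def faceRetr (e : Fin (d + 1) ↪o Fin (k + 1)) : C(TopSimplex k, TopSimplex d) :=
  affS fun i => open Classical in if h : ∃ j, e j = i then vert d h.choose else center d

lemma faceRetr_faceMap (e : Fin (d + 1) ↪o Fin (k + 1)) (x : TopSimplex d) :
    faceRetr e (faceMap e x) = x := by
  have : (faceRetr e).comp (faceMap e) = ContinuousMap.id _ := by
    rw [faceRetr, faceMap, affS_comp_affS, ← affS_vert_eq_id]
    congr 1
    funext j
    rw [Function.comp_apply, affS_vert, dif_pos ⟨j, rfl⟩]
    have h : ∃ j', e j' = e j := ⟨j, rfl⟩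
    rw [e.injective h.choose_spec]
  exact DFunLike.congr_fun this x

lemma exists_faceMap_eq {g : Fin (d + 1) ↪ Fin (k + 1)} {x : TopSimplex k}
    (h : ∀ i ∈ vsupp x, i ∈ Set.range g) : ∃ y, faceMap g y = x := by
  have hsum : ∑ i, x.1 (g i) = 1 := by
    rw [← x.2.2, ← Finset.sum_map Finset.univ g (fun j => x.1 j)]
    refine Finset.sum_subset (Finset.subset_univ _) fun j _ hj => ?_
    by_contra hx
    obtain ⟨i, rfl⟩ := h j (mem_vsupp.2 hx)
    exact hj (Finset.mem_map_of_mem g (Finset.mem_univ i))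
  refine ⟨⟨fun i => x.1 (g i), fun i => x.2.1 _, hsum⟩, ?_⟩
  apply Subtype.ext
  funext j
  by_cases hj : j ∈ Set.range g
  · obtain ⟨i, rfl⟩ := hj
    rw [faceMap_apply_of_injective g.injective]
  · rw [faceMap_apply_of_notMem _ hj]
    by_contra hx
    exact hj (h j (mem_vsupp.2 (Ne.symm hx)))

lemma faceMap_faceRetr {e : Fin (d + 1) ↪o Fin (k + 1)} {x : TopSimplex k}
    (h : ∀ i ∈ vsupp x, i ∈ Set.range e) : faceMap e (faceRetr e x) = x := by
  obtain ⟨y, rfl⟩ := exists_faceMap_eq (g := e.toEmbedding) (x := x) h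
  exact congrArg _ (faceRetr_faceMap e y)

lemma exists_orderEmb {S : Finset (Fin (k + 1))} (hS : S.card ≤ d + 1) (hdk : d ≤ k) :
    ∃ e : Fin (d + 1) ↪o Fin (k + 1), ∀ i ∈ S, i ∈ Set.range e := by
  obtain ⟨T, hST, hT⟩ := Finset.exists_superset_card_eq hS (by simpa using hdk)
  refine ⟨T.orderEmbOfFin hT, fun i hi => ?_⟩
  rw [Finset.range_orderEmbOfFin]
  exact hST hi

/-- The collection of small sets of vertices. -/
def smallSets (k m : ℕ) : Finset (Finset (Fin (k + 1))) := {S | S.card ≤ m}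

lemma smallSets_nonempty (k m : ℕ) : (smallSets k m).Nonempty := ⟨∅, by simp [smallSets]⟩

/-- The `m`-th largest coordinate, counting from zero. -/
def kth (m : ℕ) (x : Fin (k + 1) → ℝ) : ℝ :=
  (smallSets k m).inf' (smallSets_nonempty k m) fun S =>
    Finset.univ.sup' Finset.univ_nonempty fun i => if i ∈ S then 0 else x i

lemma continuous_kth (m : ℕ) : Continuous (kth m : (Fin (k + 1) → ℝ) → ℝ) := by
  unfold kth
  refine Continuous.finset_inf'_apply _ fun S _ => Continuous.finset_sup'_apply _ fun i _ => ?_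
  split_ifs
  · exact continuous_const
  · exact continuous_apply i

lemma kth_le_iff {m : ℕ} {x : Fin (k + 1) → ℝ} {c : ℝ} (hc : 0 ≤ c) :
    kth m x ≤ c ↔ (Finset.univ.filter fun i => c < x i).card ≤ m := by
  rw [kth, Finset.inf'_le_iff]
  constructor
  · rintro ⟨S, hS, h⟩
    refine (Finset.card_le_card fun i hi => ?_).trans (by simpa [smallSets] using hS)
    by_contra hiS
    have := (Finset.sup'_le_iff _ _).1 h i (Finset.mem_univ i)
    rw [if_neg hiS] at this
    exact absurd this (not_le.2 (Finset.mem_filter.1 hi).2)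
  · intro h
    refine ⟨_, by simpa [smallSets] using h, (Finset.sup'_le_iff _ _).2 fun i _ => ?_⟩
    split_ifs with hi
    · exact hc
    · simpa using hi

lemma kth_nonneg (m : ℕ) {x : Fin (k + 1) → ℝ} (hx : ∀ i, 0 ≤ x i) : 0 ≤ kth m x := by
  refine (Finset.le_inf'_iff _ _).2 fun S _ => ?_
  refine le_trans ?_ (Finset.le_sup' _ (Finset.mem_univ 0))
  split_ifs
  · exact le_rfl
  · exact hx 0

lemma le_kth {m : ℕ} {x : Fin (k + 1) → ℝ} {c : ℝ} (hx : ∀ i, 0 ≤ x i)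
    (h : m < (Finset.univ.filter fun i => c ≤ x i).card) : c ≤ kth m x := by
  by_contra hlt
  push Not at hlt
  have h1 := (kth_le_iff (kth_nonneg m hx)).1 (le_refl (kth m x))
  refine absurd (h.trans_le (Finset.card_le_card ?_)) (not_lt.2 h1)
  intro i hi
  simp only [Finset.mem_filter, Finset.mem_univ, true_and] at hi ⊢
  exact hlt.trans_le hi

lemma kth_faceMap (m : ℕ) (g : Fin (d + 1) ↪ Fin (k + 1)) (x : TopSimplex d) :
    kth m (faceMap g x).1 = kth m x.1 := by
  refine eq_of_forall_ge_iff fun c => ?_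
  by_cases hc : 0 ≤ c
  · rw [kth_le_iff hc, kth_le_iff hc]
    have : (Finset.univ.filter fun j => c < (faceMap g x).1 j)
        = (Finset.univ.filter fun i => c < x.1 i).map g := by
      ext j
      simp only [Finset.mem_filter, Finset.mem_univ, true_and, Finset.mem_map]
      constructor
      · intro h
        have : j ∈ Set.range g := by
          by_contra hj
          rw [faceMap_apply_of_notMem x hj] at h
          exact absurd h (not_lt.2 hc)
        obtain ⟨i, rfl⟩ := this
        rw [faceMap_apply_of_injective g.injective] at h
        exact ⟨i, h, rfl⟩
      · rintro ⟨i, hi, rfl⟩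
        rwa [faceMap_apply_of_injective g.injective]
    rw [this, Finset.card_map]
  · have h1 := kth_nonneg m (faceMap g x).2.1
    have h2 := kth_nonneg m x.2.1
    push Not at hc
    constructor <;> intro h <;> linarith

lemma le_kth_zero {x : Fin (k + 1) → ℝ} (hx : ∀ i, 0 ≤ x i) (i : Fin (k + 1)) : x i ≤ kth 0 x := by
  have h := (kth_le_iff (kth_nonneg 0 hx)).1 (le_refl (kth 0 x))
  by_contra hlt
  push Not at hlt
  have : i ∈ Finset.univ.filter fun i => kth 0 x < x i := by simpa using hlt
  rw [Finset.card_eq_zero.1 (Nat.le_zero.1 h)] at this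
  simp at this

lemma exists_kth_zero {x : Fin (k + 1) → ℝ} (hx : ∀ i, 0 ≤ x i) : ∃ i, x i = kth 0 x := by
  obtain ⟨i, -, hi⟩ := Finset.exists_max_image Finset.univ x Finset.univ_nonempty
  refine ⟨i, le_antisymm (le_kth_zero hx i) ?_⟩
  rw [kth_le_iff (hx i), Nat.le_zero, Finset.card_eq_zero, Finset.filter_eq_empty_iff]
  intro j _
  exact not_lt.2 (hi j (Finset.mem_univ j))

lemma kth_zero_pos (x : TopSimplex k) : 0 < kth 0 x.1 := by
  by_contra h
  have h0 : ∀ i, x.1 i = 0 := fun i =>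
    le_antisymm ((le_kth_zero x.2.1 i).trans (not_lt.1 h)) (x.2.1 i)
  have := x.2.2
  simp [h0] at this

lemma kth_eq_zero {m : ℕ} {x : TopSimplex k} (h : (vsupp x).card ≤ m) : kth m x.1 = 0 := by
  refine le_antisymm ((kth_le_iff le_rfl).2 ?_) (kth_nonneg m x.2.1)
  refine (Finset.card_le_card fun i hi => ?_).trans h
  rw [mem_vsupp]
  exact (Finset.mem_filter.1 hi).2.ne'

/-! ### Truncation of barycentric coordinates -/

/-- The truncation level. -/
def level (d : ℕ) (s : unitInterval) (x : TopSimplex k) : ℝ :=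
  min (kth (d + 1) x.1) (s * kth 0 x.1 / 2)

lemma level_nonneg (s : unitInterval) (x : TopSimplex k) : 0 ≤ level d s x :=
  le_min (kth_nonneg _ x.2.1) (by have := kth_zero_pos x; have := s.2.1; positivity)

lemma level_lt (s : unitInterval) (x : TopSimplex k) : level d s x < kth 0 x.1 := by
  refine (min_le_right _ _).trans_lt ?_
  have := kth_zero_pos x
  nlinarith [s.2.2]

lemma sum_trunc_pos (s : unitInterval) (x : TopSimplex k) :
    0 < ∑ i, max (x.1 i - level d s x) 0 := by
  obtain ⟨i, hi⟩ := exists_kth_zero x.2.1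
  refine Finset.sum_pos' (fun i _ => le_max_right _ _) ⟨i, Finset.mem_univ i, ?_⟩
  rw [hi]
  exact lt_max_of_lt_left (sub_pos.2 (level_lt s x))

/-- Truncate the barycentric coordinates and renormalize. -/
def trunc (d : ℕ) (s : unitInterval) (x : TopSimplex k) : TopSimplex k :=
  ⟨fun i => max (x.1 i - level d s x) 0 / ∑ j, max (x.1 j - level d s x) 0,
    fun i => div_nonneg (le_max_right _ _) (sum_trunc_pos s x).le, by
      rw [← Finset.sum_div, div_self (sum_trunc_pos s x).ne']⟩

lemma continuous_level : Continuous fun p : unitInterval × TopSimplex k => level d p.1 p.2 := by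
  unfold level
  have h1 : ∀ m, Continuous fun p : unitInterval × TopSimplex k => kth m p.2.1 := fun m =>
    (continuous_kth m).comp (continuous_subtype_val.comp continuous_snd)
  exact (h1 _).min (((continuous_subtype_val.comp continuous_fst).mul (h1 0)).div_const 2)

lemma continuous_trunc : Continuous fun p : unitInterval × TopSimplex k => trunc d p.1 p.2 := by
  have h : ∀ i, Continuous fun p : unitInterval × TopSimplex k =>
      max (p.2.1 i - level d p.1 p.2) 0 := fun i =>
    (((continuous_apply i).comp (continuous_subtype_val.comp continuous_snd)).sub
      continuous_level).max continuous_const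
  refine Continuous.subtype_mk (continuous_pi fun i => ?_) _
  exact (h i).div (continuous_finsetSum _ fun j _ => h j) fun p => (sum_trunc_pos p.1 p.2).ne'

lemma trunc_eq_self {s : unitInterval} {x : TopSimplex k} (h : level d s x = 0) :
    trunc d s x = x := by
  apply Subtype.ext
  funext i
  have : ∀ j, max (x.1 j) 0 = x.1 j := fun j => max_eq_left (x.2.1 j)
  simp only [trunc, h, sub_zero, this]
  rw [x.2.2, div_one]

lemma vsupp_trunc (s : unitInterval) (x : TopSimplex k) :
    vsupp (trunc d s x) = Finset.univ.filter fun i => level d s x < x.1 i := by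
  ext i
  rw [mem_vsupp]
  simp only [trunc, ne_eq, div_eq_zero_iff, (sum_trunc_pos s x).ne', or_false, Finset.mem_filter,
    Finset.mem_univ, true_and, max_eq_right_iff, sub_nonpos, not_le]

lemma vsupp_trunc_subset (s : unitInterval) (x : TopSimplex k) :
    vsupp (trunc d s x) ⊆ vsupp x := by
  intro i hi
  rw [vsupp_trunc] at hi
  exact mem_vsupp.2 ((level_nonneg s x).trans_lt (Finset.mem_filter.1 hi).2).ne'

lemma level_faceMap (s : unitInterval) {m : ℕ} (g : Fin (m + 1) ↪ Fin (k + 1))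
    (x : TopSimplex m) : level d s (faceMap g x) = level d s x := by
  simp only [level, kth_faceMap]

lemma trunc_faceMap (s : unitInterval) {m : ℕ} (g : Fin (m + 1) ↪ Fin (k + 1))
    (x : TopSimplex m) : trunc d s (faceMap g x) = faceMap g (trunc d s x) := by
  have hsum : ∑ j, max ((faceMap g x).1 j - level d s x) 0
      = ∑ i, max (x.1 i - level d s x) 0 := by
    have h1 : ∀ i, max (x.1 i - level d s x) 0 = max ((faceMap g x).1 (g i) - level d s x) 0 :=
      fun i => by rw [faceMap_apply_of_injective g.injective]
    simp only [h1]
    rw [← Finset.sum_map Finset.univ g (fun j => max ((faceMap g x).1 j - level d s x) 0)]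
    symm
    refine Finset.sum_subset (Finset.subset_univ _) fun j _ hj => ?_
    rw [faceMap_apply_of_notMem x (by simpa using hj)]
    simpa using level_nonneg s x
  apply Subtype.ext
  funext j
  by_cases hj : j ∈ Set.range g
  · obtain ⟨i, rfl⟩ := hj
    rw [faceMap_apply_of_injective g.injective]
    simp only [trunc, level_faceMap, hsum, faceMap_apply_of_injective g.injective]
  · rw [faceMap_apply_of_notMem _ hj]
    simp only [trunc, level_faceMap, faceMap_apply_of_notMem _ hj]
    rw [max_eq_right (by simpa using level_nonneg s x), zero_div]

lemma card_vsupp_trunc {s : unitInterval} {x : TopSimplex k}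
    (h : 2 * kth (d + 1) x.1 ≤ s * kth 0 x.1) : (vsupp (trunc d s x)).card ≤ d + 1 := by
  rw [vsupp_trunc, level, min_eq_left (by linarith)]
  exact (kth_le_iff (kth_nonneg _ x.2.1)).1 le_rfl

/-- Points of large support are truncations. -/
lemma exists_trunc_eq (s : unitInterval) {z : TopSimplex k} (hz : d + 1 < (vsupp z).card) :
    ∃ x, vsupp x ⊆ vsupp z ∧ (s : ℝ) * kth 0 x.1 ≤ 2 * kth (d + 1) x.1 ∧ trunc d s x = z := by
  have hs := s.2
  have hM := kth_zero_pos z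
  set M := kth 0 z.1 with hMdef
  set c := M * s / (2 - s) with hc
  have h2s : (0 : ℝ) < 2 - s := by linarith [hs.2]
  have hc0 : 0 ≤ c := by have := hs.1; positivity
  set N := 1 + c * (vsupp z).card with hN
  have hN0 : 0 < N := by positivity
  have hcs : s * (M + c) / 2 = c := by rw [hc]; field_simp; ring
  classical
  set f : Fin (k + 1) → ℝ := fun i => if i ∈ vsupp z then (z.1 i + c) / N else 0 with hf
  have hf0 : ∀ i, 0 ≤ f i := fun i => by
    simp only [hf]; split_ifs
    · exact div_nonneg (add_nonneg (z.2.1 i) hc0) hN0.le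
    · exact le_rfl
  have hzsum : ∑ i ∈ vsupp z, z.1 i = 1 := by
    rw [← z.2.2]
    exact Finset.sum_subset (Finset.subset_univ _) fun i _ hi => by
      simpa [mem_vsupp] using hi
  have hf1 : ∑ i, f i = 1 := by
    simp only [hf]
    rw [Finset.sum_ite_mem, Finset.univ_inter, ← Finset.sum_div, Finset.sum_add_distrib, hzsum,
      Finset.sum_const, nsmul_eq_mul, mul_comm _ c, ← hN, div_self hN0.ne']
  set x : TopSimplex k := ⟨f, hf0, hf1⟩ with hx
  obtain ⟨i₀, hi₀⟩ := exists_kth_zero z.2.1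
  have hi₀s : i₀ ∈ vsupp z := mem_vsupp.2 (by rw [hi₀]; exact hM.ne')
  have hk0 : kth 0 x.1 = (M + c) / N := by
    apply le_antisymm
    · rw [kth_le_iff (by positivity), Nat.le_zero, Finset.card_eq_zero,
        Finset.filter_eq_empty_iff]
      intro i _
      rw [not_lt]
      simp only [hx, hf]
      split_ifs
      · have := le_kth_zero z.2.1 i
        gcongr
      · positivity
    · have : x.1 i₀ = (M + c) / N := by simp only [hx, hf, if_pos hi₀s, hi₀, hMdef]
      rw [← this]
      exact le_kth_zero x.2.1 i₀
  have hk1 : c / N ≤ kth (d + 1) x.1 := by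
    refine le_kth x.2.1 (hz.trans_le (Finset.card_le_card fun i hi => ?_))
    simp only [Finset.mem_filter, Finset.mem_univ, true_and, hx, hf, if_pos hi]
    have := z.2.1 i
    gcongr
    linarith
  have hsk : (s : ℝ) * kth 0 x.1 / 2 = c / N := by
    rw [hk0, show (s : ℝ) * ((M + c) / N) / 2 = (s * (M + c) / 2) / N by ring, hcs]
  have hlev : level d s x = c / N := by
    rw [level, hsk, min_eq_right hk1]
  have hdiff : ∀ i, max (x.1 i - level d s x) 0 = z.1 i / N := fun i => by
    rw [hlev]
    simp only [hx, hf]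
    split_ifs with hi
    · rw [← sub_div, add_sub_cancel_right, max_eq_left (div_nonneg (z.2.1 i) hN0.le)]
    · have : z.1 i = 0 := by simpa [mem_vsupp] using hi
      rw [this, zero_div, max_eq_right]
      have := div_nonneg hc0 hN0.le
      linarith
  refine ⟨x, fun i hi => ?_, by linarith, ?_⟩
  · by_contra h
    exact mem_vsupp.1 hi (by simp only [hx, hf, if_neg h])
  · apply Subtype.ext
    funext i
    simp only [trunc, hdiff]
    rw [← Finset.sum_div, z.2.2]
    field_simp

end Faces

/-! ### Extending homotopies of the `d`-skeleton -/

/-- Homotopies of the `d`-faces of `τ`, starting at `τ` and constant on boundaries. -/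
structure SkelHomotopy {Z : Type*} [TopologicalSpace Z] {d k : ℕ} (τ : C(TopSimplex k, Z))
    (h : (Fin (d + 1) ↪o Fin (k + 1)) → C(unitInterval × TopSimplex d, Z)) : Prop where
  zero : ∀ e x, h e (0, x) = τ (faceMap e x)
  bdry : ∀ e s x, (∃ j, x.1 j = 0) → h e (s, x) = τ (faceMap e x)

section Theta
variable {Z : Type*} [TopologicalSpace Z] {d k m : ℕ} {τ : C(TopSimplex k, Z)}
  {h : (Fin (d + 1) ↪o Fin (k + 1)) → C(unitInterval × TopSimplex d, Z)}

/-- The part of the time left after truncation. -/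
def lateTime (d : ℕ) (s : unitInterval) (x : TopSimplex k) : unitInterval :=
  Set.projIcc 0 1 zero_le_one ((s : ℝ) - 2 * kth (d + 1) x.1 / kth 0 x.1)

lemma continuous_lateTime :
    Continuous fun p : unitInterval × TopSimplex k => lateTime d p.1 p.2 := by
  have h1 : ∀ m, Continuous fun p : unitInterval × TopSimplex k => kth m p.2.1 := fun m =>
    (continuous_kth m).comp (continuous_subtype_val.comp continuous_snd)
  refine continuous_projIcc.comp ((continuous_subtype_val.comp continuous_fst).sub ?_)
  exact (continuous_const.mul (h1 _)).div (h1 0) fun p => (kth_zero_pos p.2).ne'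

lemma lateTime_faceMap (s : unitInterval) (g : Fin (m + 1) ↪ Fin (k + 1)) (x : TopSimplex m) :
    lateTime d s (faceMap g x) = lateTime d s x := by
  simp only [lateTime, kth_faceMap]

lemma lateTime_eq_self {s : unitInterval} {x : TopSimplex k} (hx : kth (d + 1) x.1 = 0) :
    lateTime d s x = s := by
  rw [lateTime, hx, mul_zero, zero_div, sub_zero, Set.projIcc_val]

lemma lateTime_eq_zero {s : unitInterval} {x : TopSimplex k}
    (hx : (s : ℝ) * kth 0 x.1 ≤ 2 * kth (d + 1) x.1) : lateTime d s x = 0 := by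
  refine Set.projIcc_of_le_left _ ?_
  rw [sub_nonpos, le_div_iff₀ (kth_zero_pos x)]
  exact hx

/-- The extension of the homotopies `h` of the `d`-faces of `τ`, as a function. -/
def thetaFun (τ : C(TopSimplex k, Z))
    (h : (Fin (d + 1) ↪o Fin (k + 1)) → C(unitInterval × TopSimplex d, Z))
    (s : unitInterval) (x : TopSimplex k) : Z :=
  open Classical in
  if H : ∃ e : Fin (d + 1) ↪o Fin (k + 1), 2 * kth (d + 1) x.1 ≤ s * kth 0 x.1 ∧
      ∀ i ∈ vsupp (trunc d s x), i ∈ Set.range e then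
    h H.choose (lateTime d s x, faceRetr H.choose (trunc d s x))
  else τ (trunc d s x)

lemma SkelHomotopy.choice_indep (H : SkelHomotopy τ h) {e e' : Fin (d + 1) ↪o Fin (k + 1)}
    {y : TopSimplex k} (he : ∀ i ∈ vsupp y, i ∈ Set.range e)
    (he' : ∀ i ∈ vsupp y, i ∈ Set.range e') (s : unitInterval) :
    h e (s, faceRetr e y) = h e' (s, faceRetr e' y) := by
  by_cases hee : e = e'
  · rw [hee]
  have key : ∀ e e' : Fin (d + 1) ↪o Fin (k + 1), e ≠ e' → (∀ i ∈ vsupp y, i ∈ Set.range e) →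
      (∀ i ∈ vsupp y, i ∈ Set.range e') → h e (s, faceRetr e y) = τ y := by
    intro e e' hne he he'
    have hj : ∃ j, e j ∉ Set.range e' := by
      by_contra hall
      push Not at hall
      have hsub : Set.range e ⊆ Set.range e' := by
        rintro _ ⟨j, rfl⟩; exact hall j
      have heq : Set.range e = Set.range e' := by
        refine Set.eq_of_subset_of_ncard_le hsub ?_ (Set.toFinite _)
        rw [← Set.image_univ, ← Set.image_univ, Set.ncard_image_of_injective _ e.injective,
          Set.ncard_image_of_injective _ e'.injective]
      exact hne (OrderEmbedding.range_inj.1 heq)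
    obtain ⟨j, hj⟩ := hj
    rw [H.bdry e s _ ⟨j, ?_⟩, faceMap_faceRetr he]
    have h1 := faceMap_apply_of_injective e.injective (faceRetr e y) j
    rw [faceMap_faceRetr he] at h1
    rw [← h1]
    by_contra h0
    exact hj (he' _ (mem_vsupp.2 h0))
  rw [key e e' hee he he', key e' e (Ne.symm hee) he' he]

lemma SkelHomotopy.thetaFun_of_mem (H : SkelHomotopy τ h) {s : unitInterval} {x : TopSimplex k}
    {e : Fin (d + 1) ↪o Fin (k + 1)} (hs : 2 * kth (d + 1) x.1 ≤ s * kth 0 x.1)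
    (he : ∀ i ∈ vsupp (trunc d s x), i ∈ Set.range e) :
    thetaFun τ h s x = h e (lateTime d s x, faceRetr e (trunc d s x)) := by
  have hex : ∃ e : Fin (d + 1) ↪o Fin (k + 1), 2 * kth (d + 1) x.1 ≤ s * kth 0 x.1 ∧
      ∀ i ∈ vsupp (trunc d s x), i ∈ Set.range e := ⟨e, hs, he⟩
  rw [thetaFun, dif_pos hex]
  exact H.choice_indep hex.choose_spec.2 he _

lemma SkelHomotopy.thetaFun_of_ge (H : SkelHomotopy τ h) {s : unitInterval} {x : TopSimplex k}
    (hs : (s : ℝ) * kth 0 x.1 ≤ 2 * kth (d + 1) x.1) :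
    thetaFun τ h s x = τ (trunc d s x) := by
  by_cases hex : ∃ e : Fin (d + 1) ↪o Fin (k + 1), 2 * kth (d + 1) x.1 ≤ s * kth 0 x.1 ∧
      ∀ i ∈ vsupp (trunc d s x), i ∈ Set.range e
  · obtain ⟨e, h1, h2⟩ := hex
    rw [H.thetaFun_of_mem h1 h2, lateTime_eq_zero hs, H.zero, faceMap_faceRetr h2]
  · rw [thetaFun, dif_neg hex]

lemma SkelHomotopy.thetaFun_of_card (H : SkelHomotopy τ h) {s : unitInterval} {x : TopSimplex k}
    (hx : (vsupp x).card ≤ d) : thetaFun τ h s x = τ x := by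
  have hk : kth (d + 1) x.1 = 0 := kth_eq_zero (hx.trans (Nat.le_succ d))
  have ht : trunc d s x = x := trunc_eq_self (by
    have := kth_zero_pos x
    have := s.2.1
    rw [level, hk]; exact min_eq_left (by positivity))
  by_cases hex : ∃ e : Fin (d + 1) ↪o Fin (k + 1), 2 * kth (d + 1) x.1 ≤ s * kth 0 x.1 ∧
      ∀ i ∈ vsupp (trunc d s x), i ∈ Set.range e
  · obtain ⟨e, h1, h2⟩ := hex
    rw [H.thetaFun_of_mem h1 h2]
    rw [ht] at h2 ⊢
    have hj : ∃ j, (faceRetr e x).1 j = 0 := by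
      by_contra hall
      push Not at hall
      have h3 : vsupp (faceRetr e x) = Finset.univ := by
        ext j; simpa [mem_vsupp] using hall j
      have h4 := congrArg vsupp (faceMap_faceRetr h2)
      rw [show faceMap ⇑e = faceMap ⇑e.toEmbedding from rfl, vsupp_faceMap, h3] at h4
      rw [← h4] at hx
      simp at hx
    rw [H.bdry e _ _ hj, faceMap_faceRetr h2]
  · rw [thetaFun, dif_neg hex, ht]

lemma SkelHomotopy.thetaFun_zero (H : SkelHomotopy τ h) (x : TopSimplex k) :
    thetaFun τ h 0 x = τ x := by
  rw [H.thetaFun_of_ge, trunc_eq_self]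
  · rw [level]
    simpa using kth_nonneg (d + 1) x.2.1
  · simpa using kth_nonneg (d + 1) x.2.1

lemma SkelHomotopy.thetaFun_faceMap (H : SkelHomotopy τ h) (e : Fin (d + 1) ↪o Fin (k + 1))
    (s : unitInterval) (y : TopSimplex d) : thetaFun τ h s (faceMap e y) = h e (s, y) := by
  have hsub : ∀ i ∈ vsupp (faceMap e y), i ∈ Set.range e := by
    intro i hi
    by_contra hni
    exact mem_vsupp.1 hi (faceMap_apply_of_notMem y hni)
  have hk : kth (d + 1) (faceMap e y).1 = 0 := by
    rw [show faceMap ⇑e = faceMap ⇑e.toEmbedding from rfl, kth_faceMap]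
    exact kth_eq_zero ((Finset.card_le_univ _).trans (by simp))
  have hM := kth_zero_pos (faceMap e y)
  have hs0 := s.2.1
  have ht : trunc d s (faceMap e y) = faceMap e y := trunc_eq_self (by
    rw [level, hk]; exact min_eq_left (by positivity))
  rw [H.thetaFun_of_mem (e := e) (by rw [hk, mul_zero]; positivity) (by rwa [ht]),
    lateTime_eq_self hk, ht, faceRetr_faceMap]

lemma SkelHomotopy.continuous_thetaFun (H : SkelHomotopy τ h) :
    Continuous fun p : unitInterval × TopSimplex k => thetaFun τ h p.1 p.2 := by
  have hk : ∀ m, Continuous fun p : unitInterval × TopSimplex k => kth m p.2.1 := fun m =>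
    (continuous_kth m).comp (continuous_subtype_val.comp continuous_snd)
  have hI : Continuous fun p : unitInterval × TopSimplex k => (p.1 : ℝ) :=
    continuous_subtype_val.comp continuous_fst
  rcases lt_or_ge k d with hkd | hkd
  · have : (fun p : unitInterval × TopSimplex k => thetaFun τ h p.1 p.2) = fun p => τ p.2 := by
      funext p
      exact H.thetaFun_of_card ((Finset.card_le_univ _).trans (by simpa using hkd))
    rw [this]
    exact τ.continuous.comp continuous_snd
  let A : Option (Fin (d + 1) ↪o Fin (k + 1)) → Set (unitInterval × TopSimplex k) := fun o =>
    o.elim {p | (p.1 : ℝ) * kth 0 p.2.1 ≤ 2 * kth (d + 1) p.2.1} fun e =>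
      {p | 2 * kth (d + 1) p.2.1 ≤ p.1 * kth 0 p.2.1} ∩
        ⋂ i ∈ (Set.range e)ᶜ, {p | (trunc d p.1 p.2).1 i = 0}
  have hA : ∀ e p, p ∈ A (some e) ↔ 2 * kth (d + 1) p.2.1 ≤ p.1 * kth 0 p.2.1 ∧
      ∀ i ∈ vsupp (trunc d p.1 p.2), i ∈ Set.range e := by
    intro e p
    simp only [A, Option.elim_some, Set.mem_inter_iff, Set.mem_iInter, mem_vsupp,
      Set.mem_compl_iff]
    refine and_congr Iff.rfl (forall_congr' fun i => ?_)
    exact not_imp_comm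
  refine LocallyFinite.continuous (f := A) (locallyFinite_of_finite A) ?_ ?_ ?_
  · refine Set.eq_univ_of_forall fun p => Set.mem_iUnion.2 ?_
    rcases le_total ((p.1 : ℝ) * kth 0 p.2.1) (2 * kth (d + 1) p.2.1) with hp | hp
    · exact ⟨none, hp⟩
    · obtain ⟨e, he⟩ := exists_orderEmb (card_vsupp_trunc hp) hkd
      exact ⟨some e, (hA e p).2 ⟨hp, he⟩⟩
  · rintro (_ | e)
    · exact isClosed_le (hI.mul (hk 0)) (continuous_const.mul (hk _))
    · refine (isClosed_le (continuous_const.mul (hk _)) (hI.mul (hk 0))).inter ?_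
      refine isClosed_biInter fun i _ => isClosed_eq ?_ continuous_const
      exact (continuous_apply i).comp (continuous_subtype_val.comp (continuous_trunc (d := d)))
  · rintro (_ | e)
    · refine (τ.continuous.comp (continuous_trunc (d := d))).continuousOn.congr fun p hp => ?_
      exact H.thetaFun_of_ge hp
    · refine ((h e).continuous.comp ((continuous_lateTime (d := d)).prodMk
        ((faceRetr e).continuous.comp (continuous_trunc (d := d))))).continuousOn.congr fun p hp => ?_
      exact H.thetaFun_of_mem ((hA e p).1 hp).1 ((hA e p).1 hp).2

open Classical in
/-- The extension of the homotopies `h` of the `d`-faces of `τ` to a homotopy of `τ`. -/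
def theta (τ : C(TopSimplex k, Z))
    (h : (Fin (d + 1) ↪o Fin (k + 1)) → C(unitInterval × TopSimplex d, Z)) :
    C(unitInterval × TopSimplex k, Z) :=
  if H : SkelHomotopy τ h then ⟨fun p => thetaFun τ h p.1 p.2, H.continuous_thetaFun⟩
  else τ.comp ContinuousMap.snd

lemma SkelHomotopy.theta_apply (H : SkelHomotopy τ h) (s : unitInterval) (x : TopSimplex k) :
    theta τ h (s, x) = thetaFun τ h s x := by
  rw [theta, dif_pos H]; rfl

lemma theta_zero (x : TopSimplex k) : theta τ h (0, x) = τ x := by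
  by_cases H : SkelHomotopy τ h
  · rw [H.theta_apply, H.thetaFun_zero]
  · rw [theta, dif_neg H]; rfl

lemma theta_of_card {s : unitInterval} {x : TopSimplex k} (hx : (vsupp x).card ≤ d) :
    theta τ h (s, x) = τ x := by
  by_cases H : SkelHomotopy τ h
  · rw [H.theta_apply, H.thetaFun_of_card hx]
  · rw [theta, dif_neg H]; rfl

lemma SkelHomotopy.comp_face (H : SkelHomotopy τ h) (g : Fin (m + 1) ↪o Fin (k + 1)) :
    SkelHomotopy (τ.comp (faceMap g)) fun e : Fin (d + 1) ↪o Fin (m + 1) => h (e.trans g) where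
  zero e x := by
    rw [H.zero, ContinuousMap.comp_apply, faceMap_faceMap]; rfl
  bdry e s x hx := by
    rw [H.bdry _ _ _ hx, ContinuousMap.comp_apply, faceMap_faceMap]; rfl

lemma SkelHomotopy.theta_face (H : SkelHomotopy τ h) (g : Fin (m + 1) ↪o Fin (k + 1))
    (s : unitInterval) (x : TopSimplex m) :
    theta τ h (s, faceMap g x)
      = theta (τ.comp (faceMap g)) (fun e : Fin (d + 1) ↪o Fin (m + 1) => h (e.trans g)) (s, x) := by
  have H' := H.comp_face g
  rw [H.theta_apply, H'.theta_apply]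
  have hg : ∀ x : TopSimplex m, faceMap ⇑g x = faceMap ⇑g.toEmbedding x := fun _ => rfl
  have hkf : ∀ j, kth j (faceMap g x).1 = kth j x.1 := fun j => kth_faceMap j g.toEmbedding x
  have htr : trunc d s (faceMap g x) = faceMap g (trunc d s x) := trunc_faceMap s g.toEmbedding x
  rcases lt_or_ge m d with hmd | hmd
  · have h1 : (vsupp x).card ≤ d := (Finset.card_le_univ _).trans (by simpa using hmd)
    rw [H'.thetaFun_of_card h1, H.thetaFun_of_card]
    · rfl
    · rwa [hg, vsupp_faceMap, Finset.card_map]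
  rcases le_total ((s : ℝ) * kth 0 x.1) (2 * kth (d + 1) x.1) with hp | hp
  · rw [H'.thetaFun_of_ge hp, H.thetaFun_of_ge (by rw [hkf, hkf]; exact hp), htr]
    rfl
  · obtain ⟨e, he⟩ := exists_orderEmb (card_vsupp_trunc hp) hmd
    have he' : ∀ i ∈ vsupp (trunc d s (faceMap g x)), i ∈ Set.range (e.trans g) := by
      intro i hi
      rw [htr, hg, vsupp_faceMap] at hi
      obtain ⟨j, hj, rfl⟩ := Finset.mem_map.1 hi
      obtain ⟨l, rfl⟩ := he j hj
      exact ⟨l, rfl⟩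
    rw [H'.thetaFun_of_mem hp he, H.thetaFun_of_mem (by rw [hkf, hkf]; exact hp) he']
    congr 2
    · exact lateTime_faceMap s g.toEmbedding x
    · have h1 := faceMap_faceRetr he'
      rw [htr] at h1 ⊢
      rw [← faceMap_faceRetr he, faceMap_faceMap]
      rw [show (⇑g ∘ ⇑e) = ⇑(e.trans g) from rfl, faceRetr_faceMap, faceRetr_faceMap]

/-- The homotopy `theta` preserves which faces are mapped to a given set. -/
lemma SkelHomotopy.theta_mem_iff (H : SkelHomotopy τ h) (L : Set Z)
    (hL : ∀ e s, (∀ x, h e (s, x) ∈ L) ↔ ∀ x, τ (faceMap e x) ∈ L) (S : Finset (Fin (k + 1)))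
    (s : unitInterval) :
    (∀ x ∈ faceSet k S, theta τ h (s, x) ∈ L) ↔ ∀ x ∈ faceSet k S, τ x ∈ L := by
  rcases lt_or_ge k d with hkd | hkd
  · refine forall₂_congr fun x _ => ?_
    rw [theta_of_card ((Finset.card_le_univ _).trans (by simpa using hkd))]
  have hfull : ∀ {z : TopSimplex k} {e : Fin (d + 1) ↪o Fin (k + 1)}, ¬ (vsupp z).card ≤ d →
      z ∈ faceSet k S → (∀ i ∈ vsupp z, i ∈ Set.range e) → ∀ w, faceMap e w ∈ faceSet k S := by
    intro z e hc hz he w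
    rw [mem_faceSet_iff] at hz ⊢
    have hcard : vsupp z = Finset.univ.map e.toEmbedding := by
      refine Finset.eq_of_subset_of_card_le (fun i hi => ?_) (by simp; omega)
      obtain ⟨j, rfl⟩ := he i hi
      exact Finset.mem_map_of_mem e.toEmbedding (Finset.mem_univ j)
    refine subset_trans ?_ hz
    rw [hcard, show faceMap ⇑e = faceMap ⇑e.toEmbedding from rfl, vsupp_faceMap]
    exact Finset.map_subset_map.2 (Finset.subset_univ _)
  constructor
  · intro hΘ z hz
    by_cases hc : (vsupp z).card ≤ d
    · rw [← theta_of_card (h := h) (s := s) hc]; exact hΘ z hz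
    by_cases hc' : (vsupp z).card ≤ d + 1
    · obtain ⟨e, he⟩ := exists_orderEmb hc' hkd
      have := (hL e s).1 fun w => by
        rw [← H.thetaFun_faceMap, ← H.theta_apply]
        exact hΘ _ (hfull hc hz he w)
      have := this (faceRetr e z)
      rwa [faceMap_faceRetr he] at this
    · obtain ⟨x, hx1, hx2, rfl⟩ := exists_trunc_eq s (not_le.1 hc')
      have := hΘ x (mem_faceSet_iff.2 (hx1.trans (mem_faceSet_iff.1 hz)))
      rwa [H.theta_apply, H.thetaFun_of_ge hx2] at this
  · intro hτ x hx
    have hy : trunc d s x ∈ faceSet k S :=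
      mem_faceSet_iff.2 ((vsupp_trunc_subset s x).trans (mem_faceSet_iff.1 hx))
    rw [H.theta_apply]
    rcases le_total ((s : ℝ) * kth 0 x.1) (2 * kth (d + 1) x.1) with hp | hp
    · rw [H.thetaFun_of_ge hp]; exact hτ _ hy
    · obtain ⟨e, he⟩ := exists_orderEmb (card_vsupp_trunc hp) hkd
      rw [H.thetaFun_of_mem hp he]
      by_cases hc : (vsupp (trunc d s x)).card ≤ d
      · have h1 := H.thetaFun_faceMap e (lateTime d s x) (faceRetr e (trunc d s x))
        rw [faceMap_faceRetr he, H.thetaFun_of_card hc] at h1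
        rw [← h1]
        exact hτ _ hy
      · exact (hL e _).2 (fun w => hτ _ (hfull hc hy he w)) _

end Theta

lemma SkelHomotopy.theta_faceMap {Z : Type*} [TopologicalSpace Z] {d k : ℕ}
    {τ : C(TopSimplex k, Z)}
    {h : (Fin (d + 1) ↪o Fin (k + 1)) → C(unitInterval × TopSimplex d, Z)}
    (H : SkelHomotopy τ h) (e : Fin (d + 1) ↪o Fin (k + 1)) (s : unitInterval)
    (x : TopSimplex d) : theta τ h (s, faceMap e x) = h e (s, x) := by
  have hv : vsupp (faceMap e x) = (vsupp x).map e.toEmbedding := vsupp_faceMap (g := e.toEmbedding) x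
  have hk : kth (d + 1) (faceMap e x).1 = 0 := by
    refine kth_eq_zero ?_
    rw [hv, Finset.card_map]
    exact (Finset.card_le_univ _).trans (by simp)
  have hl : level d s (faceMap e x) = 0 := by
    rw [level, hk, min_eq_left]
    have := kth_zero_pos (faceMap e x)
    have := s.2.1
    positivity
  rw [H.theta_apply, H.thetaFun_of_mem (e := e), lateTime_eq_self hk, trunc_eq_self hl,
    faceRetr_faceMap]
  · rw [hk, mul_zero]
    exact mul_nonneg s.2.1 (kth_zero_pos _).le
  · rw [trunc_eq_self hl, hv]
    intro i hi
    obtain ⟨j, -, rfl⟩ := Finset.mem_map.1 hi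
    exact ⟨j, rfl⟩

/-! ### Commutativity of fundamental groups -/

section Square
variable {Y : Type*} [TopologicalSpace Y]

instance : ContractibleSpace unitInterval :=
  (convex_Icc (0 : ℝ) 1).contractibleSpace ⟨0, by simp⟩

lemma homotopic_of_square {x y z w : Y} {p : Path x y} {q : Path y w} {p' : Path x z}
    {q' : Path z w} (E : C(unitInterval × unitInterval, Y)) (hp : ∀ s, E (s, 0) = p s)
    (hq : ∀ t, E (1, t) = q t) (hp' : ∀ t, E (0, t) = p' t) (hq' : ∀ s, E (s, 1) = q' s) :
    (p.trans q).Homotopic (p'.trans q') := by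
  obtain rfl : E (0, 0) = x := by rw [hp, p.source]
  obtain rfl : E (1, 0) = y := by rw [hp, p.target]
  obtain rfl : E (0, 1) = z := by rw [hp', p'.target]
  obtain rfl : E (1, 1) = w := by rw [hq, q.target]
  let P : Path ((0 : unitInterval), (0 : unitInterval)) (1, 0) :=
    ⟨⟨fun s => (s, 0), by fun_prop⟩, rfl, rfl⟩
  let Q : Path ((1 : unitInterval), (0 : unitInterval)) (1, 1) :=
    ⟨⟨fun s => (1, s), by fun_prop⟩, rfl, rfl⟩
  let P' : Path ((0 : unitInterval), (0 : unitInterval)) (0, 1) :=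
    ⟨⟨fun s => (0, s), by fun_prop⟩, rfl, rfl⟩
  let Q' : Path ((0 : unitInterval), (1 : unitInterval)) (1, 1) :=
    ⟨⟨fun s => (s, 1), by fun_prop⟩, rfl, rfl⟩
  obtain rfl : P.map E.continuous = p := by ext s; exact hp s
  obtain rfl : Q.map E.continuous = q := by ext s; exact hq s
  obtain rfl : P'.map E.continuous = p' := by ext s; exact hp' s
  obtain rfl : Q'.map E.continuous = q' := by ext s; exact hq' s
  rw [← Path.map_trans, ← Path.map_trans]
  exact (SimplyConnectedSpace.paths_homotopic _ _).map E

/-- A free homotopy of loops with a prescribed track of the base point. -/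
def FreelyHomotopic {a b : Y} (b₁ : Path b b) (κ : Path b a) (β : Path a a) : Prop :=
  ∃ H : C(unitInterval × unitInterval, Y), (∀ s, H (s, 0) = b₁ s) ∧ (∀ s, H (s, 1) = β s) ∧
    (∀ t, H (0, t) = κ t) ∧ ∀ t, H (1, t) = κ t

open Path.Homotopic.Quotient in
lemma FreelyHomotopic.conj {a b : Y} {b₁ : Path b b} {κ : Path b a} {β : Path a a}
    (h : FreelyHomotopic b₁ κ β) : (mk κ).symm.trans ((mk b₁).trans (mk κ)) = mk β := by
  obtain ⟨H, h1, h2, h3, h4⟩ := h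
  rw [← mk_trans, Path.Homotopic.Quotient.eq.2 (homotopic_of_square H h1 h4 h3 h2), mk_trans,
    ← trans_assoc, symm_trans, refl_trans]

open Path.Homotopic.Quotient in
lemma quotient_symm_trans_cancel {x y z : Y} (p : Path.Homotopic.Quotient x y)
    (q : Path.Homotopic.Quotient y z) : p.symm.trans (p.trans q) = q := by
  rw [← trans_assoc, symm_trans, refl_trans]

open Path.Homotopic.Quotient in
lemma quotient_trans_symm_cancel {x y z : Y} (p : Path.Homotopic.Quotient x y)
    (q : Path.Homotopic.Quotient x z) : p.trans (p.symm.trans q) = q := by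
  rw [← trans_assoc, trans_symm, refl_trans]

open Path.Homotopic.Quotient in
/-- An Eckmann–Hilton argument. -/
lemma fundamentalGroup_comm {a b : Y} (κ₁ κ₂ : Path b a)
    (H : ∀ β γ : Path a a, ∃ b₁ g₁ : Path b b, FreelyHomotopic b₁ κ₁ β ∧
      FreelyHomotopic g₁ κ₂ γ ∧ ∃ E : C(unitInterval × unitInterval, Y),
        (∀ s, E (s, 0) = b₁ s) ∧ (∀ s, E (s, 1) = b₁ s) ∧ (∀ t, E (0, t) = g₁ t) ∧
        ∀ t, E (1, t) = g₁ t) (x y : FundamentalGroup Y a) : x * y = y * x := by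
  change y.toPath.trans x.toPath = x.toPath.trans y.toPath
  generalize y.toPath = y
  generalize x.toPath = x
  obtain ⟨β, hβ⟩ := mk_surjective x
  obtain ⟨γ, hγ⟩ := mk_surjective
    ((mk κ₂).symm.trans ((mk κ₁).trans (y.trans ((mk κ₁).symm.trans (mk κ₂)))))
  obtain ⟨b₁, g₁, hb, hg, E, h1, h2, h3, h4⟩ := H β γ
  have hc := Path.Homotopic.Quotient.eq.2 (homotopic_of_square E h1 h4 h3 h2)
  rw [mk_trans, mk_trans] at hc
  have hb' := hb.conj
  have hg' := hg.conj
  rw [hβ] at hb'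
  rw [hγ] at hg'
  have hy : y = (mk κ₁).symm.trans ((mk g₁).trans (mk κ₁)) := by
    have := congrArg (fun z => (mk κ₁).symm.trans
      ((mk κ₂).trans (z.trans ((mk κ₂).symm.trans (mk κ₁))))) hg'
    simp only [trans_assoc, quotient_symm_trans_cancel, quotient_trans_symm_cancel, symm_trans,
      trans_refl] at this
    exact this.symm
  have hc' := congrArg (fun z => (mk κ₁).symm.trans (z.trans (mk κ₁))) hc
  simp only [trans_assoc] at hc'
  rw [hy, ← hb']
  simp only [trans_assoc, quotient_trans_symm_cancel]
  exact hc'.symm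

end Square

/-! ### Spaces of simplices with fixed `d`-skeleton -/

section Good
variable {X : Type*} [TopologicalSpace X] {L : Set X} {d k m : ℕ}

/-- `τ` and `τ'` agree on faces of dimension less than `d`, map the same faces to `L`, and
have the same vertices outside `L`. -/
structure Good (L : Set X) (d : ℕ) (τ τ' : C(TopSimplex k, X)) : Prop where
  low : ∀ x, (vsupp x).card ≤ d → τ' x = τ x
  face : ∀ S, (∀ x ∈ faceSet k S, τ' x ∈ L) ↔ ∀ x ∈ faceSet k S, τ x ∈ L
  vertex : ∀ i, τ (vert k i) ∉ L → τ' (vert k i) = τ (vert k i)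

lemma vsupp_vert (i : Fin (k + 1)) : vsupp (vert k i) = {i} := by
  ext j
  simp [mem_vsupp, vert_apply]

lemma eq_vert_of_vsupp_subset {x : TopSimplex k} {i : Fin (k + 1)} (h : vsupp x ⊆ {i}) :
    x = vert k i := by
  have h0 : ∀ j, j ≠ i → x.1 j = 0 := by
    intro j hj
    by_contra hx
    exact hj (Finset.mem_singleton.1 (h (mem_vsupp.2 hx)))
  apply Subtype.ext
  funext j
  rw [vert_apply]
  split_ifs with hj
  · rw [hj, ← x.2.2, Finset.sum_eq_single i (fun j _ hj => h0 j hj) (by simp)]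
  · exact h0 j hj

lemma forall_mem_faceSet_singleton {P : TopSimplex k → Prop} {i : Fin (k + 1)} :
    (∀ x ∈ faceSet k {i}, P x) ↔ P (vert k i) := by
  constructor
  · exact fun h => h _ (mem_faceSet_iff.2 (vsupp_vert i).subset)
  · intro h x hx
    rwa [eq_vert_of_vsupp_subset (mem_faceSet_iff.1 hx)]

lemma forall_mem_faceSet_univ {P : TopSimplex k → Prop} :
    (∀ x ∈ faceSet k Finset.univ, P x) ↔ ∀ x, P x :=
  ⟨fun h x => h x (mem_faceSet_iff.2 (Finset.subset_univ _)), fun h x _ => h x⟩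

lemma forall_mem_faceSet_map {P : TopSimplex k → Prop} (g : Fin (m + 1) ↪o Fin (k + 1))
    (S : Finset (Fin (m + 1))) :
    (∀ x ∈ faceSet k (S.map g.toEmbedding), P x) ↔ ∀ x ∈ faceSet m S, P (faceMap g x) := by
  have hv : ∀ x, vsupp (faceMap g x) = (vsupp x).map g.toEmbedding := fun x =>
    vsupp_faceMap (g := g.toEmbedding) x
  constructor
  · intro h x hx
    refine h _ (mem_faceSet_iff.2 ?_)
    rw [hv]
    exact Finset.map_subset_map.2 (mem_faceSet_iff.1 hx)
  · intro h x hx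
    have hx' := mem_faceSet_iff.1 hx
    obtain ⟨y, rfl⟩ := exists_faceMap_eq (g := g.toEmbedding) (x := x) fun i hi => by
      obtain ⟨j, -, rfl⟩ := Finset.mem_map.1 (hx' hi)
      exact ⟨j, rfl⟩
    refine h y (mem_faceSet_iff.2 ?_)
    rw [show faceMap (⇑g.toEmbedding) y = faceMap g y from rfl, hv] at hx'
    exact Finset.map_subset_map.1 hx'

namespace Good
variable {τ τ' τ'' : C(TopSimplex k, X)}

lemma refl (τ : C(TopSimplex k, X)) : Good L d τ τ :=
  ⟨fun _ _ => rfl, fun _ => Iff.rfl, fun _ _ => rfl⟩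

lemma vert_mem (h : Good L d τ τ') (i : Fin (k + 1)) : τ' (vert k i) ∈ L ↔ τ (vert k i) ∈ L := by
  simpa only [forall_mem_faceSet_singleton] using h.face {i}

lemma range_mem (h : Good L d τ τ') : (∀ x, τ' x ∈ L) ↔ ∀ x, τ x ∈ L := by
  simpa only [forall_mem_faceSet_univ] using h.face Finset.univ

lemma symm (h : Good L d τ τ') : Good L d τ' τ where
  low x hx := (h.low x hx).symm
  face S := (h.face S).symm
  vertex i hi := (h.vertex i fun h' => hi ((h.vert_mem i).2 h')).symm

lemma trans (h : Good L d τ τ') (h' : Good L d τ' τ'') : Good L d τ τ'' where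
  low x hx := (h'.low x hx).trans (h.low x hx)
  face S := (h'.face S).trans (h.face S)
  vertex i hi := (h'.vertex i fun h'' => hi ((h.vert_mem i).1 h'')).trans (h.vertex i hi)

lemma comp_face (h : Good L d τ τ') (g : Fin (m + 1) ↪o Fin (k + 1)) :
    Good L d (τ.comp (faceMap g)) (τ'.comp (faceMap g)) where
  low x hx := by
    refine h.low _ ?_
    rwa [show faceMap g x = faceMap (⇑g.toEmbedding) x from rfl, vsupp_faceMap, Finset.card_map]
  face S := by
    have := h.face (S.map g.toEmbedding)
    rwa [forall_mem_faceSet_map, forall_mem_faceSet_map] at this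
  vertex i hi := by
    rw [ContinuousMap.comp_apply, faceMap_vert] at hi
    simp only [ContinuousMap.comp_apply, faceMap_vert]
    exact h.vertex _ hi

end Good

/-- The equivalence relation `Good`. -/
def goodSetoid (L : Set X) (d k : ℕ) : Setoid C(TopSimplex k, X) :=
  ⟨Good L d, Good.refl, Good.symm, Good.trans⟩

/-- The space of simplices, with the classes of `Good` made open. -/
def SimplexSpace (_L : Set X) (_d k : ℕ) : Type _ := C(TopSimplex k, X)

namespace SimplexSpace
variable {T : Type*} [TopologicalSpace T]

/-- The underlying singular simplex. -/
def under (τ : SimplexSpace L d k) : C(TopSimplex k, X) := τ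

/-- The class of a simplex. -/
def cls (τ : SimplexSpace L d k) : Quotient (goodSetoid (X := X) L d k) :=
  Quotient.mk _ τ.under

instance : TopologicalSpace (SimplexSpace L d k) :=
  TopologicalSpace.induced under inferInstance ⊓ TopologicalSpace.induced cls ⊥

lemma continuous_under : Continuous (under : SimplexSpace L d k → C(TopSimplex k, X)) :=
  continuous_inf_dom_left (t₁ := .induced under inferInstance) (t₂ := .induced cls ⊥)
    continuous_induced_dom

lemma continuous_cls : @Continuous _ _ _ ⊥ (cls (X := X) (L := L) (d := d) (k := k)) :=
  @continuous_inf_dom_right _ _ _ (.induced under inferInstance) (.induced cls ⊥) ⊥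
    (@continuous_induced_dom _ _ cls ⊥)

lemma continuous_rng {f : T → SimplexSpace L d k} (h : Continuous fun t => (f t).under)
    (h' : @Continuous _ _ _ ⊥ fun t => (f t).cls) : Continuous f :=
  @continuous_inf_rng _ _ _ _ (.induced under inferInstance) (.induced cls ⊥) |>.2
    ⟨continuous_induced_rng.2 h, (continuous_induced_rng (f := cls) (g := f) (t₂ := ⊥)).2 h'⟩

/-- Forgetting the refined topology. -/
def toMap : C(SimplexSpace L d k, C(TopSimplex k, X)) := ⟨under, continuous_under⟩

lemma good_of_preconnected [PreconnectedSpace T] (f : C(T, SimplexSpace L d k)) (t t' : T) :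
    Good L d (toMap (f t)) (toMap (f t')) := by
  let : TopologicalSpace (Quotient (goodSetoid (X := X) L d k)) := ⊥
  have : DiscreteTopology (Quotient (goodSetoid (X := X) L d k)) := ⟨rfl⟩
  have hc : Continuous fun t => (f t).cls := continuous_cls.comp f.continuous
  exact Quotient.exact (PreconnectedSpace.constant inferInstance hc (x := t) (y := t'))

/-- A family of equivalent simplices. -/
def lift (G : C(T × TopSimplex k, X)) (h : ∀ t t', Good L d (G.curry t) (G.curry t')) :
    C(T, SimplexSpace L d k) where
  toFun t := G.curry t
  continuous_toFun := by
    refine continuous_rng G.curry.continuous ?_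
    refine @continuous_of_const _ _ _ ⊥ _ fun t t' => ?_
    exact Quotient.sound (h t t')

/-- The family of simplices underlying a map to the space of simplices. -/
def unlift (f : C(T, SimplexSpace L d k)) : C(T × TopSimplex k, X) :=
  ContinuousMap.uncurry (toMap.comp f)

@[simp] lemma unlift_apply (f : C(T, SimplexSpace L d k)) (t : T) (x : TopSimplex k) :
    unlift f (t, x) = toMap (f t) x := rfl

@[ext] lemma ext' {α β : SimplexSpace L d k} (h : ∀ x, toMap α x = toMap β x) : α = β :=
  ContinuousMap.ext h

/-- Restriction to a face. -/
def face (g : Fin (m + 1) ↪o Fin (k + 1)) : C(SimplexSpace L d k, SimplexSpace L d m) where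
  toFun τ := (toMap τ).comp (faceMap g)
  continuous_toFun := by
    refine continuous_rng ((ContinuousMap.continuous_precomp (faceMap g)).comp
      toMap.continuous) ?_
    let F : Quotient (goodSetoid (X := X) L d k) → Quotient (goodSetoid (X := X) L d m) :=
      Quotient.map (fun τ => τ.comp (faceMap g)) fun τ τ' h => Good.comp_face h g
    have h1 : @Continuous _ _ ⊥ ⊥ F := continuous_bot
    exact @Continuous.comp _ _ _ _ ⊥ ⊥ cls F h1 continuous_cls

@[simp] lemma toMap_face (g : Fin (m + 1) ↪o Fin (k + 1)) (τ : SimplexSpace L d k)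
    (x : TopSimplex m) : toMap (face g τ) x = toMap τ (faceMap g x) := rfl

end SimplexSpace

end Good

/-! ### Folding a simplex -/

section Fold
variable {c : ℕ}

/-- The smallest of the barycentric coordinates except the first one. -/
def tailMin (x : TopSimplex (c + 1)) : ℝ :=
  Finset.univ.inf' Finset.univ_nonempty fun i : Fin (c + 1) => x.1 i.succ

/-- The largest possible first coordinate on the line through `x` and the first vertex's
opposite barycentric direction. -/
def height (x : TopSimplex (c + 1)) : ℝ := x.1 0 + (c + 1) * tailMin x

lemma continuous_coord (i : Fin (c + 1)) : Continuous fun x : TopSimplex c => x.1 i :=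
  (continuous_apply i).comp continuous_subtype_val

lemma continuous_tailMin : Continuous (tailMin : TopSimplex (c + 1) → ℝ) :=
  Continuous.finset_inf'_apply _ fun i _ => continuous_coord i.succ

lemma continuous_height : Continuous (height : TopSimplex (c + 1) → ℝ) :=
  (continuous_coord 0).add (continuous_const.mul continuous_tailMin)

lemma tailMin_le (x : TopSimplex (c + 1)) (i : Fin (c + 1)) : tailMin x ≤ x.1 i.succ :=
  Finset.inf'_le _ (Finset.mem_univ i)

lemma exists_tailMin (x : TopSimplex (c + 1)) : ∃ i : Fin (c + 1), x.1 i.succ = tailMin x := by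
  obtain ⟨i, -, hi⟩ := Finset.exists_mem_eq_inf' Finset.univ_nonempty
    fun i : Fin (c + 1) => x.1 i.succ
  exact ⟨i, hi.symm⟩

lemma tailMin_nonneg (x : TopSimplex (c + 1)) : 0 ≤ tailMin x := by
  obtain ⟨i, hi⟩ := exists_tailMin x
  exact hi ▸ x.2.1 _

lemma coord_le_height (x : TopSimplex (c + 1)) : x.1 0 ≤ height x := by
  have := tailMin_nonneg x
  rw [height, le_add_iff_nonneg_right]
  positivity

lemma height_nonneg (x : TopSimplex (c + 1)) : 0 ≤ height x := (x.2.1 0).trans (coord_le_height x)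

/-- The boundary of the simplex. -/
def IsBd (x : TopSimplex c) : Prop := ∃ j, x.1 j = 0

lemma isBd_iff (x : TopSimplex (c + 1)) : IsBd x ↔ x.1 0 = 0 ∨ x.1 0 = height x := by
  have hc : (0 : ℝ) < c + 1 := by positivity
  constructor
  · rintro ⟨j, hj⟩
    rcases Fin.eq_zero_or_eq_succ j with rfl | ⟨i, rfl⟩
    · exact Or.inl hj
    · refine Or.inr ?_
      have h1 : tailMin x = 0 := le_antisymm (hj ▸ tailMin_le x i) (tailMin_nonneg x)
      rw [height, h1, mul_zero, add_zero]
  · rintro (h | h)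
    · exact ⟨0, h⟩
    · obtain ⟨i, hi⟩ := exists_tailMin x
      refine ⟨i.succ, ?_⟩
      rw [height, eq_comm, add_eq_left] at h
      rw [hi]
      exact (mul_eq_zero.1 h).resolve_left hc.ne'

lemma isBd_iff_card (x : TopSimplex c) : IsBd x ↔ (vsupp x).card ≤ c := by
  constructor
  · rintro ⟨j, hj⟩
    have : vsupp x ⊆ Finset.univ.erase j := fun i hi =>
      Finset.mem_erase.2 ⟨fun h => mem_vsupp.1 hi (h ▸ hj), Finset.mem_univ _⟩
    exact (Finset.card_le_card this).trans (by simp)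
  · intro h
    by_contra hx
    have : vsupp x = Finset.univ := Finset.eq_univ_of_forall fun i =>
      mem_vsupp.2 fun hi => hx ⟨i, hi⟩
    rw [this] at h
    simp at h

/-- Moving a point so that its first barycentric coordinate becomes `v`. -/
def shiftTo (x : TopSimplex (c + 1)) (v : ℝ) : TopSimplex (c + 1) :=
  ⟨Fin.cons (max 0 (min v (height x)))
    fun i => x.1 i.succ + (x.1 0 - max 0 (min v (height x))) / (c + 1), by
    have hc : (0 : ℝ) < c + 1 := by positivity
    constructor
    · intro j
      refine Fin.cases ?_ (fun i => ?_) j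
      · exact le_max_left _ _
      · rw [Fin.cons_succ]
        have h1 : max 0 (min v (height x)) ≤ height x :=
          max_le (height_nonneg x) (min_le_right _ _)
        have h2 := tailMin_le x i
        have h3 : -tailMin x ≤ (x.1 0 - max 0 (min v (height x))) / (c + 1) := by
          rw [le_div_iff₀ hc]
          rw [height] at h1 ⊢
          linarith
        linarith
    · rw [Fin.sum_univ_succ]
      simp only [Fin.cons_zero, Fin.cons_succ, Finset.sum_add_distrib, Finset.sum_const,
        Finset.card_univ, Fintype.card_fin, nsmul_eq_mul]
      have := x.2.2
      rw [Fin.sum_univ_succ] at this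
      push_cast
      field_simp
      linarith⟩

lemma continuous_shiftTo : Continuous fun p : TopSimplex (c + 1) × ℝ => shiftTo p.1 p.2 := by
  have h0 : Continuous fun p : TopSimplex (c + 1) × ℝ => max 0 (min p.2 (height p.1)) :=
    continuous_const.max (continuous_snd.min (continuous_height.comp continuous_fst))
  refine Continuous.subtype_mk (continuous_pi fun j => ?_) _
  refine Fin.cases ?_ (fun i => ?_) j
  · simpa only [Fin.cons_zero] using h0
  · simp only [Fin.cons_succ]
    exact ((continuous_coord _).comp continuous_fst).add
      ((((continuous_coord 0).comp continuous_fst).sub h0).div_const _)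

variable {x : TopSimplex (c + 1)} {v w : ℝ}

lemma clamp_eq (h0 : 0 ≤ v) (h1 : v ≤ height x) : max 0 (min v (height x)) = v := by
  rw [min_eq_left h1, max_eq_right h0]

lemma shiftTo_zero (h0 : 0 ≤ v) (h1 : v ≤ height x) : (shiftTo x v).1 0 = v :=
  clamp_eq h0 h1

lemma shiftTo_succ (h0 : 0 ≤ v) (h1 : v ≤ height x) (i : Fin (c + 1)) :
    (shiftTo x v).1 i.succ = x.1 i.succ + (x.1 0 - v) / (c + 1) := by
  simp only [shiftTo, Fin.cons_succ, clamp_eq h0 h1]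

lemma height_shiftTo (h0 : 0 ≤ v) (h1 : v ≤ height x) : height (shiftTo x v) = height x := by
  have hc : (0 : ℝ) < c + 1 := by positivity
  have ht : tailMin (shiftTo x v) = tailMin x + (x.1 0 - v) / (c + 1) := by
    apply le_antisymm
    · obtain ⟨i, hi⟩ := exists_tailMin x
      rw [← hi, ← shiftTo_succ h0 h1]
      exact tailMin_le _ i
    · obtain ⟨i, hi⟩ := exists_tailMin (shiftTo x v)
      rw [← hi, shiftTo_succ h0 h1]
      linarith [tailMin_le x i]
  rw [height, height, ht, shiftTo_zero h0 h1]
  field_simp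
  ring

lemma shiftTo_self : shiftTo x (x.1 0) = x := by
  apply Subtype.ext
  funext j
  refine Fin.cases ?_ (fun i => ?_) j
  · exact shiftTo_zero (x.2.1 0) (coord_le_height x)
  · rw [shiftTo_succ (x.2.1 0) (coord_le_height x), sub_self, zero_div, add_zero]

lemma shiftTo_shiftTo (h0 : 0 ≤ v) (h1 : v ≤ height x) (h2 : 0 ≤ w) (h3 : w ≤ height x) :
    shiftTo (shiftTo x v) w = shiftTo x w := by
  apply Subtype.ext
  funext j
  have hH := height_shiftTo h0 h1
  refine Fin.cases ?_ (fun i => ?_) j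
  · rw [shiftTo_zero h2 h3, shiftTo_zero h2 (by rwa [hH])]
  · rw [shiftTo_succ h2 h3, shiftTo_succ h2 (by rwa [hH]), shiftTo_succ h0 h1,
      shiftTo_zero h0 h1]
    ring

/-- The reflection of the simplex exchanging its first vertex with the opposite faces. -/
def reflect : C(TopSimplex (c + 1), TopSimplex (c + 1)) where
  toFun x := shiftTo x (height x - x.1 0)
  continuous_toFun := continuous_shiftTo.comp
    (continuous_id.prodMk (continuous_height.sub (continuous_coord 0)))

lemma reflect_zero (x : TopSimplex (c + 1)) : (reflect x).1 0 = height x - x.1 0 :=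
  shiftTo_zero (sub_nonneg.2 (coord_le_height x)) (sub_le_self _ (x.2.1 0))

lemma height_reflect (x : TopSimplex (c + 1)) : height (reflect x) = height x :=
  height_shiftTo (sub_nonneg.2 (coord_le_height x)) (sub_le_self _ (x.2.1 0))

lemma shiftTo_reflect (h2 : 0 ≤ w) (h3 : w ≤ height x) : shiftTo (reflect x) w = shiftTo x w :=
  shiftTo_shiftTo (sub_nonneg.2 (coord_le_height x)) (sub_le_self _ (x.2.1 0)) h2 h3

lemma reflect_shiftTo (h2 : 0 ≤ w) (h3 : w ≤ height x) :
    reflect (shiftTo x w) = shiftTo x (height x - w) := by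
  change shiftTo _ _ = _
  rw [height_shiftTo h2 h3, shiftTo_zero h2 h3,
    shiftTo_shiftTo h2 h3 (by linarith) (by linarith)]

lemma reflect_reflect (x : TopSimplex (c + 1)) : reflect (reflect x) = x := by
  change shiftTo _ _ = _
  rw [height_reflect, reflect_zero, sub_sub_cancel,
    shiftTo_reflect (x.2.1 0) (coord_le_height x), shiftTo_self]

lemma isBd_reflect : IsBd (reflect x) ↔ IsBd x := by
  rw [isBd_iff, isBd_iff, reflect_zero, height_reflect]
  constructor <;> rintro (h | h)
  · right; linarith
  · left; linarith
  · right; linarith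
  · left; linarith

/-- The first coordinate of the folded point. -/
def foldCoord (l : ℝ) (x : TopSimplex (c + 1)) : ℝ :=
  min (x.1 0 / l) (height x - 3 * min (x.1 0 - l * height x) (height x - x.1 0))

/-- Folding the simplex. -/
def fold (l : ℝ) (x : TopSimplex (c + 1)) : TopSimplex (c + 1) := shiftTo x (foldCoord l x)

lemma foldCoord_mem {l : ℝ} (hl : 1 / 3 ≤ l) (x : TopSimplex (c + 1)) :
    0 ≤ foldCoord l x ∧ foldCoord l x ≤ height x := by
  have h0 := x.2.1 0
  have h1 := coord_le_height x
  have hl0 : 0 < l := by linarith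
  constructor
  · refine le_min (by positivity) ?_
    have h2 : 2 * min (x.1 0 - l * height x) (height x - x.1 0) ≤ (1 - l) * height x := by
      have := min_le_left (x.1 0 - l * height x) (height x - x.1 0)
      have := min_le_right (x.1 0 - l * height x) (height x - x.1 0)
      linarith
    nlinarith
  · rcases le_total (x.1 0) (l * height x) with h | h
    · refine (min_le_left _ _).trans ?_
      rw [div_le_iff₀ hl0]
      linarith
    · refine (min_le_right _ _).trans ?_
      have : 0 ≤ min (x.1 0 - l * height x) (height x - x.1 0) :=
        le_min (by linarith) (by linarith)
      linarith

lemma foldCoord_eq {l : ℝ} (hl : 1 / 3 ≤ l) (h : x.1 0 ≤ l * height x) :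
    foldCoord l x = x.1 0 / l := by
  have hl0 : 0 < l := by linarith
  refine min_eq_left ?_
  have h1 : x.1 0 / l ≤ height x := by
    rw [div_le_iff₀ hl0]; linarith
  have := min_le_left (x.1 0 - l * height x) (height x - x.1 0)
  linarith

lemma fold_one (x : TopSimplex (c + 1)) : fold 1 x = x := by
  rw [fold, foldCoord_eq (by norm_num) (by linarith [coord_le_height x]), div_one, shiftTo_self]

lemma fold_of_isBd {l : ℝ} (hl : 1 / 3 ≤ l) (hl1 : l ≤ 1) (hx : IsBd x) : fold l x = x := by
  have hH := height_nonneg x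
  have hl0 : 0 < l := by linarith
  have : foldCoord l x = x.1 0 := by
    rcases (isBd_iff x).1 hx with h | h
    · rw [foldCoord_eq hl (by rw [h]; positivity), h, zero_div]
    · rw [foldCoord, h, sub_self, min_eq_right (a := height x - l * height x) (b := 0) (by nlinarith),
        mul_zero, sub_zero, min_eq_right]
      rw [le_div_iff₀ hl0]
      nlinarith
  rw [fold, this, shiftTo_self]

lemma isBd_fold {l : ℝ} (hl : 1 / 3 ≤ l) (h : x.1 0 = l * height x) : IsBd (fold l x) := by
  have hl0 : 0 < l := by linarith
  have := foldCoord_mem hl x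
  rw [isBd_iff, fold, height_shiftTo this.1 this.2, shiftTo_zero this.1 this.2,
    foldCoord_eq hl h.le, h, mul_div_cancel_left₀ _ hl0.ne']
  exact Or.inr rfl

lemma exists_fold_eq {l : ℝ} (hl : 1 / 3 ≤ l) (hl1 : l ≤ 1) (y : TopSimplex (c + 1)) :
    ∃ x : TopSimplex (c + 1), x.1 0 ≤ l * height x ∧ fold l x = y := by
  have hl0 : 0 < l := by linarith
  have h0 := y.2.1 0
  have h1 := coord_le_height y
  have hv0 : 0 ≤ l * y.1 0 := by positivity
  have hv1 : l * y.1 0 ≤ height y := by nlinarith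
  have h2 : (shiftTo y (l * y.1 0)).1 0 ≤ l * height (shiftTo y (l * y.1 0)) := by
    rw [shiftTo_zero hv0 hv1, height_shiftTo hv0 hv1]
    gcongr
  refine ⟨shiftTo y (l * y.1 0), h2, ?_⟩
  rw [fold, foldCoord_eq hl h2, shiftTo_zero hv0 hv1, mul_div_cancel_left₀ _ hl0.ne',
    shiftTo_shiftTo hv0 hv1 h0 h1, shiftTo_self]

lemma reflect_fold_reflect (x : TopSimplex (c + 1)) :
    reflect (fold (1 / 3) (reflect x)) = fold (1 / 3) x := by
  have h0 := x.2.1 0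
  have h1 := coord_le_height x
  have h2 := foldCoord_mem le_rfl (reflect x)
  rw [height_reflect] at h2
  rw [fold, fold, shiftTo_reflect h2.1 h2.2, reflect_shiftTo h2.1 h2.2]
  congr 1
  simp only [foldCoord, height_reflect, reflect_zero, div_eq_mul_inv]
  norm_num
  rcases min_cases ((height x - x.1 0) * 3)
    (height x - 3 * min (height x - x.1 0 - 1 / 3 * height x) (x.1 0)) with ⟨a, b⟩ | ⟨a, b⟩ <;>
  rcases min_cases (x.1 0 * 3)
    (height x - 3 * min (x.1 0 - 1 / 3 * height x) (height x - x.1 0)) with ⟨a', b'⟩ | ⟨a', b'⟩ <;>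
  rcases min_cases (height x - x.1 0 - 1 / 3 * height x) (x.1 0) with ⟨a'', b''⟩ | ⟨a'', b''⟩ <;>
  rcases min_cases (x.1 0 - 1 / 3 * height x) (height x - x.1 0) with ⟨e, f⟩ | ⟨e, f⟩ <;>
  rw [a, a'] <;> linarith

end Fold

/-! ### Squashing families of simplices -/

section Squash
variable {X : Type*} [TopologicalSpace X] {L : Set X} {c : ℕ} {T : Type*} [TopologicalSpace T]

lemma good_of_isBd {τ τ' : C(TopSimplex (c + 1), X)} (h : ∀ x, IsBd x → τ' x = τ x)
    (h' : (∀ x, τ' x ∈ L) ↔ ∀ x, τ x ∈ L) : Good L (c + 1) τ τ' where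
  low x hx := h x ((isBd_iff_card x).2 hx)
  face S := by
    by_cases hS : S = Finset.univ
    · subst hS
      simpa only [forall_mem_faceSet_univ] using h'
    · refine forall₂_congr fun x hx => ?_
      rw [h x]
      obtain ⟨j, hj⟩ : ∃ j, j ∉ S := by
        by_contra! hj
        exact hS (Finset.eq_univ_iff_forall.2 hj)
      exact ⟨j, hx j hj⟩
  vertex i _ := by
    refine h _ ((isBd_iff_card _).2 ?_)
    rw [vsupp_vert]
    simp

lemma continuous_fold {l : T → ℝ} (hl : Continuous l) (hl0 : ∀ t, 1 / 3 ≤ l t) :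
    Continuous fun p : T × TopSimplex (c + 1) => fold (l p.1) p.2 := by
  have hc : Continuous fun p : T × TopSimplex (c + 1) => p.2.1 0 :=
    (continuous_coord 0).comp continuous_snd
  have hh : Continuous fun p : T × TopSimplex (c + 1) => height p.2 :=
    continuous_height.comp continuous_snd
  have hl' : Continuous fun p : T × TopSimplex (c + 1) => l p.1 := hl.comp continuous_fst
  refine continuous_shiftTo.comp (continuous_snd.prodMk ?_)
  refine (hc.div hl' fun p => ?_).min ?_
  · have := hl0 p.1
    linarith
  · exact hh.sub (continuous_const.mul ((hc.sub (hl'.mul hh)).min (hh.sub hc)))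

/-- Compress the family `b` to the part of the simplex below the relative height `l` and fill
the rest with a folding of `a`. -/
def squash (b : C(T × TopSimplex (c + 1), X)) (a : C(TopSimplex (c + 1), X)) (l : ℝ)
    (t : T) (x : TopSimplex (c + 1)) : X :=
  open Classical in if x.1 0 ≤ l * height x then b (t, fold l x) else a (fold l x)

variable {b : C(T × TopSimplex (c + 1), X)} {a : C(TopSimplex (c + 1), X)} {l : ℝ}

lemma continuous_squash {f : T → ℝ} (hf : Continuous f) (hf0 : ∀ t, 1 / 3 ≤ f t)
    (hb : ∀ t x, IsBd x → b (t, x) = a x) :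
    Continuous fun p : T × TopSimplex (c + 1) => squash b a (f p.1) p.1 p.2 := by
  have h := continuous_fold (c := c) hf hf0
  unfold squash
  refine Continuous.if_le (b.continuous.comp (continuous_fst.prodMk h)) (a.continuous.comp h)
    ((continuous_coord 0).comp continuous_snd)
    ((hf.comp continuous_fst).mul (continuous_height.comp continuous_snd)) fun p hp => ?_
  exact hb _ _ (isBd_fold (hf0 _) hp)

lemma squash_one (t : T) (x : TopSimplex (c + 1)) :
    squash b a 1 t x = b (t, x) := by
  rw [squash, if_pos (by linarith [coord_le_height x]), fold_one]

lemma squash_isBd (hb : ∀ t x, IsBd x → b (t, x) = a x) (hl : 1 / 3 ≤ l) (hl1 : l ≤ 1) (t : T)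
    {x : TopSimplex (c + 1)} (hx : IsBd x) : squash b a l t x = a x := by
  rw [squash, fold_of_isBd hl hl1 hx, hb t x hx, ite_self]

lemma squash_const {t : T} (h : ∀ x, b (t, x) = a x) (x : TopSimplex (c + 1)) :
    squash b a l t x = a (fold l x) := by
  rw [squash, h, ite_self]

lemma squash_mem (hl : 1 / 3 ≤ l) (hl1 : l ≤ 1) {t : T}
    (h : (∀ x, b (t, x) ∈ L) ↔ ∀ x, a x ∈ L) : (∀ x, squash b a l t x ∈ L) ↔ ∀ x, a x ∈ L := by
  constructor
  · intro H
    refine h.1 fun y => ?_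
    obtain ⟨x, hx, rfl⟩ := exists_fold_eq hl hl1 y
    have := H x
    rwa [squash, if_pos hx] at this
  · intro H x
    rw [squash]
    split_ifs
    · exact h.2 H _
    · exact H _

lemma squash_upper (hb : ∀ t x, IsBd x → b (t, x) = a x) {t : T} {x : TopSimplex (c + 1)}
    (h : height x ≤ 2 * x.1 0) : squash b a (1 / 3) t x = a (fold (1 / 3) x) := by
  rw [squash]
  split_ifs with h'
  · have h0 := height_nonneg x
    have h1 := x.2.1 0
    have hx : IsBd x := (isBd_iff x).2 (Or.inl (by linarith))
    rw [fold_of_isBd le_rfl (by norm_num) hx, hb t x hx]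
  · rfl

end Squash

section Comm
variable {X : Type*} [TopologicalSpace X] {L : Set X} {c : ℕ}
open SimplexSpace

/-- The interpolation between `1 / 3` and `1`. -/
def third (t : unitInterval) : ℝ := 1 / 3 + 2 / 3 * (t : ℝ)

lemma continuous_third : Continuous third := by unfold third; fun_prop

lemma third_mem (t : unitInterval) : 1 / 3 ≤ third t ∧ third t ≤ 1 := by
  have := t.2.1
  have := t.2.2
  constructor <;> rw [third] <;> linarith

/-- An involution of the simplex preserving the boundary. -/
structure IsFlip (ρ : C(TopSimplex (c + 1), TopSimplex (c + 1))) : Prop where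
  invol : ∀ x, ρ (ρ x) = x
  bd : ∀ {x}, IsBd x → IsBd (ρ x)

lemma isFlip_id : IsFlip (ContinuousMap.id (TopSimplex (c + 1))) := ⟨fun _ => rfl, id⟩

lemma isFlip_reflect : IsFlip (reflect (c := c)) := ⟨reflect_reflect, isBd_reflect.2⟩

/-- A family of simplices precomposed with a map of the simplex. -/
def flipFam {T : Type*} [TopologicalSpace T] (ρ : C(TopSimplex (c + 1), TopSimplex (c + 1)))
    (b : C(T × TopSimplex (c + 1), X)) : C(T × TopSimplex (c + 1), X) :=
  b.comp ((ContinuousMap.id T).prodMap ρ)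

variable {T : Type*} [TopologicalSpace T] {ρ : C(TopSimplex (c + 1), TopSimplex (c + 1))}

lemma flipFam_isBd (hρ : IsFlip ρ) {b : C(T × TopSimplex (c + 1), X)}
    {a : C(TopSimplex (c + 1), X)} (hb : ∀ t x, IsBd x → b (t, x) = a x) (t : T)
    (x : TopSimplex (c + 1)) (hx : IsBd x) : flipFam ρ b (t, x) = a.comp ρ x :=
  hb t (ρ x) (hρ.bd hx)

/-- The conjugate of `squash` by a flip. -/
def flipSquash (hρ : IsFlip ρ) (b : C(T × TopSimplex (c + 1), X)) (a : C(TopSimplex (c + 1), X))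
    (f : C(T, ℝ)) (hf0 : ∀ t, 1 / 3 ≤ f t) (hb : ∀ t x, IsBd x → b (t, x) = a x) :
    C(T × TopSimplex (c + 1), X) where
  toFun p := squash (flipFam ρ b) (a.comp ρ) (f p.1) p.1 (ρ p.2)
  continuous_toFun := (continuous_squash f.continuous hf0 (flipFam_isBd hρ hb)).comp
    (continuous_fst.prodMk (ρ.continuous.comp continuous_snd))

lemma flipSquash_good (hρ : IsFlip ρ) (b : C(T × TopSimplex (c + 1), X))
    (a : C(TopSimplex (c + 1), X)) (f : C(T, ℝ)) (hf0 : ∀ t, 1 / 3 ≤ f t) (hf1 : ∀ t, f t ≤ 1)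
    (hb : ∀ t x, IsBd x → b (t, x) = a x)
    (hL : ∀ t, (∀ x, b (t, x) ∈ L) ↔ ∀ x, a x ∈ L) (t : T) :
    Good L (c + 1) a ((flipSquash hρ b a f hf0 hb).curry t) := by
  have hflip : ∀ P : TopSimplex (c + 1) → Prop, (∀ x, P (ρ x)) ↔ ∀ x, P x := fun P =>
    ⟨fun h x => hρ.invol x ▸ h (ρ x), fun h x => h _⟩
  refine good_of_isBd (fun x hx => ?_) ?_
  · change squash (flipFam ρ b) (a.comp ρ) _ t (ρ x) = _
    rw [squash_isBd (flipFam_isBd hρ hb) (hf0 _) (hf1 _) t (hρ.bd hx),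
      ContinuousMap.comp_apply, hρ.invol]
  · change (∀ x, squash (flipFam ρ b) (a.comp ρ) _ t (ρ x) ∈ L) ↔ _
    rw [hflip fun x => squash (flipFam ρ b) (a.comp ρ) (f t) t x ∈ L,
      squash_mem (hf0 _) (hf1 _)]
    · exact hflip fun x => a x ∈ L
    · change (∀ x, b (t, ρ x) ∈ L) ↔ ∀ x, a (ρ x) ∈ L
      rw [hflip fun x => b (t, x) ∈ L, hflip fun x => a x ∈ L]
      exact hL t

variable (α : SimplexSpace L (c + 1) (c + 1))

lemma loop_isBd (β : Path α α) (t : unitInterval) (x : TopSimplex (c + 1)) (hx : IsBd x) :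
    toMap (β t) x = toMap α x := by
  have := (good_of_preconnected β.toContinuousMap 0 t).low x ((isBd_iff_card x).1 hx)
  simpa using this

lemma loop_mem (β : Path α α) (t : unitInterval) :
    (∀ x, toMap (β t) x ∈ L) ↔ ∀ x, toMap α x ∈ L := by
  have := (good_of_preconnected β.toContinuousMap 0 t).range_mem
  simpa using this

/-- The free homotopy squashing a loop of simplices. -/
def loopSquash (hρ : IsFlip ρ) (β : Path α α) :
    C((unitInterval × unitInterval) × TopSimplex (c + 1), X) :=
  flipSquash (T := unitInterval × unitInterval) hρ
    ((unlift β.toContinuousMap).comp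
      ((⟨Prod.fst, continuous_fst⟩ : C(unitInterval × unitInterval, unitInterval)).prodMap
        (ContinuousMap.id (TopSimplex (c + 1)))))
    (toMap α) ⟨fun p => third p.2, continuous_third.comp continuous_snd⟩
    (fun p => (third_mem p.2).1) (fun p x hx => loop_isBd α β p.1 x hx)

lemma loopSquash_good (hρ : IsFlip ρ) (β : Path α α) (t : unitInterval × unitInterval) :
    Good L (c + 1) (toMap α) ((loopSquash α hρ β).curry t) :=
  flipSquash_good hρ _ _ _ _ (fun p => (third_mem p.2).2) _ (fun p => loop_mem α β p.1) t

lemma loopSquash_one (hρ : IsFlip ρ) (β : Path α α) (s : unitInterval)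
    (x : TopSimplex (c + 1)) : loopSquash α hρ β ((s, 1), x) = toMap (β s) x := by
  have h1 : third 1 = 1 := by norm_num [third]
  refine Eq.trans (b := toMap (β s) (ρ (ρ x))) ?_ (by rw [hρ.invol])
  change squash _ _ (third 1) _ _ = _
  rw [h1, squash_one]
  rfl

lemma loopSquash_const (hρ : IsFlip ρ) (β : Path α α) {s : unitInterval} (hs : β s = α)
    (t : unitInterval) (x : TopSimplex (c + 1)) :
    loopSquash α hρ β ((s, t), x) = toMap α (ρ (fold (third t) (ρ x))) := by
  change squash _ _ (third t) _ _ = _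
  rw [squash_const]
  · rfl
  · intro x
    change toMap (β s) (ρ x) = _
    rw [hs]
    rfl

lemma loopSquash_upper (hρ : IsFlip ρ) (β : Path α α) {s : unitInterval}
    {x : TopSimplex (c + 1)} (hx : height (ρ x) ≤ 2 * (ρ x).1 0) :
    loopSquash α hρ β ((s, 0), x) = toMap α (ρ (fold (1 / 3) (ρ x))) := by
  have h1 : third 0 = 1 / 3 := by norm_num [third]
  change squash _ _ (third 0) _ _ = _
  rw [h1, squash_upper]
  · rfl
  · exact flipFam_isBd hρ fun p x hx => loop_isBd α β p.1 x hx
  · exact hx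

lemma lift_good {G : C(T × TopSimplex (c + 1), X)}
    (h : ∀ t, Good L (c + 1) (toMap α) (G.curry t)) (t t' : T) :
    Good L (c + 1) (G.curry t) (G.curry t') := (h t).symm.trans (h t')

/-- The simplex `α` folded. -/
def foldBase : SimplexSpace L (c + 1) (c + 1) :=
  lift (T := unitInterval × unitInterval) (loopSquash α isFlip_id (Path.refl α))
    (lift_good α (loopSquash_good α isFlip_id _)) (0, 0)

lemma third_zero : third 0 = 1 / 3 := by norm_num [third]

lemma loopSquash_base (hρ : IsFlip ρ)
    (hfold : ∀ x, ρ (fold (1 / 3) (ρ x)) = fold (1 / 3) x) (β : Path α α) {s : unitInterval}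
    (hs : β s = α) :
    lift (loopSquash α hρ β) (lift_good α (loopSquash_good α hρ β)) (s, 0) = foldBase α := by
  ext x
  change loopSquash α hρ β _ = loopSquash α isFlip_id (Path.refl α) _
  rw [loopSquash_const α _ _ hs, loopSquash_const α _ _ rfl, third_zero, hfold]
  rfl

/-- The track of the base point under squashing. -/
def foldPath (hρ : IsFlip ρ) (hfold : ∀ x, ρ (fold (1 / 3) (ρ x)) = fold (1 / 3) x) :
    Path (foldBase α) α where
  toFun t := lift (loopSquash α hρ (Path.refl α)) (lift_good α (loopSquash_good α hρ _)) (0, t)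
  continuous_toFun := by fun_prop
  source' := loopSquash_base α hρ hfold _ rfl
  target' := by
    ext x
    exact loopSquash_one α hρ _ _ x

/-- The squashed loop. -/
def squashLoop (hρ : IsFlip ρ) (hfold : ∀ x, ρ (fold (1 / 3) (ρ x)) = fold (1 / 3) x)
    (β : Path α α) : Path (foldBase α) (foldBase α) where
  toFun s := lift (loopSquash α hρ β) (lift_good α (loopSquash_good α hρ _)) (s, 0)
  continuous_toFun := by fun_prop
  source' := loopSquash_base α hρ hfold _ β.source
  target' := loopSquash_base α hρ hfold _ β.target

lemma freelyHomotopic_squashLoop (hρ : IsFlip ρ)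
    (hfold : ∀ x, ρ (fold (1 / 3) (ρ x)) = fold (1 / 3) x) (β : Path α α) :
    FreelyHomotopic (squashLoop α hρ hfold β) (foldPath α hρ hfold) β := by
  refine ⟨lift (loopSquash α hρ β) (lift_good α (loopSquash_good α hρ _)), fun s => rfl,
    fun s => ?_, fun t => ?_, fun t => ?_⟩ <;> ext x
  · exact loopSquash_one α hρ β s x
  · exact (loopSquash_const α hρ β β.source t x).trans
      (loopSquash_const α hρ (Path.refl α) rfl t x).symm
  · exact (loopSquash_const α hρ β β.target t x).trans
      (loopSquash_const α hρ (Path.refl α) rfl t x).symm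

lemma hasMean_simplexSpace_succ : HasMean (FundamentalGroup (SimplexSpace L (c + 1) (c + 1)) α) := by
  classical
  have hid : ∀ x : TopSimplex (c + 1), (ContinuousMap.id _) (fold (1 / 3)
    ((ContinuousMap.id (TopSimplex (c + 1))) x)) = fold (1 / 3) x := fun x => rfl
  refine hasMean_of_comm (fundamentalGroup_comm (foldPath α isFlip_id hid)
    (foldPath α isFlip_reflect reflect_fold_reflect) fun β γ => ?_)
  refine ⟨_, _, freelyHomotopic_squashLoop α isFlip_id hid β,
    freelyHomotopic_squashLoop α isFlip_reflect reflect_fold_reflect γ, ?_⟩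
  have hup : ∀ {x : TopSimplex (c + 1)} (s : unitInterval), height x ≤ 2 * x.1 0 →
      loopSquash α isFlip_id β ((s, 0), x) = toMap α (fold (1 / 3) x) := fun s hx =>
    loopSquash_upper α isFlip_id β hx
  have hdown : ∀ {x : TopSimplex (c + 1)} (s : unitInterval), 2 * x.1 0 ≤ height x →
      loopSquash α isFlip_reflect γ ((s, 0), x) = toMap α (fold (1 / 3) x) := fun {x} s hx => by
    rw [loopSquash_upper α isFlip_reflect γ, reflect_fold_reflect]
    rw [height_reflect, reflect_zero]
    linarith
  have hend : ∀ {x : TopSimplex (c + 1)} {s : unitInterval}, β s = α →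
      loopSquash α isFlip_id β ((s, 0), x) = toMap α (fold (1 / 3) x) := fun hs => by
    rw [loopSquash_const α _ _ hs, third_zero]; rfl
  have hend' : ∀ {x : TopSimplex (c + 1)} {s : unitInterval}, γ s = α →
      loopSquash α isFlip_reflect γ ((s, 0), x) = toMap α (fold (1 / 3) x) := fun hs => by
    rw [loopSquash_const α _ _ hs, third_zero, reflect_fold_reflect]
  let E : C((unitInterval × unitInterval) × TopSimplex (c + 1), X) :=
    ⟨fun p => if 2 * p.2.1 0 ≤ height p.2 then loopSquash α isFlip_id β ((p.1.1, 0), p.2)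
      else loopSquash α isFlip_reflect γ ((p.1.2, 0), p.2), by
      refine Continuous.if_le (by fun_prop) (by fun_prop)
        (continuous_const.mul ((continuous_coord 0).comp continuous_snd))
        (continuous_height.comp continuous_snd) fun p hp => ?_
      rw [hup _ hp.ge, hdown _ hp.le]⟩
  have hE : ∀ s t x, E ((s, t), x) = if 2 * x.1 0 ≤ height x then
      loopSquash α isFlip_id β ((s, 0), x) else loopSquash α isFlip_reflect γ ((t, 0), x) :=
    fun _ _ _ => rfl
  have hG := loopSquash_good α isFlip_id β
  have hG' := loopSquash_good α isFlip_reflect γ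
  have hgood : ∀ p, Good L (c + 1) (toMap α) (E.curry p) := by
    rintro ⟨s, t⟩
    refine good_of_isBd (fun x hx => ?_) ⟨fun H => ?_, fun H x => ?_⟩
    · change E ((s, t), x) = _
      rw [hE]
      split_ifs
      · exact (hG (s, 0)).low x ((isBd_iff_card x).1 hx)
      · exact (hG' (t, 0)).low x ((isBd_iff_card x).1 hx)
    · refine (loop_mem α β s).1 fun y => ?_
      obtain ⟨x, hx, rfl⟩ := exists_fold_eq (l := 1 / 3) le_rfl (by norm_num) y
      have h0 := height_nonneg x
      have := H x
      change E ((s, t), x) ∈ L at this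
      rw [hE, if_pos (by linarith)] at this
      change squash _ _ (third 0) _ _ ∈ L at this
      rw [third_zero, squash, if_pos] at this
      · exact this
      · exact hx
    · change E ((s, t), x) ∈ L
      rw [hE]
      split_ifs
      · exact (hG (s, 0)).range_mem.2 H x
      · exact (hG' (t, 0)).range_mem.2 H x
  refine ⟨lift E (lift_good α hgood), fun s => ?_, fun s => ?_, fun t => ?_, fun t => ?_⟩ <;>
    ext x
  · change E ((s, 0), x) = loopSquash α isFlip_id β ((s, 0), x)
    rw [hE]
    split_ifs with h
    · rfl
    · rw [hend' γ.source, hup s (by linarith)]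
  · change E ((s, 1), x) = loopSquash α isFlip_id β ((s, 0), x)
    rw [hE]
    split_ifs with h
    · rfl
    · rw [hend' γ.target, hup s (by linarith)]
  · change E ((0, t), x) = loopSquash α isFlip_reflect γ ((t, 0), x)
    rw [hE]
    split_ifs with h
    · rw [hend β.source, hdown t h]
    · rfl
  · change E ((1, t), x) = loopSquash α isFlip_reflect γ ((t, 0), x)
    rw [hE]
    split_ifs with h
    · rw [hend β.target, hdown t h]
    · rfl

end Comm

section ZeroDim
variable {X : Type*} [TopologicalSpace X] {L : Set X}
open SimplexSpace

lemma eq_vert_zero (x : TopSimplex 0) : x = vert 0 0 :=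
  eq_vert_of_vsupp_subset fun i _ => Finset.mem_singleton.2 (Fin.fin_one_eq_zero i)

lemma card_vsupp_pos {k : ℕ} (x : TopSimplex k) : 0 < (vsupp x).card := by
  rw [Finset.card_pos]
  by_contra h
  have h0 : ∀ j, x.1 j = 0 := fun j => by
    by_contra hj
    exact h ⟨j, mem_vsupp.2 hj⟩
  have := x.2.2
  simp [h0] at this

open Path.Homotopic.Quotient in
lemma hasMean_simplexSpace_zero
    (hL : ∀ (x : X) (hx : x ∈ L), IsAmenable
      (FundamentalGroup (connectedComponentIn L x) ⟨x, mem_connectedComponentIn hx⟩))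
    (α : SimplexSpace L 0 0) : HasMean (FundamentalGroup (SimplexSpace L 0 0) α) := by
  by_cases ha : toMap α (vert 0 0) ∈ L
  · let a := toMap α (vert 0 0)
    let G : C(connectedComponentIn L a × TopSimplex 0, X) := ⟨fun p => p.1.1, by fun_prop⟩
    have hGL : ∀ p, G p ∈ L := fun p => connectedComponentIn_subset _ _ p.1.2
    let f : C(connectedComponentIn L a, SimplexSpace L 0 0) := lift G fun t t' =>
      { low := fun x hx => absurd (card_vsupp_pos x) (by omega)
        face := fun S => ⟨fun _ x _ => hGL (t, x), fun _ x _ => hGL (t', x)⟩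
        vertex := fun i hi => absurd (hGL (t, vert 0 i)) hi }
    have hf : f ⟨a, mem_connectedComponentIn ha⟩ = α := by
      ext x
      rw [eq_vert_zero x]
      rfl
    refine HasMean.of_surjective (FundamentalGroup.mapOfEq f hf) (fun x => ?_)
      (hasMean_of_isAmenable (hL a ha))
    obtain ⟨p, rfl⟩ := Path.Homotopic.Quotient.mk_surjective x
    have hmem : ∀ t, toMap (p t) (vert 0 0) ∈ L := fun t => by
      have := (good_of_preconnected p.toContinuousMap 0 t).vert_mem 0
      rw [show p.toContinuousMap 0 = α from p.source] at this
      exact this.2 ha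
    have hc : Continuous fun t => toMap (p t) (vert 0 0) :=
      (continuous_eval_const _).comp (toMap.continuous.comp p.continuous)
    have hcomp : ∀ t, toMap (p t) (vert 0 0) ∈ connectedComponentIn L a := fun t => by
      refine IsPreconnected.subset_connectedComponentIn (isPreconnected_range hc) (x := a) ?_ ?_ ⟨t, rfl⟩
      · exact ⟨0, by simp only [p.source]; rfl⟩
      · rintro _ ⟨t, rfl⟩
        exact hmem t
    let q : Path (⟨a, mem_connectedComponentIn ha⟩ : connectedComponentIn L a)
        ⟨a, mem_connectedComponentIn ha⟩ :=
      ⟨⟨fun t => ⟨_, hcomp t⟩, hc.subtype_mk _⟩, Subtype.ext (by simp only [p.source]; rfl),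
        Subtype.ext (by simp only [p.target]; rfl)⟩
    refine ⟨mk q, ?_⟩
    rw [FundamentalGroup.mapOfEq_apply, ← mk_map, ← mk_cast]
    congr 1
    refine Path.ext (funext fun t => ext' fun x => ?_)
    rw [eq_vert_zero x]
    rfl
  · refine hasMean_of_comm fun x y => ?_
    have : ∀ x : FundamentalGroup (SimplexSpace L 0 0) α, x = mk (Path.refl α) := fun x => by
      obtain ⟨p, rfl⟩ := Path.Homotopic.Quotient.mk_surjective x
      congr 1
      refine Path.ext (funext fun t => ext' fun x => ?_)
      have := (good_of_preconnected p.toContinuousMap 0 t).vertex 0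
      rw [show p.toContinuousMap 0 = α from p.source] at this
      rw [eq_vert_zero x]
      exact this ha
    rw [this x, this y]

end ZeroDim

lemma hasMean_simplexSpace {X : Type*} [TopologicalSpace X] {L : Set X}
    (hL : ∀ (x : X) (hx : x ∈ L), IsAmenable
      (FundamentalGroup (connectedComponentIn L x) ⟨x, mem_connectedComponentIn hx⟩))
    {d : ℕ} (α : SimplexSpace L d d) : HasMean (FundamentalGroup (SimplexSpace L d d) α) := by
  cases d with
  | zero => exact hasMean_simplexSpace_zero hL α
  | succ c => exact hasMean_simplexSpace_succ α

/-! ### Means over homotopy classes of paths -/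

section PathMean
variable {Y : Type*} [TopologicalSpace Y]

/-- A chosen point in each path component. -/
def star (α : Y) : Y := Quotient.out (s := pathSetoid Y) (Quotient.mk _ α)

lemma star_eq {α α' : Y} (h : Joined α α') : star α = star α' :=
  congrArg (Quotient.out (s := pathSetoid Y)) (Quotient.sound h)

/-- A chosen path to the chosen point of the path component. -/
def starPath (α : Y) : Path α (star α) :=
  (Quotient.exact (s := pathSetoid Y) (Quotient.out_eq _).symm : Joined α (star α)).somePath

/-- A representative of an element of the fundamental group. -/
def repLoop {s : Y} (g : FundamentalGroup Y s) : Path s s :=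
  (Path.Homotopic.Quotient.mk_surjective g).choose

lemma mk_repLoop {s : Y} (g : FundamentalGroup Y s) :
    Path.Homotopic.Quotient.mk (repLoop g) = g :=
  (Path.Homotopic.Quotient.mk_surjective g).choose_spec

variable (hY : ∀ a : Y, HasMean (FundamentalGroup Y a))

/-- The mean over the homotopy classes of paths continuing a given one. -/
def pathMeanAux {α s : Y} (p : Path α s) : (C(unitInterval, Y) → ℝ) →ₗ[ℝ] ℝ :=
  (hY s).choose ∘ₗ LinearMap.funLeft ℝ ℝ fun g => (p.trans (repLoop g)).toContinuousMap

/-- The mean over the homotopy classes of paths with given origin. -/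
def pathMean (α : Y) : (C(unitInterval, Y) → ℝ) →ₗ[ℝ] ℝ := pathMeanAux hY (starPath α)

lemma pathMean_const (α : Y) (r : ℝ) : pathMean hY α (fun _ => r) = r := by
  have h : (fun _ => r : C(unitInterval, Y) → ℝ) = r • fun _ => 1 := by
    ext; simp
  rw [h, map_smul]
  have := (hY (star α)).choose_spec.1
  change r • (hY (star α)).choose (fun _ => 1) = r
  rw [this, smul_eq_mul, mul_one]

lemma abs_pathMean_le (α : Y) {φ : C(unitInterval, Y) → ℝ} {C : ℝ} (h : ∀ γ, |φ γ| ≤ C) :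
    |pathMean hY α φ| ≤ C :=
  (hY (star α)).choose_spec.2.1 _ C fun _ => h _

lemma pathMean_congr (α : Y) {φ φ' : C(unitInterval, Y) → ℝ}
    (h : ∀ γ : C(unitInterval, Y), γ 0 = α → φ γ = φ' γ) :
    pathMean hY α φ = pathMean hY α φ' := by
  refine congrArg (hY (star α)).choose (funext fun g => h _ ?_)
  exact (Path.trans _ _).source

/-- Two paths with the same endpoint that are homotopic up to composition with `W`. -/
def PathRel {α α' : Y} (W : Path α α') (γ γ' : C(unitInterval, Y)) : Prop :=
  ∃ (a : Y) (p : Path α a) (p' : Path α' a), γ = p.toContinuousMap ∧ γ' = p'.toContinuousMap ∧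
    p.Homotopic (W.trans p')

open Path.Homotopic.Quotient in
lemma pathMean_inv {α α' : Y} (W : Path α α') {φ φ' : C(unitInterval, Y) → ℝ} {C : ℝ}
    (hC : ∀ γ, |φ' γ| ≤ C) (h : ∀ γ γ', PathRel W γ γ' → φ γ = φ' γ') :
    pathMean hY α φ = pathMean hY α' φ' := by
  have key : ∀ (s s' : Y) (p : Path α s) (p' : Path α' s'), s = s' →
      pathMeanAux hY p φ = pathMeanAux hY p' φ' := by
    rintro s s' p p' rfl
    obtain ⟨-, -, hinv⟩ := (hY s).choose_spec
    let k : FundamentalGroup Y s := mk (p'.symm.trans (W.symm.trans p))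
    have h1 : pathMeanAux hY p' φ' = (hY s).choose
        (fun g => φ' (p'.trans (repLoop (g * k))).toContinuousMap) :=
      (hinv _ ⟨C, fun g => hC _⟩ k).symm
    rw [h1]
    refine congrArg (hY s).choose (funext fun g => h _ _ ⟨s, _, _, rfl, rfl, ?_⟩)
    rw [← Path.Homotopic.Quotient.eq, mk_trans, mk_trans, mk_trans, mk_repLoop, mk_repLoop]
    change _ = (mk W).trans ((mk p').trans ((mk (p'.symm.trans (W.symm.trans p))).trans g))
    rw [mk_trans, mk_symm, mk_trans, mk_symm, trans_assoc (mk p').symm, trans_assoc (mk W).symm,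
      quotient_trans_symm_cancel, quotient_trans_symm_cancel]
  exact key _ _ _ _ (star_eq ⟨W⟩)

variable {E : Type*}

open Classical in
/-- The iterated mean over a list of indices. -/
def listMean (α : E → Y) : List E → (E → C(unitInterval, Y)) →
    ((E → C(unitInterval, Y)) → ℝ) →ₗ[ℝ] ℝ
  | [], h => LinearMap.proj h
  | e :: l, h => pathMean hY (α e) ∘ₗ LinearMap.pi fun γ => listMean α l (Function.update h e γ)

open Classical in
lemma listMean_cons (α : E → Y) (e : E) (l : List E) (h : E → C(unitInterval, Y))
    (φ : (E → C(unitInterval, Y)) → ℝ) : listMean hY α (e :: l) h φ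
      = pathMean hY (α e) fun γ => listMean hY α l (Function.update h e γ) φ := rfl

lemma listMean_const (α : E → Y) (r : ℝ) (l : List E) (h : E → C(unitInterval, Y)) :
    listMean hY α l h (fun _ => r) = r := by
  induction l generalizing h with
  | nil => rfl
  | cons e l ih => simp only [listMean_cons, ih, pathMean_const]

lemma abs_listMean_le (α : E → Y) {φ : (E → C(unitInterval, Y)) → ℝ} {C : ℝ}
    (hC : ∀ h, |φ h| ≤ C) (l : List E) (h : E → C(unitInterval, Y)) :
    |listMean hY α l h φ| ≤ C := by
  induction l generalizing h with
  | nil => exact hC h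
  | cons e l ih => exact abs_pathMean_le hY _ fun γ => ih _

lemma listMean_congr (α : E → Y) {φ φ' : (E → C(unitInterval, Y)) → ℝ}
    (H : ∀ h : E → C(unitInterval, Y), (∀ e, h e 0 = α e) → φ h = φ' h) (l : List E)
    {h : E → C(unitInterval, Y)} (hh : ∀ e, h e 0 = α e) :
    listMean hY α l h φ = listMean hY α l h φ' := by
  classical
  induction l generalizing h with
  | nil => exact H h hh
  | cons e l ih =>
    simp only [listMean_cons]
    refine pathMean_congr hY _ fun γ hγ => ih fun e' => ?_
    rcases eq_or_ne e' e with rfl | he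
    · rwa [Function.update_self]
    · rw [Function.update_of_ne he]
      exact hh e'

lemma listMean_inv {α α' : E → Y} (W : ∀ e, Path (α e) (α' e))
    {φ φ' : (E → C(unitInterval, Y)) → ℝ} {C : ℝ} (hC : ∀ h, |φ' h| ≤ C)
    (H : ∀ h h', (∀ e, PathRel (W e) (h e) (h' e)) → φ h = φ' h') (l : List E)
    {h h' : E → C(unitInterval, Y)} (hh : ∀ e ∉ l, PathRel (W e) (h e) (h' e)) :
    listMean hY α l h φ = listMean hY α' l h' φ' := by
  classical
  induction l generalizing h h' with
  | nil => exact H h h' fun e => hh e (by simp)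
  | cons e l ih =>
    simp only [listMean_cons]
    refine pathMean_inv hY (W e) (C := C) (fun γ => abs_listMean_le hY _ hC _ _)
      fun γ γ' hγ => ih fun e' he' => ?_
    rcases eq_or_ne e' e with rfl | he
    · simpa using hγ
    · rw [Function.update_of_ne he, Function.update_of_ne he]
      exact hh e' (by simp [he, he'])

open Classical in
lemma listMean_marginal {E' : Type*} {j : E' → E} (hj : Function.Injective j) {α : E → Y}
    {φ : (E → C(unitInterval, Y)) → ℝ} {φ' : (E' → C(unitInterval, Y)) → ℝ}
    (H : ∀ h, φ h = φ' (h ∘ j)) (l : List E) {l' : List E'}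
    (hl : l'.map j = l.filter (fun e => e ∈ Set.range j)) (h : E → C(unitInterval, Y)) :
    listMean hY α l h φ = listMean hY (α ∘ j) l' (h ∘ j) φ' := by
  induction l generalizing h l' with
  | nil =>
    obtain rfl : l' = [] := by simpa using hl
    exact H h
  | cons e l ih =>
    by_cases he : e ∈ Set.range j
    · obtain ⟨e', rfl⟩ := he
      rw [List.filter_cons_of_pos (by simp)] at hl
      obtain ⟨e'', l'', rfl, he'', hl''⟩ := List.map_eq_cons_iff.1 hl
      obtain rfl := hj he''
      simp only [listMean_cons, Function.comp_apply, ih hl'',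
        Function.update_comp_eq_of_injective _ hj]
    · rw [List.filter_cons_of_neg (by simpa using he)] at hl
      have hupd : ∀ γ, Function.update h e γ ∘ j = h ∘ j := fun γ => by
        funext e'
        exact Function.update_of_ne (fun h' => he ⟨e', h'⟩) _ _
      simp only [listMean_cons, ih hl, hupd, pathMean_const]

end PathMean

section EmbList
variable {d k m : ℕ}

/-- The lexicographic order on order embeddings. -/
def lexLE (e e' : Fin (d + 1) ↪o Fin (k + 1)) : Prop := toLex (⇑e) ≤ toLex (⇑e')

instance : Std.Total (lexLE (d := d) (k := k)) := ⟨fun _ _ => le_total _ _⟩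

instance : IsTrans _ (lexLE (d := d) (k := k)) := ⟨fun _ _ _ h h' => le_trans h h'⟩

instance : Std.Antisymm (lexLE (d := d) (k := k)) :=
  ⟨fun _ _ h h' => DFunLike.coe_injective (toLex.injective (le_antisymm h h'))⟩

open Classical in
/-- The faces of a simplex of given dimension, in lexicographic order. -/
def embList (d k : ℕ) : List (Fin (d + 1) ↪o Fin (k + 1)) := Finset.univ.sort lexLE

lemma mem_embList (e : Fin (d + 1) ↪o Fin (k + 1)) : e ∈ embList d k := by
  classical
  simp [embList]

/-- A face of a face. -/
def embTrans (d : ℕ) (g : Fin (m + 1) ↪o Fin (k + 1)) (e : Fin (d + 1) ↪o Fin (m + 1)) :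
    Fin (d + 1) ↪o Fin (k + 1) := e.trans g

lemma embTrans_injective (g : Fin (m + 1) ↪o Fin (k + 1)) :
    Function.Injective (embTrans d g) := fun e e' h => by
  ext i : 1
  exact g.injective (DFunLike.congr_fun h i)

lemma lexLE_embTrans (g : Fin (m + 1) ↪o Fin (k + 1)) {e e' : Fin (d + 1) ↪o Fin (m + 1)}
    (h : lexLE e e') : lexLE (embTrans d g e) (embTrans d g e') := by
  rcases h.eq_or_lt with h | h
  · have : e = e' := DFunLike.coe_injective (toLex.injective h)
    rw [this]
    exact le_refl _
  · obtain ⟨i, hi, hlt⟩ := h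
    refine le_of_lt ⟨i, fun j hj => ?_, g.lt_iff_lt.2 hlt⟩
    exact congrArg g (hi j hj)

open Classical in
lemma map_embList (g : Fin (m + 1) ↪o Fin (k + 1)) : (embList d m).map (embTrans d g)
    = (embList d k).filter (fun e => e ∈ Set.range (embTrans d g)) := by
  refine List.Perm.eq_of_pairwise' (r := lexLE) ?_ ?_ ?_
  · rw [List.pairwise_map]
    exact (Finset.pairwise_sort _ _).imp fun h => lexLE_embTrans g h
  · exact (Finset.pairwise_sort _ _).filter _
  · rw [List.perm_ext_iff_of_nodup]
    · intro e
      simp [mem_embList]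
    · exact (Finset.sort_nodup _ _).map (embTrans_injective g)
    · exact (Finset.sort_nodup _ _).filter _

end EmbList

/-! ### The averaging operator -/

section Average
variable {X : Type*} [TopologicalSpace X] {L : Set X} {d k m : ℕ}
open SimplexSpace

/-- A simplex as a point of the space of simplices. -/
def SimplexSpace.of (L : Set X) (d : ℕ) (τ : C(TopSimplex k, X)) : SimplexSpace L d k := τ

@[simp] lemma SimplexSpace.toMap_of (τ : C(TopSimplex k, X)) : toMap (of L d τ) = τ := rfl

/-- A system of paths of faces with origin the faces of `τ`. -/
def IsStart (τ : SimplexSpace L d k)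
    (h : (Fin (d + 1) ↪o Fin (k + 1)) → C(unitInterval, SimplexSpace L d d)) : Prop :=
  ∀ e, h e 0 = face e τ

/-- The homotopy of `τ` determined by paths of faces. -/
def thetaS (τ : SimplexSpace L d k)
    (h : (Fin (d + 1) ↪o Fin (k + 1)) → C(unitInterval, SimplexSpace L d d)) :
    C(unitInterval × TopSimplex k, X) := theta (toMap τ) fun e => unlift (h e)

section Start
variable {τ : SimplexSpace L d k}
  {h : (Fin (d + 1) ↪o Fin (k + 1)) → C(unitInterval, SimplexSpace L d d)}

lemma IsStart.good (H : IsStart τ h) (e : Fin (d + 1) ↪o Fin (k + 1)) (s : unitInterval) :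
    Good L d ((toMap τ).comp (faceMap e)) (toMap (h e s)) := by
  have := good_of_preconnected (h e) 0 s
  rw [H e] at this
  exact this

lemma IsStart.skel (H : IsStart τ h) : SkelHomotopy (toMap τ) fun e => unlift (h e) where
  zero e x := by rw [unlift_apply, H e, toMap_face]
  bdry e s x hx := (H.good e s).low x ((isBd_iff_card x).1 hx)

lemma thetaS_zero (x : TopSimplex k) : thetaS τ h (0, x) = toMap τ x := theta_zero x

lemma IsStart.thetaS_good (H : IsStart τ h) (s : unitInterval) :
    Good L d (toMap τ) ((thetaS τ h).curry s) where
  low x hx := theta_of_card hx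
  face S := H.skel.theta_mem_iff L (fun e s => (H.good e s).range_mem) S s
  vertex i hi := by
    change thetaS τ h (s, vert k i) = _
    cases d with
    | zero =>
      let e : Fin (0 + 1) ↪o Fin (k + 1) := OrderEmbedding.ofStrictMono (fun _ => i)
        (fun a b hab => absurd hab (by simp [Fin.fin_one_eq_zero a, Fin.fin_one_eq_zero b]))
      have he : vert k i = faceMap e (vert 0 0) := by rw [faceMap_vert]; rfl
      rw [he] at hi ⊢
      rw [thetaS, H.skel.theta_faceMap]
      exact (H.good e s).vertex 0 hi
    | succ c =>
      refine theta_of_card ?_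
      rw [vsupp_vert]
      simp

lemma IsStart.thetaS_mem (H : IsStart τ h) (hτ : ∀ x, toMap τ x ∈ L)
    (p : unitInterval × TopSimplex k) : thetaS τ h p ∈ L :=
  (H.thetaS_good p.1).range_mem.2 hτ p.2

lemma IsStart.restr_thetaS (H : IsStart τ h) (g : Fin (m + 1) ↪o Fin (k + 1)) :
    restr (thetaS τ h) (faceMap g) = thetaS (face g τ) (h ∘ embTrans d g) := by
  ext ⟨s, x⟩
  exact H.skel.theta_face g s x

end Start

variable (hY : ∀ a : SimplexSpace L d d, HasMean (FundamentalGroup (SimplexSpace L d d) a))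

/-- The mean over systems of paths of faces. -/
def avg (τ : SimplexSpace L d k) :
    (((Fin (d + 1) ↪o Fin (k + 1)) → C(unitInterval, SimplexSpace L d d)) → ℝ) →ₗ[ℝ] ℝ :=
  listMean hY (fun e => face e τ) (embList d k) fun e => ContinuousMap.const _ (face e τ)

lemma avg_congr (τ : SimplexSpace L d k)
    {φ φ' : ((Fin (d + 1) ↪o Fin (k + 1)) → C(unitInterval, SimplexSpace L d d)) → ℝ}
    (H : ∀ h, IsStart τ h → φ h = φ' h) : avg hY τ φ = avg hY τ φ' :=
  listMean_congr hY _ H _ fun _ => rfl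

lemma avg_const (τ : SimplexSpace L d k) (r : ℝ) : avg hY τ (fun _ => r) = r :=
  listMean_const hY _ r _ _

lemma abs_avg_le (τ : SimplexSpace L d k)
    {φ : ((Fin (d + 1) ↪o Fin (k + 1)) → C(unitInterval, SimplexSpace L d d)) → ℝ} {C : ℝ}
    (hC : ∀ h, |φ h| ≤ C) : |avg hY τ φ| ≤ C := abs_listMean_le hY _ hC _ _

lemma avg_marginal (τ : SimplexSpace L d k) (g : Fin (m + 1) ↪o Fin (k + 1))
    (φ : ((Fin (d + 1) ↪o Fin (m + 1)) → C(unitInterval, SimplexSpace L d d)) → ℝ) :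
    avg hY τ (fun h => φ (h ∘ embTrans d g)) = avg hY (face g τ) φ := by
  have hf : ∀ e : Fin (d + 1) ↪o Fin (m + 1), face (embTrans d g e) τ = face e (face g τ) := by
    intro e
    ext x
    rw [toMap_face, toMap_face, toMap_face, faceMap_faceMap]
    rfl
  classical
  rw [avg, listMean_marginal hY (embTrans_injective g) (φ' := φ) (fun h => rfl) _
    (l' := embList d m) (by rw [map_embList]; congr!)]
  simp only [Function.comp_def, hf]
  rfl

variable {n : ℕ}

/-- The average of a cochain. -/
def average (f : SingularSimplex X n → ℝ) (τ : SingularSimplex X n) : ℝ :=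
  avg hY (of L d τ) fun h => f (slice (thetaS (of L d τ) h) 1)

/-- The primitive of the difference between a cocycle and its average. -/
def averagePrim (f : SingularSimplex X (n + 1) → ℝ) (τ : SingularSimplex X n) : ℝ :=
  avg hY (of L d τ) fun h => ev f (prism (thetaS (of L d τ) h))

lemma abs_average_le {f : SingularSimplex X n → ℝ} {C : ℝ} (hf : ∀ σ, |f σ| ≤ C)
    (τ : SingularSimplex X n) : |average hY f τ| ≤ C := abs_avg_le hY _ fun _ => hf _

lemma average_eq_zero {f : SingularSimplex X n → ℝ}
    (hf : ∀ σ : SingularSimplex X n, Set.range σ ⊆ L → f σ = 0) {τ : SingularSimplex X n}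
    (hτ : Set.range τ ⊆ L) : average hY f τ = 0 := by
  rw [average, avg_congr hY (φ' := fun _ => 0), avg_const]
  intro h H
  refine hf _ ?_
  rintro _ ⟨x, rfl⟩
  exact H.thetaS_mem (fun x => hτ ⟨x, rfl⟩) _

lemma averagePrim_eq_zero {f : SingularSimplex X (n + 1) → ℝ}
    (hf : ∀ σ : SingularSimplex X (n + 1), Set.range σ ⊆ L → f σ = 0) {τ : SingularSimplex X n}
    (hτ : Set.range τ ⊆ L) : averagePrim hY f τ = 0 := by
  rw [averagePrim, avg_congr hY (φ' := fun _ => 0), avg_const]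
  intro h H
  refine ev_eq_zero_of_span hf (prism_mem_chainsIn _ ?_)
  rintro _ ⟨x, rfl⟩
  exact H.thetaS_mem (fun x => hτ ⟨x, rfl⟩) _

lemma average_eq {f : SingularSimplex X (n + 1) → ℝ}
    (hf : ∀ c, ev f (boundary ℝ X (n + 1) c) = 0) (τ : SingularSimplex X (n + 1)) :
    average hY f τ = f τ + ev (averagePrim hY f) (boundary ℝ X n (Finsupp.single τ 1)) := by
  have h1 : ∀ h, IsStart (of L d τ) h → f (slice (thetaS (of L d τ) h) 1) = f τ +
      ∑ i : Fin (n + 2), (-1 : ℝ) ^ (i : ℕ) * ev f (prism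
        (thetaS (face i.succAboveOrderEmb (of L d τ)) (h ∘ embTrans d i.succAboveOrderEmb))) := by
    intro h H
    have := hf (prism (thetaS (of L d τ) h))
    rw [boundary_prism_succ, map_sub, map_sub, map_sum, ev_single, ev_single] at this
    have h0 : slice (thetaS (of L d τ) h) 0 = τ := by
      ext x
      exact thetaS_zero x
    rw [h0] at this
    have h2 : ∀ i : Fin (n + 2), ev f ((-1 : ℝ) ^ (i : ℕ) • prism (restr (thetaS (of L d τ) h)
        (coface i))) = (-1 : ℝ) ^ (i : ℕ) * ev f (prism
        (thetaS (face i.succAboveOrderEmb (of L d τ)) (h ∘ embTrans d i.succAboveOrderEmb))) := by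
      intro i
      rw [map_smul, smul_eq_mul, coface_eq_faceMap, ← H.restr_thetaS]
      rfl
    simp only [h2] at this
    linarith
  have h2 : ∀ i : Fin (n + 2), averagePrim hY f (τ.comp (coface i))
      = avg hY (of L d τ) (fun h => ev f (prism (thetaS (face i.succAboveOrderEmb (of L d τ))
        (h ∘ embTrans d i.succAboveOrderEmb)))) := by
    intro i
    rw [avg_marginal hY (of L d τ) i.succAboveOrderEmb fun h => ev f (prism (thetaS
      (face i.succAboveOrderEmb (of L d τ)) h)), coface_eq_faceMap]
    rfl
  rw [boundary_single, map_sum, average, avg_congr hY _ h1]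
  have h3 : (fun h => f τ + ∑ i : Fin (n + 2), (-1 : ℝ) ^ (i : ℕ) * ev f (prism
        (thetaS (face i.succAboveOrderEmb (of L d τ)) (h ∘ embTrans d i.succAboveOrderEmb))))
      = (fun _ => f τ) + ∑ i : Fin (n + 2), (-1 : ℝ) ^ (i : ℕ) • fun h => ev f (prism
        (thetaS (face i.succAboveOrderEmb (of L d τ)) (h ∘ embTrans d i.succAboveOrderEmb))) := by
    funext h
    simp
  rw [h3, map_add, avg_const, map_sum]
  congr 1
  refine Finset.sum_congr rfl fun i _ => ?_
  rw [map_smul, ← h2]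
  simp [ev, mul_comm]

lemma ev_average {f : SingularSimplex X (n + 1) → ℝ}
    (hf : ∀ c, ev f (boundary ℝ X (n + 1) c) = 0) (c : SingularChain ℝ X (n + 1)) :
    ev (average hY f) c = ev f c + ev (averagePrim hY f) (boundary ℝ X n c) := by
  have : ev (average hY f) = ev f + ev (averagePrim hY f) ∘ₗ boundary ℝ X n := by
    refine Finsupp.lhom_ext' fun τ => LinearMap.ext_ring ?_
    simp only [LinearMap.comp_apply, Finsupp.lsingle_apply, LinearMap.add_apply, ev_single]
    exact average_eq hY hf τ
  rw [this]
  rfl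

end Average

/-! ### Invariance of averages -/

section Invariance
variable {X : Type*} [TopologicalSpace X] {L : Set X} {d n : ℕ}
open SimplexSpace

/-- Invariance of a cochain under homotopies in the space of simplices. -/
def Inv (L : Set X) (d : ℕ) (f : SingularSimplex X n → ℝ) : Prop :=
  ∀ P : C(unitInterval, SimplexSpace L d n), f (toMap (P 0)) = f (toMap (P 1))

lemma Inv.apply {f : SingularSimplex X n → ℝ} (hf : Inv L d f)
    (G : C(unitInterval × TopSimplex n, X)) {τ : SingularSimplex X n}
    (h : ∀ t, Good L d τ (G.curry t)) : f (G.curry 0) = f (G.curry 1) :=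
  hf (lift G fun t t' => (h t).symm.trans (h t'))

lemma inv_of_lt (hd : n < d) (f : SingularSimplex X n → ℝ) : Inv L d f := by
  intro P
  congr 1
  ext x
  refine ((good_of_preconnected P 0 1).low x ?_).symm
  exact (Finset.card_le_univ _).trans (by simpa using hd)

open Path.Homotopic.Quotient in
lemma homotopic_refl_of_pathRel {Y : Type*} [TopologicalSpace Y] {x y a : Y} {W : Path x y}
    {p : Path x a} {p' : Path y a} (h : p.Homotopic (W.trans p')) :
    (p.symm.trans (W.trans p')).Homotopic (Path.refl a) := by
  rw [← Path.Homotopic.Quotient.eq] at h ⊢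
  rw [mk_trans, ← h, mk_symm, symm_trans]
  rfl

variable {τ₁ τ₂ : SimplexSpace L d n}
  {h : (Fin (d + 1) ↪o Fin (n + 1)) → C(unitInterval, SimplexSpace L d d)}

/-- The homotopy determined by paths of faces, as a path of simplices. -/
def IsStart.path {τ : SimplexSpace L d n} (H : IsStart τ h) :
    Path τ (of L d (slice (thetaS τ h) 1)) where
  toFun := lift (thetaS τ h) fun t t' => (H.thetaS_good t).symm.trans (H.thetaS_good t')
  continuous_toFun := ContinuousMap.continuous _
  source' := by
    ext x
    exact thetaS_zero x
  target' := rfl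

lemma IsStart.face_path {τ : SimplexSpace L d n} (H : IsStart τ h)
    (e : Fin (d + 1) ↪o Fin (n + 1)) (s : unitInterval) : face e (H.path s) = h e s := by
  ext x
  exact H.skel.theta_faceMap e s x

/-- A path of simplices with null-homotopic faces does not change invariant cochains. -/
lemma Inv.eq_of_nullhomotopic {f : SingularSimplex X n → ℝ} (hf : Inv L (d + 1) f)
    {θ₁ θ₂ : SimplexSpace L d n} (Ω : Path θ₁ θ₂)
    (N : (Fin (d + 1) ↪o Fin (n + 1)) → C(unitInterval × unitInterval, SimplexSpace L d d))
    (h0 : ∀ e t, N e (0, t) = face e (Ω t)) (h1 : ∀ e t, N e (1, t) = face e θ₁)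
    (hl : ∀ e s, N e (s, 0) = face e θ₁) (hr : ∀ e s, N e (s, 1) = face e θ₁) :
    f (toMap θ₁) = f (toMap θ₂) := by
  let Om : C(TopSimplex n, C(unitInterval, X)) :=
    ContinuousMap.curry ((unlift Ω.toContinuousMap).comp ContinuousMap.prodSwap)
  let Nh : (Fin (d + 1) ↪o Fin (n + 1)) → C(unitInterval × TopSimplex d, C(unitInterval, X)) :=
    fun e => ContinuousMap.curry ((unlift (N e)).comp
      ⟨fun p => ((p.1.1, p.2), p.1.2), by fun_prop⟩)
  have hOm : ∀ x t, Om x t = toMap (Ω t) x := fun _ _ => rfl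
  have hNh : ∀ e s x t, Nh e (s, x) t = toMap (N e (s, t)) x := fun _ _ _ _ => rfl
  have hNg : ∀ (e : Fin (d + 1) ↪o Fin (n + 1)) s t,
      Good L d ((toMap (Ω t)).comp (faceMap e)) (toMap (N e (s, t))) := by
    intro e s t
    have := good_of_preconnected (N e) (0, t) (s, t)
    rw [h0] at this
    exact this
  have hOg : ∀ t, Good L d (toMap θ₁) (toMap (Ω t)) := fun t => by
    have := good_of_preconnected Ω.toContinuousMap 0 t
    rwa [show Ω.toContinuousMap 0 = θ₁ from Ω.source] at this
  have hsk : SkelHomotopy Om Nh :=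
    { zero := fun e x => by
        ext t
        rw [hNh, hOm, h0, toMap_face]
      bdry := fun e s x hx => by
        ext t
        rw [hNh, hOm]
        exact (hNg e s t).low x ((isBd_iff_card x).1 hx) }
  let G : C((unitInterval × unitInterval) × TopSimplex n, X) :=
    (ContinuousMap.uncurry (theta Om Nh)).comp ⟨fun p => ((p.1.1, p.2), p.1.2), by fun_prop⟩
  have hG : ∀ s t x, G ((s, t), x) = theta Om Nh (s, x) t := fun _ _ _ => rfl
  have hface : ∀ s t S, (∀ x ∈ faceSet n S, G ((s, t), x) ∈ L) ↔
      ∀ x ∈ faceSet n S, toMap θ₁ x ∈ L := by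
    intro s t S
    have := hsk.theta_mem_iff {γ | γ t ∈ L} (fun e s => (hNg e s t).range_mem) S s
    exact this.trans ((hOg t).face S)
  have hlow : ∀ s t, (∀ e, N e (s, t) = face e θ₁) → ∀ x, (vsupp x).card ≤ d + 1 →
      G ((s, t), x) = toMap θ₁ x := by
    intro s t hst x hx
    rcases Nat.lt_or_ge d (vsupp x).card with hd | hd
    · have hdn : d ≤ n := by
        have := Finset.card_le_univ (vsupp x)
        rw [Fintype.card_fin] at this
        omega
      obtain ⟨e, he⟩ := exists_orderEmb hx hdn
      obtain ⟨y, rfl⟩ := exists_faceMap_eq (g := e.toEmbedding) he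
      have := hsk.theta_faceMap e s y
      change theta Om Nh (s, faceMap e y) t = _
      rw [this, hNh, hst, toMap_face]
      rfl
    · rw [hG, theta_of_card hd, hOm, (hOg t).low x hd]
  have hgood : ∀ s t, (∀ e, N e (s, t) = face e θ₁) →
      Good L (d + 1) (toMap θ₁) (G.curry (s, t)) := fun s t hst =>
    { low := hlow s t hst
      face := hface s t
      vertex := fun i _ => hlow s t hst _ (by rw [vsupp_vert]; simp) }
  have e1 : f (G.curry (0, 0)) = f (G.curry (1, 0)) :=
    hf.apply (G.comp ⟨fun p => ((p.1, 0), p.2), by fun_prop⟩) (τ := toMap θ₁)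
      fun s => hgood s 0 fun e => hl e s
  have e2 : f (G.curry (1, 0)) = f (G.curry (1, 1)) :=
    hf.apply (G.comp ⟨fun p => ((1, p.1), p.2), by fun_prop⟩) (τ := toMap θ₁)
      fun s => hgood 1 s fun e => h1 e s
  have e3 : f (G.curry (0, 1)) = f (G.curry (1, 1)) :=
    hf.apply (G.comp ⟨fun p => ((p.1, 1), p.2), by fun_prop⟩) (τ := toMap θ₁)
      fun s => hgood s 1 fun e => hr e s
  have c0 : G.curry (0, 0) = toMap θ₁ := by
    ext x
    change G ((0, 0), x) = _
    rw [hG, theta_zero, hOm, Ω.source]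
  have c1 : G.curry (0, 1) = toMap θ₂ := by
    ext x
    change G ((0, 1), x) = _
    rw [hG, theta_zero, hOm, Ω.target]
  rw [← c0, ← c1, e1, e2, e3]

variable (hY : ∀ a : SimplexSpace L d d, HasMean (FundamentalGroup (SimplexSpace L d d) a))

lemma inv_average {f : SingularSimplex X n → ℝ} {C : ℝ} (hC : ∀ σ, |f σ| ≤ C)
    (hf : Inv L (d + 1) f) : Inv L d (average hY f) := by
  intro P
  let W : Path (P 0) (P 1) := ⟨P, rfl, rfl⟩
  refine listMean_inv hY (α := fun e => face e (P 0)) (α' := fun e => face e (P 1))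
    (fun e => W.map (face e).continuous) (C := C) (fun h => hC _) (fun h h' hh => ?_) _
    fun e he => absurd (mem_embList e) he
  have H : IsStart (P 0) h := fun e => by
    obtain ⟨a, p, p', h1, h2, -⟩ := hh e
    rw [h1]
    exact p.source
  have H' : IsStart (P 1) h' := fun e => by
    obtain ⟨a, p, p', h1, h2, -⟩ := hh e
    rw [h2]
    exact p'.source
  change f (slice (thetaS (P 0) h) 1) = f (slice (thetaS (P 1) h') 1)
  let Ω := H.path.symm.trans (W.trans H'.path)
  have key : ∀ e, ∃ N : C(unitInterval × unitInterval, SimplexSpace L d d),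
      (∀ t, N (0, t) = face e (Ω t)) ∧
      (∀ t, N (1, t) = face e (of L d (slice (thetaS (P 0) h) 1))) ∧
      (∀ s, N (s, 0) = face e (of L d (slice (thetaS (P 0) h) 1))) ∧
      ∀ s, N (s, 1) = face e (of L d (slice (thetaS (P 0) h) 1)) := by
    intro e
    obtain ⟨a, p, p', h1, h2, h3⟩ := hh e
    have ha : face e (of L d (slice (thetaS (P 0) h) 1)) = a := by
      have := H.face_path e 1
      rw [h1, H.path.target] at this
      exact this.trans p.target
    obtain ⟨F⟩ := homotopic_refl_of_pathRel h3
    have hp : ∀ t, face e (H.path t) = p t := fun t => by rw [H.face_path, h1]; rfl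
    have hp' : ∀ t, face e (H'.path t) = p' t := fun t => by rw [H'.face_path, h2]; rfl
    refine ⟨F.toContinuousMap, fun t => ?_, fun t => ?_, fun s => ?_, fun s => ?_⟩
    · refine (F.apply_zero t).trans ?_
      change (p.symm.trans ((W.map (face e).continuous).trans p')) t
        = face e (H.path.symm.trans (W.trans H'.path) t)
      simp only [Path.trans_apply, Path.symm_apply]
      split_ifs
      · exact (hp _).symm
      · rfl
      · exact (hp' _).symm
    · rw [ha]
      exact F.apply_one t
    · rw [ha]
      exact F.source s
    · rw [ha]
      exact F.target s
  choose N n1 n2 n3 n4 using key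
  exact hf.eq_of_nullhomotopic Ω N n1 n2 n3 n4

/-- A bounded relative cocycle of positive degree is cohomologous to an invariant one. -/
lemma exists_invariant_succ (hL : ∀ (x : X) (hx : x ∈ L), IsAmenable
      (FundamentalGroup (connectedComponentIn L x) ⟨x, mem_connectedComponentIn hx⟩))
    {f : SingularSimplex X (n + 1) → ℝ} {C : ℝ} (hC : ∀ σ, |f σ| ≤ C)
    (hcoc : ∀ c, ev f (boundary ℝ X (n + 1) c) = 0)
    (hrel : ∀ σ : SingularSimplex X (n + 1), Set.range σ ⊆ L → f σ = 0) :
    ∀ j d, d + j = n + 2 → ∃ f' : SingularSimplex X (n + 1) → ℝ, (∀ σ, |f' σ| ≤ C) ∧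
      (∀ c, ev f' (boundary ℝ X (n + 1) c) = 0) ∧
      (∀ σ : SingularSimplex X (n + 1), Set.range σ ⊆ L → f' σ = 0) ∧
      (∀ z ∈ relativeCycles ℝ X L (n + 1), ev f' z = ev f z) ∧ Inv L d f' := by
  intro j
  induction j with
  | zero => exact fun d hd => ⟨f, hC, hcoc, hrel, fun _ _ => rfl, inv_of_lt (by omega) f⟩
  | succ j ih =>
    intro d hd
    obtain ⟨g, g1, g2, g3, g4, g5⟩ := ih (d + 1) (by omega)
    have hY := fun a : SimplexSpace L d d => hasMean_simplexSpace hL a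
    refine ⟨average hY g, abs_average_le hY g1, fun c => ?_, fun σ => average_eq_zero hY g3,
      fun z hz => ?_, inv_average hY g1 g5⟩
    · rw [ev_average hY g2, g2, boundary_boundary, map_zero, add_zero]
    · rw [ev_average hY g2, g4 z hz, ev_eq_zero_of_span
        (fun σ => averagePrim_eq_zero hY g3 (τ := σ)) hz, add_zero]

end Invariance

/-! ### Invariant cocycles -/

section InvariantCocycle
variable {X : Type*} [TopologicalSpace X] {L : Set X} {n : ℕ}

/-- `W` is a homotopy moving points only inside `L`. -/
def SupportedIn (L : Set X) {Z : Type*} [TopologicalSpace Z] (W : C(unitInterval × Z, X)) : Prop :=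
  ∀ x, (∀ t, W (t, x) ∈ L) ∨ ∀ t, W (t, x) = W (0, x)

lemma SupportedIn.mem_iff {Z : Type*} [TopologicalSpace Z] {W : C(unitInterval × Z, X)}
    (h : SupportedIn L W) (t : unitInterval) (x : Z) : W (t, x) ∈ L ↔ W (0, x) ∈ L := by
  rcases h x with h | h
  · simp only [h]
  · rw [h]

lemma SupportedIn.good {W : C(unitInterval × TopSimplex n, X)} (h : SupportedIn L W)
    (t : unitInterval) : Good L 0 (W.curry 0) (W.curry t) where
  low x hx := absurd (card_vsupp_pos x) (by omega)
  face S := forall₂_congr fun x _ => h.mem_iff t x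
  vertex i hi := (h (vert n i)).elim (fun h' => absurd (h' 0) hi) fun h' => h' t

/-- A bounded relative cocycle is cohomologous to a relative cocycle invariant under homotopies
supported in `L`, if the components of `L` have amenable fundamental groups. -/
lemma exists_invariant (hL : ∀ (x : X) (hx : x ∈ L), IsAmenable
      (FundamentalGroup (connectedComponentIn L x) ⟨x, mem_connectedComponentIn hx⟩))
    {f : SingularSimplex X n → ℝ} {C : ℝ} (hC : ∀ σ, |f σ| ≤ C)
    (hcoc : ∀ c, ev f (boundary ℝ X n c) = 0)
    (hrel : ∀ σ : SingularSimplex X n, Set.range σ ⊆ L → f σ = 0) :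
    ∃ f' : SingularSimplex X n → ℝ, (∀ σ, |f' σ| ≤ C) ∧
      (∀ c, ev f' (boundary ℝ X n c) = 0) ∧
      (∀ σ : SingularSimplex X n, Set.range σ ⊆ L → f' σ = 0) ∧
      (∀ z ∈ relativeCycles ℝ X L n, ev f' z = ev f z) ∧
      ∀ W : C(unitInterval × TopSimplex n, X), SupportedIn L W →
        f' (slice W 0) = f' (slice W 1) := by
  cases n with
  | zero =>
    refine ⟨f, hC, hcoc, hrel, fun _ _ => rfl, fun W _ => ?_⟩
    have := hcoc (prism W)
    rw [boundary_prism_zero, map_sub, ev_single, ev_single] at this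
    linarith
  | succ n =>
    obtain ⟨f', h1, h2, h3, h4, h5⟩ := exists_invariant_succ hL hC hcoc hrel (n + 2) 0 (by omega)
    exact ⟨f', h1, h2, h3, h4, fun W hW => h5.apply W fun t => hW.good t⟩

end InvariantCocycle

/-! ### Collars -/

section Collar
variable {X : Type*} [TopologicalSpace X] {bd : Set X}

/-- A collar of `bd` in `X` whose half-open part is open. -/
structure Collar (bd : Set X) where
  map : C(bd × unitInterval, X)
  isClosedEmbedding : IsClosedEmbedding map
  map_zero : ∀ x, map (x, 0) = x
  mem_iff : ∀ x t, map (x, t) ∈ bd ↔ t = 0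
  isOpen_image : IsOpen (map '' {p | p.2 < 1})

lemma exists_collar [CompactSpace X] (hbd : IsClosed bd) (h : HasBoundaryCollar X bd) :
    Nonempty (Collar bd) := by
  obtain ⟨φ, hφ, h0, hnhds, hmem⟩ := h
  have : CompactSpace bd := isCompact_iff_compactSpace.1 hbd.isCompact
  let V := φ ⁻¹' interior (Set.range φ)
  have hV : IsOpen V := isOpen_interior.preimage φ.continuous
  obtain ⟨A, B, -, hB, hA, hB0, hAB⟩ := generalized_tube_lemma (s := (Set.univ : Set bd))
    isCompact_univ (t := ({0} : Set unitInterval)) isCompact_singleton hV (by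
      rintro ⟨x, t⟩ ⟨-, ht⟩
      replace ht : t = 0 := ht
      change φ (x, t) ∈ interior (Set.range φ)
      rw [ht, h0]
      exact mem_interior_iff_mem_nhds.2 (mem_nhdsSet_iff_forall.1 hnhds x x.2))
  obtain ⟨ε, hε, hball⟩ := Metric.isOpen_iff.1 hB 0 (hB0 rfl)
  let δ : unitInterval := ⟨min 1 (ε / 2), by positivity, min_le_left _ _⟩
  have hδ : 0 < (δ : ℝ) := lt_min one_pos (half_pos hε)
  have hδB : ∀ t : unitInterval, t ≤ δ → t ∈ B := by
    intro t ht
    refine hball ?_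
    have h1 : (t : ℝ) ≤ ε / 2 := le_trans (show (t : ℝ) ≤ δ from ht) (min_le_right _ _)
    rw [Metric.mem_ball, Subtype.dist_eq, Real.dist_eq]
    simp only [Set.Icc.coe_zero, sub_zero]
    rw [abs_of_nonneg t.2.1]
    linarith
  let sc : C(bd × unitInterval, bd × unitInterval) := ⟨fun p => (p.1, δ * p.2), by fun_prop⟩
  have hcoe : ∀ t : unitInterval, ((δ * t : unitInterval) : ℝ) = δ * t := fun _ => rfl
  have hmulinj : Function.Injective fun t : unitInterval => δ * t := by
    intro s t hst
    have := congrArg (Subtype.val) hst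
    simp only [hcoe] at this
    exact Subtype.ext (mul_left_cancel₀ hδ.ne' this)
  have hsc : IsClosedEmbedding sc := by
    have : IsClosedEmbedding fun t : unitInterval => δ * t :=
      (by fun_prop : Continuous fun t : unitInterval => δ * t).isClosedEmbedding hmulinj
    exact (IsClosedEmbedding.id (X := bd)).prodMap this
  have hle : ∀ t : unitInterval, δ * t ≤ δ := fun t => by
    rw [← Subtype.coe_le_coe, hcoe]
    exact mul_le_of_le_one_right hδ.le t.2.2
  refine ⟨⟨φ.comp sc, hφ.comp hsc, fun x => ?_, fun x t => ?_, ?_⟩⟩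
  · change φ (x, δ * 0) = x
    rw [mul_zero, h0]
  · change φ (x, δ * t) ∈ bd ↔ _
    rw [hmem]
    exact ⟨fun h => hmulinj (h.trans (mul_zero δ).symm), fun h => by rw [h, mul_zero]⟩
  · obtain ⟨O, hO, hOe⟩ := hφ.isInducing.isOpen_iff.1
      (isOpen_lt continuous_snd continuous_const : IsOpen {p : bd × unitInterval | p.2 < δ})
    have : (φ.comp sc) '' {p | p.2 < 1} = O ∩ interior (Set.range φ) := by
      apply Set.Subset.antisymm
      · rintro _ ⟨⟨x, t⟩, ht, rfl⟩
        refine ⟨?_, hAB ⟨hA trivial, hδB _ (hle t)⟩⟩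
        change (x, δ * t) ∈ φ ⁻¹' O
        rw [hOe]
        change δ * t < δ
        rw [← Subtype.coe_lt_coe, hcoe]
        exact mul_lt_of_lt_one_right hδ (show (t : ℝ) < 1 from ht)
      · rintro y ⟨hyO, hyR⟩
        obtain ⟨⟨x, t⟩, rfl⟩ := interior_subset hyR
        have ht : (x, t) ∈ φ ⁻¹' O := hyO
        rw [hOe] at ht
        have ht' : (t : ℝ) < δ := ht
        refine ⟨(x, ⟨t / δ, div_nonneg t.2.1 hδ.le, (div_le_one hδ).2 ht'.le⟩), ?_, ?_⟩
        · change (t : ℝ) / δ < 1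
          exact (div_lt_one hδ).2 ht'
        · change φ (x, δ * _) = _
          congr 2
          exact Subtype.ext (mul_div_cancel₀ _ hδ.ne')
    rw [this]
    exact hO.inter isOpen_interior

namespace Collar
variable (κ : Collar bd) {P Y : Type*} [TopologicalSpace P] [TopologicalSpace Y]

/-- Gluing of maps along a collar. -/
lemma exists_glue (a : C(P × (bd × unitInterval), Y)) (b : C(P × X, Y))
    (hab : ∀ s x, a (s, (x, 1)) = b (s, κ.map (x, 1))) :
    ∃ F : C(P × X, Y), (∀ s p, F (s, κ.map p) = a (s, p)) ∧
      ∀ s y, y ∉ κ.map '' {p | p.2 < 1} → F (s, y) = b (s, y) := by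
  classical
  let F : P × X → Y := fun p =>
    if h : p.2 ∈ Set.range κ.map then a (p.1, h.choose) else b p
  have h1 : ∀ s p, F (s, κ.map p) = a (s, p) := by
    intro s p
    have h : (s, κ.map p).2 ∈ Set.range κ.map := ⟨p, rfl⟩
    simp only [F, dif_pos h]
    rw [κ.isClosedEmbedding.injective h.choose_spec]
  have h2 : ∀ s y, y ∉ κ.map '' {p | p.2 < 1} → F (s, y) = b (s, y) := by
    intro s y hy
    by_cases h : y ∈ Set.range κ.map
    · obtain ⟨⟨x, t⟩, rfl⟩ := h
      have ht : t = 1 := by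
        by_contra ht
        exact hy ⟨(x, t), lt_of_le_of_ne unitInterval.le_one' ht, rfl⟩
      rw [h1, ht, hab]
    · exact dif_neg h
  have hA : ContinuousOn F (Prod.snd ⁻¹' Set.range κ.map) := by
    have hemb : IsClosedEmbedding (Prod.map (id : P → P) κ.map) :=
      IsClosedEmbedding.id.prodMap κ.isClosedEmbedding
    have hr : Prod.snd ⁻¹' Set.range κ.map = Set.range (Prod.map (id : P → P) κ.map) := by
      ext ⟨s, y⟩
      simp
    rw [hr, ← Set.image_univ, hemb.isInducing.continuousOn_image_iff, continuousOn_univ]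
    have : F ∘ Prod.map (id : P → P) κ.map = a := by
      ext ⟨s, p⟩
      exact h1 s p
    rw [this]
    exact a.continuous
  have hB : ContinuousOn F (Prod.snd ⁻¹' (κ.map '' {p | p.2 < 1})ᶜ) :=
    b.continuous.continuousOn.congr fun p hp => h2 p.1 p.2 hp
  have hu : (Prod.snd ⁻¹' Set.range κ.map : Set (P × X)) ∪
      Prod.snd ⁻¹' (κ.map '' {p | p.2 < 1})ᶜ = Set.univ := by
    rw [← Set.preimage_union, Set.eq_univ_iff_forall]
    rintro ⟨s, y⟩
    by_cases h : y ∈ Set.range κ.map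
    · exact Or.inl h
    · exact Or.inr fun ⟨p, _, hp⟩ => h ⟨p, hp⟩
  have hF : Continuous F := by
    rw [← continuousOn_univ, ← hu]
    exact hA.union_of_isClosed hB
      (κ.isClosedEmbedding.isClosed_range.preimage continuous_snd)
      (κ.isOpen_image.isClosed_compl.preimage continuous_snd)
  exact ⟨⟨F, hF⟩, h1, h2⟩

lemma exists_height : ∃ u : C(X, unitInterval), (∀ p, u (κ.map p) = p.2) ∧
    ∀ y, y ∉ κ.map '' {p | p.2 < 1} → u y = 1 := by
  obtain ⟨F, h1, h2⟩ := κ.exists_glue (P := Unit) (Y := unitInterval)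
    ⟨fun p => p.2.2, by fun_prop⟩ (ContinuousMap.const _ 1) fun _ _ => rfl
  exact ⟨F.comp ((ContinuousMap.const _ ()).prodMk (ContinuousMap.id _)), h1 (), h2 ()⟩

/-- The height of a point in the collar, extended by `1`. -/
def height : C(X, unitInterval) := κ.exists_height.choose

lemma height_map (p : bd × unitInterval) : κ.height (κ.map p) = p.2 :=
  κ.exists_height.choose_spec.1 p

lemma cases_point (y : X) : (∃ x t, y = κ.map (x, t)) ∨
    (κ.height y = 1 ∧ y ∉ κ.map '' {p | p.2 < 1}) := by
  by_cases h : y ∈ κ.map '' {p | p.2 < 1}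
  · obtain ⟨⟨x, t⟩, -, rfl⟩ := h
    exact Or.inl ⟨x, t, rfl⟩
  · exact Or.inr ⟨κ.exists_height.choose_spec.2 y h, h⟩

lemma height_eq_zero_iff {y : X} : κ.height y = 0 ↔ y ∈ bd := by
  rcases κ.cases_point y with ⟨x, t, rfl⟩ | ⟨h, h'⟩
  · rw [κ.height_map, κ.mem_iff]
  · rw [h]
    refine ⟨fun h => absurd h one_ne_zero, fun hy => absurd ?_ h'⟩
    exact ⟨(⟨y, hy⟩, 0), show (0 : unitInterval) < 1 from zero_lt_one, κ.map_zero _⟩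

/-- The deformation of `X` induced by a deformation of the collar parameter. -/
def deform (g : C(P × unitInterval, unitInterval)) (hg : ∀ s, g (s, 1) = 1) : C(P × X, X) :=
  (κ.exists_glue (P := P) (Y := X) ⟨fun p => κ.map (p.2.1, g (p.1, p.2.2)), by fun_prop⟩
    ⟨Prod.snd, continuous_snd⟩ fun s x => by simp [hg]).choose

variable {g : C(P × unitInterval, unitInterval)} {hg : ∀ s, g (s, 1) = 1}

lemma deform_map (s : P) (x : bd) (t : unitInterval) :
    κ.deform g hg (s, κ.map (x, t)) = κ.map (x, g (s, t)) :=
  (κ.exists_glue (P := P) (Y := X) ⟨fun p => κ.map (p.2.1, g (p.1, p.2.2)), by fun_prop⟩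
    ⟨Prod.snd, continuous_snd⟩ fun s x => by simp [hg]).choose_spec.1 s (x, t)

lemma deform_of_notMem (s : P) {y : X} (hy : y ∉ κ.map '' {p | p.2 < 1}) :
    κ.deform g hg (s, y) = y :=
  (κ.exists_glue (P := P) (Y := X) ⟨fun p => κ.map (p.2.1, g (p.1, p.2.2)), by fun_prop⟩
    ⟨Prod.snd, continuous_snd⟩ fun s x => by simp [hg]).choose_spec.2 s y hy

lemma height_deform (s : P) (y : X) : κ.height (κ.deform g hg (s, y)) = g (s, κ.height y) := by
  rcases κ.cases_point y with ⟨x, t, rfl⟩ | ⟨h, h'⟩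
  · rw [κ.deform_map, κ.height_map, κ.height_map]
  · rw [κ.deform_of_notMem s h', h, hg]

lemma deform_eq_self {s : P} {y : X} (h : g (s, κ.height y) = κ.height y) :
    κ.deform g hg (s, y) = y := by
  rcases κ.cases_point y with ⟨x, t, rfl⟩ | ⟨-, h'⟩
  · rw [κ.deform_map]
    rw [κ.height_map] at h
    rw [h]
  · exact κ.deform_of_notMem s h'

lemma deform_deform {g' : C(P × unitInterval, unitInterval)} {hg' : ∀ s, g' (s, 1) = 1} {s s' : P}
    {y : X} (h : g (s, g' (s', κ.height y)) = g (s, κ.height y)) :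
    κ.deform g hg (s, κ.deform g' hg' (s', y)) = κ.deform g hg (s, y) := by
  rcases κ.cases_point y with ⟨x, t, rfl⟩ | ⟨-, h'⟩
  · rw [κ.deform_map, κ.deform_map, κ.deform_map]
    rw [κ.height_map] at h
    rw [h]
  · rw [κ.deform_of_notMem s' h']

/-- The parameter of the retraction of half of the collar onto the boundary. -/
def retrParam : C(unitInterval × unitInterval, unitInterval) where
  toFun p := ⟨max 0 (p.2 - p.1 * (1 - p.2)), le_max_left _ _, max_le zero_le_one (by
    nlinarith [p.1.2.1, p.2.2.2])⟩
  continuous_toFun := by fun_prop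

lemma retrParam_one (s : unitInterval) : retrParam (s, 1) = 1 :=
  Subtype.ext (by simp [retrParam])

/-- The homotopy pushing half of the collar onto the boundary. -/
def retr : C(unitInterval × X, X) := κ.deform retrParam retrParam_one

/-- The homotopy pushing the boundary into the collar. -/
def push : C(unitInterval × X, X) :=
  κ.deform ⟨fun p => max p.2 p.1, by fun_prop⟩ fun s => max_eq_left unitInterval.le_one'

lemma retr_zero (y : X) : κ.retr (0, y) = y :=
  κ.deform_eq_self (Subtype.ext (by simp [retrParam, (κ.height y).2.1]))

lemma retr_one_mem {y : X} (h : (κ.height y : ℝ) ≤ 1 / 2) : κ.retr (1, y) ∈ bd := by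
  rw [← κ.height_eq_zero_iff, retr, height_deform]
  exact Subtype.ext (max_eq_left (by
    simp only [Set.Icc.coe_one]
    linarith))

lemma retr_mem (s : unitInterval) {y : X} (h : y ∈ bd) : κ.retr (s, y) ∈ bd := by
  rw [← κ.height_eq_zero_iff, retr, height_deform, κ.height_eq_zero_iff.2 h]
  exact Subtype.ext (max_eq_left (by simp [s.2.1]))

lemma push_zero (y : X) : κ.push (0, y) = y :=
  κ.deform_eq_self (max_eq_left unitInterval.nonneg')

lemma height_push (s : unitInterval) (y : X) : κ.height (κ.push (s, y)) = max (κ.height y) s :=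
  κ.height_deform s y

lemma retr_push {s : unitInterval} (hs : (s : ℝ) ≤ 1 / 2) (y : X) :
    κ.retr (1, κ.push (s, y)) = κ.retr (1, y) := by
  refine κ.deform_deform (Subtype.ext ?_)
  change max (0 : ℝ) (((max (κ.height y) s : unitInterval) : ℝ) - 1 * (1 -
    ((max (κ.height y) s : unitInterval) : ℝ))) = max 0 ((κ.height y : ℝ) - 1 * (1 - κ.height y))
  rcases le_total (κ.height y) s with h | h
  · have h' : (κ.height y : ℝ) ≤ s := h
    rw [max_eq_right h, max_eq_left (by linarith), max_eq_left (by linarith)]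
  · rw [max_eq_left h]

end Collar
end Collar

/-! ### Making simplices admissible -/

section Depth
variable {X : Type*} [TopologicalSpace X] {bd : Set X} {n : ℕ}

/-- One minus the sum of the barycentric coordinates in `S`. -/
def coSum (S : Finset (Fin (n + 1))) (x : TopSimplex n) : unitInterval :=
  ⟨1 - ∑ j ∈ S, x.1 j, by
    have := Finset.sum_le_sum_of_subset_of_nonneg (Finset.subset_univ S) fun j _ _ => x.2.1 j
    rw [x.2.2] at this
    linarith, by linarith [Finset.sum_nonneg fun j (_ : j ∈ S) => x.2.1 j]⟩

lemma continuous_coSum (S : Finset (Fin (n + 1))) : Continuous (coSum S) := by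
  unfold coSum
  fun_prop

lemma coSum_eq_zero_iff {S : Finset (Fin (n + 1))} {x : TopSimplex n} :
    coSum S x = 0 ↔ x ∈ faceSet n S := by
  have h1 : ∑ j ∈ S, x.1 j + ∑ j ∈ Sᶜ, x.1 j = 1 :=
    (Finset.sum_add_sum_compl S x.1).trans x.2.2
  have h2 : coSum S x = 0 ↔ ∑ j ∈ Sᶜ, x.1 j = 0 := by
    rw [← Subtype.coe_inj]
    change 1 - ∑ j ∈ S, x.1 j = 0 ↔ _
    constructor <;> intro h <;> linarith
  rw [h2, Finset.sum_eq_zero_iff_of_nonneg fun j _ => x.2.1 j]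
  simp only [Finset.mem_compl]
  rfl

open Classical in
/-- The faces mapped to `bd` by a simplex. -/
def bdFaces (bd : Set X) (σ : SingularSimplex X n) : Finset (Finset (Fin (n + 1))) :=
  {S | ∀ x ∈ faceSet n S, σ x ∈ bd}

lemma mem_bdFaces {σ : SingularSimplex X n} {S : Finset (Fin (n + 1))} :
    S ∈ bdFaces bd σ ↔ ∀ x ∈ faceSet n S, σ x ∈ bd := by
  simp [bdFaces]

lemma bdFaces_nonempty (σ : SingularSimplex X n) : (bdFaces bd σ).Nonempty := by
  refine ⟨∅, mem_bdFaces.2 fun x hx => absurd (card_vsupp_pos x) ?_⟩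
  rw [Finset.subset_empty.1 (mem_faceSet_iff.1 hx)]
  simp

/-- A function on the simplex vanishing precisely on the faces mapped to `bd`. -/
def depth (bd : Set X) (σ : SingularSimplex X n) : C(TopSimplex n, unitInterval) where
  toFun x := (bdFaces bd σ).inf' (bdFaces_nonempty σ) fun S => coSum S x
  continuous_toFun := Continuous.finset_inf'_apply _ fun S _ => continuous_coSum S

lemma depth_eq_zero_iff {σ : SingularSimplex X n} {x : TopSimplex n} :
    depth bd σ x = 0 ↔ ∃ S ∈ bdFaces bd σ, x ∈ faceSet n S := by
  constructor
  · intro h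
    obtain ⟨S, hS, hSx⟩ := Finset.exists_mem_eq_inf' (bdFaces_nonempty (bd := bd) σ)
      fun S => coSum S x
    exact ⟨S, hS, coSum_eq_zero_iff.1 (hSx.symm.trans h)⟩
  · rintro ⟨S, hS, hx⟩
    refine le_antisymm ?_ unitInterval.nonneg'
    rw [← coSum_eq_zero_iff.2 hx]
    exact Finset.inf'_le (fun S => coSum S x) hS

lemma depth_coface (σ : SingularSimplex X (n + 1)) (i : Fin (n + 2)) (x : TopSimplex n) :
    depth bd (σ.comp (coface i)) x = depth bd σ (coface i x) := by
  let g : Fin (n + 1) ↪o Fin (n + 2) := Fin.succAboveOrderEmb i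
  have hg : coface i = faceMap g := coface_eq_faceMap i
  have hsum : ∀ S : Finset (Fin (n + 2)), ∑ j ∈ S, (coface i x).1 j =
      ∑ k ∈ Finset.univ.filter fun k => g k ∈ S, x.1 k := by
    intro S
    simp only [coface_coe]
    rw [Finset.sum_comm, Finset.sum_filter]
    exact Finset.sum_congr rfl fun k _ => Finset.sum_ite_eq S _ _
  apply le_antisymm
  · refine Finset.le_inf' (bdFaces_nonempty σ) _ fun S hS => ?_
    refine (Finset.inf'_le (fun S => coSum S x)
      (b := Finset.univ.filter fun k => g k ∈ S) (mem_bdFaces.2 fun y hy => ?_)).trans_eq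
      (Subtype.ext (congrArg (fun r => 1 - r) (hsum S).symm))
    refine mem_bdFaces.1 hS _ (mem_faceSet_iff.2 ?_)
    have hv : vsupp (faceMap g y) = (vsupp y).map g.toEmbedding := vsupp_faceMap y
    rw [hg, hv]
    intro j hj
    obtain ⟨k, hk, rfl⟩ := Finset.mem_map.1 hj
    exact (Finset.mem_filter.1 (mem_faceSet_iff.1 hy hk)).2
  · refine Finset.le_inf' (bdFaces_nonempty _) _ fun T hT => ?_
    refine (Finset.inf'_le (fun S => coSum S (coface i x)) (b := T.map g.toEmbedding)
      (mem_bdFaces.2 ((forall_mem_faceSet_map g T).2 ?_))).trans_eq (Subtype.ext ?_)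
    · have := mem_bdFaces.1 hT
      rw [hg] at this
      exact this
    · refine congrArg (fun r => 1 - r) ((hsum _).trans (Finset.sum_congr ?_ fun _ _ => rfl))
      ext k
      simp

/-- The natural homotopy making all simplices admissible. -/
def Collar.admHomotopy (κ : Collar bd) : NatHomotopy X X where
  map n σ := κ.push.comp ⟨fun p => (p.1 * depth bd σ p.2, σ p.2), by fun_prop⟩
  face n σ i := by
    ext ⟨t, x⟩
    change κ.push (t * depth bd σ (coface i x), _) =
      κ.push (t * depth bd (σ.comp (coface i)) x, _)
    rw [depth_coface]
    rfl

lemma Collar.admHomotopy_apply (κ : Collar bd) (σ : SingularSimplex X n) (t : unitInterval)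
    (x : TopSimplex n) :
    κ.admHomotopy.map n σ (t, x) = κ.push (t * depth bd σ x, σ x) := rfl

lemma Collar.range_admHomotopy (κ : Collar bd) (n : ℕ) (σ : SingularSimplex X n)
    (h : Set.range σ ⊆ bd) : Set.range (κ.admHomotopy.map n σ) ⊆ bd := by
  rintro _ ⟨⟨t, x⟩, rfl⟩
  have : depth bd σ x = 0 := depth_eq_zero_iff.2
    ⟨Finset.univ, mem_bdFaces.2 fun y _ => h ⟨y, rfl⟩, mem_faceSet_iff.2 (Finset.subset_univ _)⟩
  rw [κ.admHomotopy_apply, this, mul_zero, κ.push_zero]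
  exact h ⟨x, rfl⟩

lemma Collar.admHomotopy_one_mem_iff (κ : Collar bd) (σ : SingularSimplex X n)
    (x : TopSimplex n) :
    κ.admHomotopy.map n σ (1, x) ∈ bd ↔ ∃ S ∈ bdFaces bd σ, x ∈ faceSet n S := by
  rw [κ.admHomotopy_apply, one_mul, ← depth_eq_zero_iff, ← κ.height_eq_zero_iff, κ.height_push]
  constructor
  · intro h
    exact le_antisymm (h ▸ le_max_right _ _) unitInterval.nonneg'
  · intro h
    obtain ⟨S, hS, hx⟩ := depth_eq_zero_iff.1 h
    rw [h, κ.height_eq_zero_iff.2 (mem_bdFaces.1 hS x hx), max_self]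

lemma mem_collapsedBoundary {x : X} : collapseMap X bd x ∈ collapsedBoundary X bd ↔ x ∈ bd := by
  refine ⟨?_, fun h => ⟨x, h, rfl⟩⟩
  rintro ⟨y, hy, hxy⟩
  have key : ∀ a b : X, Relation.EqvGen (collapseRel X bd) a b → (a ∈ bd ↔ b ∈ bd) := by
    intro a b h
    induction h with
    | rel a b h =>
      rcases h with rfl | ⟨ha, hb, -⟩
      · rfl
      · exact ⟨fun _ => hb, fun _ => ha⟩
    | refl => rfl
    | symm _ _ _ ih => exact ih.symm
    | trans _ _ _ _ _ ih1 ih2 => exact ih1.trans ih2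
  exact (key _ _ (Quot.eqvGen_exact hxy)).1 hy

lemma l1Norm_lmapDomain_le {Y : Type*} [TopologicalSpace Y] {k : ℕ}
    (g : SingularSimplex X n → SingularSimplex Y k) (c : SingularChain ℝ X n) :
    l1Norm (Finsupp.lmapDomain ℝ ℝ g c) ≤ l1Norm c := l1Norm_mapDomain_le g c

lemma mem_markedCycles_iff {B : Set X} {z : SingularChain ℝ X n} :
    z ∈ markedCycles ℝ X B n ↔
      z ∈ admissibleChains ℝ X B n ∧ z ∈ relativeCycles ℝ X B n := by
  cases n with
  | zero => exact ⟨fun h => ⟨h, trivial⟩, fun h => h.1⟩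
  | succ n => exact Iff.rfl

lemma exists_idealRepresents (κ : Collar bd) {ζ z : SingularChain ℝ X n}
    (hz : z ∈ relativeCycles ℝ X bd n) (hzζ : z - ζ ∈ relativeBoundaries ℝ X bd n) :
    ∃ z', IdealRepresents X bd n ζ z' ∧ l1Norm z' ≤ l1Norm z := by
  let H := κ.admHomotopy
  have hH := κ.range_admHomotopy
  let q := collapseMap X bd
  have hq : ∀ x ∈ bd, q x ∈ collapsedBoundary X bd := fun x hx => ⟨x, hx, rfl⟩
  have h0 : H.at 0 n z = z := by
    have : H.at 0 n = LinearMap.id := ochain_hom_ext fun σ => by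
      rw [H.at_single, LinearMap.id_apply]
      congr 1
      ext x
      change κ.push (0 * depth bd σ x, σ x) = σ x
      rw [zero_mul, κ.push_zero]
    rw [this, LinearMap.id_apply]
  refine ⟨pushChain ℝ q n (H.at 1 n z), ⟨mem_markedCycles_iff.2 ⟨?_, ?_⟩, ?_⟩,
    (l1Norm_lmapDomain_le _ _).trans (l1Norm_lmapDomain_le _ _)⟩
  · have : (pushChain ℝ q n).comp (H.at 1 n) z ∈ _ :=
      span_induct (P := fun _ => True) _ (admissibleChains ℝ _ (collapsedBoundary X bd) n)
        (fun σ _ => ?_) (c := z) ?_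
    · exact this
    · rw [LinearMap.comp_apply, H.at_single, pushChain_single]
      refine Submodule.subset_span ⟨_, ⟨bdFaces bd σ, ?_⟩, rfl⟩
      ext x
      rw [Set.mem_preimage]
      refine mem_collapsedBoundary.trans ((κ.admHomotopy_one_mem_iff σ x).trans ?_)
      simp
    · rw [← Finsupp.sum_single z]
      refine Submodule.sum_mem _ fun σ _ => ?_
      rw [← mul_one (z σ), ← smul_eq_mul, ← Finsupp.smul_single]
      exact Submodule.smul_mem _ _ (Submodule.subset_span ⟨σ, trivial, rfl⟩)
  · exact pushChain_mem_relativeCycles q hq (H.at_mem_relativeCycles hH 1 hz)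
  · rw [idealFundamentalRep, ← map_sub]
    refine pushChain_mem_relativeBoundaries q hq ?_
    have := H.at_sub_at_mem hH hz
    rw [h0] at this
    simpa using Submodule.add_mem _ this hzζ

end Depth

/-! ### Duality -/

section Duality
variable {X : Type*} [TopologicalSpace X] {n : ℕ}

lemma l1Norm_eq_sum {c : SingularChain ℝ X n} {s : Finset (SingularSimplex X n)}
    (hs : c.support ⊆ s) : l1Norm c = ∑ σ ∈ s, |c σ| :=
  Finsupp.sum_of_support_subset c hs _ fun _ _ => abs_zero

lemma l1Norm_add_le (a b : SingularChain ℝ X n) : l1Norm (a + b) ≤ l1Norm a + l1Norm b := by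
  classical
  rw [l1Norm_eq_sum (Finsupp.support_add (g₁ := a) (g₂ := b)),
    l1Norm_eq_sum (Finset.subset_union_left (s₁ := a.support) (s₂ := b.support)),
    l1Norm_eq_sum (Finset.subset_union_right (s₁ := a.support) (s₂ := b.support)),
    ← Finset.sum_add_distrib]
  exact Finset.sum_le_sum fun σ _ => abs_add_le _ _

lemma l1Norm_smul (r : ℝ) (c : SingularChain ℝ X n) : l1Norm (r • c) = |r| * l1Norm c := by
  rw [l1Norm_eq_sum (Finsupp.support_smul (b := r) (g := c)), l1Norm_eq_sum subset_rfl,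
    Finset.mul_sum]
  exact Finset.sum_congr rfl fun σ _ => abs_mul _ _

lemma l1Norm_zero : l1Norm (0 : SingularChain ℝ X n) = 0 := Finsupp.sum_zero_index

lemma l1Norm_single (σ : SingularSimplex X n) (r : ℝ) : l1Norm (Finsupp.single σ r) = |r| :=
  Finsupp.sum_single_index abs_zero

variable (S : Submodule ℝ (SingularChain ℝ X n))

/-- The quotient `ℓ¹`-seminorm modulo a subspace. -/
def quotNorm (c : SingularChain ℝ X n) : ℝ := ⨅ b : S, l1Norm (c + b.1)

lemma quotNorm_le (c : SingularChain ℝ X n) {b : SingularChain ℝ X n} (hb : b ∈ S) :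
    quotNorm S c ≤ l1Norm (c + b) :=
  ciInf_le (f := fun b : S => l1Norm (c + b.1)) ⟨0, by rintro _ ⟨b, rfl⟩; exact l1Norm_nonneg _⟩
    ⟨b, hb⟩

lemma quotNorm_nonneg (c : SingularChain ℝ X n) : 0 ≤ quotNorm S c :=
  le_ciInf fun _ => l1Norm_nonneg _

lemma quotNorm_add_le (a b : SingularChain ℝ X n) :
    quotNorm S (a + b) ≤ quotNorm S a + quotNorm S b := by
  refine le_ciInf_add_ciInf (g := fun x : S => l1Norm (a + x.1))
    (h := fun x : S => l1Norm (b + x.1)) fun x y => ?_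
  refine (quotNorm_le S (a + b) (S.add_mem x.2 y.2)).trans ?_
  rw [add_add_add_comm]
  exact l1Norm_add_le _ _

lemma quotNorm_smul_le {r : ℝ} (hr : 0 < r) (c : SingularChain ℝ X n) :
    quotNorm S (r • c) ≤ r * quotNorm S c := by
  rw [quotNorm, quotNorm, Real.mul_iInf_of_nonneg hr.le]
  refine le_ciInf fun b => ?_
  refine (quotNorm_le S (r • c) (S.smul_mem r b.2)).trans_eq ?_
  rw [← smul_add, l1Norm_smul, abs_of_pos hr]

lemma quotNorm_smul (r : ℝ) (hr : 0 < r) (c : SingularChain ℝ X n) :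
    quotNorm S (r • c) = r * quotNorm S c := by
  refine le_antisymm (quotNorm_smul_le S hr c) ?_
  have := quotNorm_smul_le S (inv_pos.2 hr) (r • c)
  rw [inv_smul_smul₀ hr.ne'] at this
  rwa [← div_eq_inv_mul, le_div_iff₀' hr] at this

/-- Duality between `ℓ¹` chains and bounded cochains. -/
lemma exists_cochain_eq_quotNorm {ζ : SingularChain ℝ X n} (hζ : ζ ≠ 0) :
    ∃ f : SingularSimplex X n → ℝ, (∀ σ, |f σ| ≤ 1) ∧ (∀ b ∈ S, ev f b = 0) ∧
      ev f ζ = quotNorm S ζ := by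
  obtain ⟨g, g1, g2⟩ := exists_extension_of_le_sublinear
    (LinearPMap.mkSpanSingleton ζ (quotNorm S ζ) hζ) (quotNorm S) (quotNorm_smul S)
    (quotNorm_add_le S) (by
      rintro ⟨x, hx⟩
      obtain ⟨r, rfl⟩ := Submodule.mem_span_singleton.1 hx
      rw [LinearPMap.mkSpanSingleton'_apply, RingHom.id_apply, smul_eq_mul]
      rcases le_or_gt r 0 with hr | hr
      · exact (mul_nonpos_of_nonpos_of_nonneg hr (quotNorm_nonneg S _)).trans (quotNorm_nonneg S _)
      · exact (quotNorm_smul S r hr ζ).ge)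
  have hev : ev (fun σ => g (Finsupp.single σ 1)) = g := by
    refine Finsupp.lhom_ext' fun σ => LinearMap.ext_ring ?_
    exact ev_single _ σ
  have hle : ∀ c, g c ≤ l1Norm c := fun c =>
    (g2 c).trans ((quotNorm_le S c S.zero_mem).trans_eq (by rw [add_zero]))
  have hS : ∀ b ∈ S, g b ≤ 0 := fun b hb =>
    (g2 b).trans ((quotNorm_le S b (S.neg_mem hb)).trans_eq (by
      rw [add_neg_cancel, l1Norm_zero]))
  refine ⟨fun σ => g (Finsupp.single σ 1), fun σ => abs_le.2 ⟨?_, ?_⟩, fun b hb => ?_, ?_⟩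
  · have := hle (Finsupp.single σ (-1))
    rw [Finsupp.single_neg, map_neg, ← Finsupp.single_neg, l1Norm_single, abs_neg, abs_one] at this
    linarith
  · simpa [l1Norm_single] using hle (Finsupp.single σ 1)
  · rw [hev]
    have := hS _ (S.neg_mem hb)
    rw [map_neg] at this
    exact le_antisymm (hS b hb) (by linarith)
  · rw [hev]
    have := g1 ⟨ζ, Submodule.mem_span_singleton_self ζ⟩
    rw [this]
    exact LinearPMap.mkSpanSingleton_apply ℝ ℝ hζ _

lemma relativeBoundaries_le_relativeCycles (B : Set X) :
    relativeBoundaries ℝ X B n ≤ relativeCycles ℝ X B n := by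
  cases n with
  | zero => exact le_top
  | succ n =>
    refine sup_le ?_ fun c hc => boundary_mem_chainsIn hc
    rintro _ ⟨w, -, rfl⟩
    change boundary ℝ X n (boundary ℝ X (n + 1) w) ∈ chainsIn ℝ X B n
    rw [boundary_boundary]
    exact Submodule.zero_mem _

lemma simplicialVolume_le_quotNorm {bd : Set X} {ζ : SingularChain ℝ X n}
    (hζ : ζ ∈ relativeCycles ℝ X bd n) :
    simplicialVolume X bd n ζ ≤ quotNorm (relativeBoundaries ℝ X bd n) ζ := by
  refine le_ciInf fun b => csInf_le ⟨0, ?_⟩ ⟨_, ?_, ?_, rfl⟩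
  · rintro _ ⟨z, -, -, rfl⟩
    exact l1Norm_nonneg z
  · exact Submodule.add_mem _ hζ (relativeBoundaries_le_relativeCycles bd b.2)
  · rw [add_sub_cancel_left]
    exact b.2

end Duality

/-! ### Lifting simplices avoiding the marked points -/

section Lift
variable {X : Type*} [TopologicalSpace X] {bd : Set X} (κ : Collar bd)

lemma Collar.isClosed (κ : Collar bd) : IsClosed bd := by
  have : bd = κ.height ⁻¹' {0} := by
    ext x
    exact κ.height_eq_zero_iff.symm
  rw [this]
  exact isClosed_singleton.preimage κ.height.continuous

lemma eq_of_collapseMap_eq {x y : X} (hx : x ∉ bd) (h : collapseMap X bd x = collapseMap X bd y) :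
    x = y := by
  have key : ∀ a b : X, Relation.EqvGen (collapseRel X bd) a b → a = b ∨ (a ∈ bd ∧ b ∈ bd) := by
    intro a b h
    induction h with
    | rel a b h => exact h.imp id fun h => ⟨h.1, h.2.1⟩
    | refl => exact Or.inl rfl
    | symm _ _ _ ih => exact ih.imp Eq.symm And.symm
    | trans _ _ _ _ _ ih1 ih2 =>
      rcases ih1 with rfl | ⟨h1, h2⟩
      · exact ih2
      · rcases ih2 with rfl | ⟨h3, h4⟩
        · exact Or.inr ⟨h1, h2⟩
        · exact Or.inr ⟨h1, h4⟩
  exact (key x y (Quot.eqvGen_exact h)).resolve_right fun h => hx h.1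

/-- The collar height on the collapsed space. -/
def Collar.hgt : C(Collapse X bd, unitInterval) where
  toFun := Quot.lift κ.height (by
    rintro a b (rfl | ⟨ha, hb, -⟩)
    · rfl
    · rw [κ.height_eq_zero_iff.2 ha, κ.height_eq_zero_iff.2 hb])
  continuous_toFun := continuous_quot_lift _ κ.height.continuous

lemma Collar.hgt_collapseMap (x : X) : κ.hgt (collapseMap X bd x) = κ.height x := rfl

lemma Collar.hgt_eq_zero_iff {y : Collapse X bd} : κ.hgt y = 0 ↔ y ∈ collapsedBoundary X bd := by
  obtain ⟨x, rfl⟩ : ∃ x, collapseMap X bd x = y := Quot.exists_rep y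
  rw [κ.hgt_collapseMap, κ.height_eq_zero_iff, mem_collapsedBoundary]

lemma collapseMap_out (y : Collapse X bd) : collapseMap X bd (Quot.out y) = y := Quot.out_eq y

lemma out_collapseMap {x : X} (hx : x ∉ bd) : Quot.out (collapseMap X bd x) = x :=
  (eq_of_collapseMap_eq hx (collapseMap_out _).symm).symm

lemma Collar.height_out (y : Collapse X bd) : κ.height (Quot.out y) = κ.hgt y := by
  rw [← κ.hgt_collapseMap, collapseMap_out]

variable {D : Type*} [TopologicalSpace D]

lemma Collar.continuous_out (κ : Collar bd) {σ : C(D, Collapse X bd)}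
    (h : ∀ x, σ x ∉ collapsedBoundary X bd) :
    Continuous fun x => Quot.out (σ x) := by
  refine continuous_def.2 fun V hV => ?_
  have h1 : (fun x => Quot.out (σ x)) ⁻¹' V = σ ⁻¹' (collapseMap X bd '' (V \ bd)) := by
    ext x
    constructor
    · intro hx
      refine ⟨_, ⟨hx, fun hb => h x ?_⟩, collapseMap_out _⟩
      rw [← collapseMap_out (σ x)]
      exact mem_collapsedBoundary.2 hb
    · rintro ⟨y, ⟨hyV, hyb⟩, hy⟩
      change Quot.out (σ x) ∈ V
      rwa [← hy, out_collapseMap hyb]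
  have h2 : collapseMap X bd ⁻¹' (collapseMap X bd '' (V \ bd)) = V \ bd := by
    refine Set.Subset.antisymm ?_ (Set.subset_preimage_image _ _)
    rintro x ⟨y, hy, hyx⟩
    rwa [← eq_of_collapseMap_eq hy.2 hyx]
  rw [h1]
  refine IsOpen.preimage σ.continuous ?_
  have hq : IsQuotientMap (collapseMap X bd) := isQuotientMap_quot_mk
  rw [← hq.isOpen_preimage, h2]
  exact hV.sdiff κ.isClosed

/-- The lift to `X` of a map avoiding the marked points, followed by the retraction of the
collar. -/
def Collar.desing (σ : C(D, Collapse X bd)) (h : ∀ x, σ x ∉ collapsedBoundary X bd) : C(D, X) where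
  toFun x := κ.retr (1, Quot.out (σ x))
  continuous_toFun := κ.retr.continuous.comp (continuous_const.prodMk (κ.continuous_out h))

lemma Collar.desing_apply (σ : C(D, Collapse X bd)) (h : ∀ x, σ x ∉ collapsedBoundary X bd)
    (x : D) : κ.desing σ h x = κ.retr (1, Quot.out (σ x)) := rfl

lemma Collar.desing_mem {σ : C(D, Collapse X bd)} {h : ∀ x, σ x ∉ collapsedBoundary X bd}
    {x : D} (hx : (κ.hgt (σ x) : ℝ) < 1 / 2) : κ.desing σ h x ∈ bd :=
  κ.retr_one_mem (by rw [κ.height_out]; exact hx.le)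

end Lift

/-! ### Moving simplices off the marked points -/

section Approx
variable {n m : ℕ}

/-- The straight line homotopy in a simplex. -/
def lerp : C(unitInterval × (TopSimplex n × TopSimplex n), TopSimplex n) where
  toFun p := ⟨fun j => (1 - p.1) * p.2.1.1 j + p.1 * p.2.2.1 j,
    convex_stdSimplex ℝ (Fin (n + 1)) p.2.1.2 p.2.2.2 (sub_nonneg.2 p.1.2.2) p.1.2.1
      (sub_add_cancel _ _)⟩
  continuous_toFun := by
    refine Continuous.subtype_mk (continuous_pi fun j => ?_) _
    have hx : Continuous fun p : unitInterval × (TopSimplex n × TopSimplex n) => p.2.1.1 j :=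
      (continuous_apply j).comp (continuous_subtype_val.comp (continuous_fst.comp continuous_snd))
    have hy : Continuous fun p : unitInterval × (TopSimplex n × TopSimplex n) => p.2.2.1 j :=
      (continuous_apply j).comp (continuous_subtype_val.comp (continuous_snd.comp continuous_snd))
    have ht : Continuous fun p : unitInterval × (TopSimplex n × TopSimplex n) => (p.1 : ℝ) :=
      continuous_subtype_val.comp continuous_fst
    exact ((continuous_const.sub ht).mul hx).add (ht.mul hy)

lemma lerp_coe (t : unitInterval) (x y : TopSimplex n) (j : Fin (n + 1)) :
    (lerp (t, (x, y))).1 j = (1 - t) * x.1 j + t * y.1 j := rfl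

lemma lerp_zero (x y : TopSimplex n) : lerp (0, (x, y)) = x :=
  Subtype.ext (funext fun j => by simp [lerp_coe])

lemma lerp_one (x y : TopSimplex n) : lerp (1, (x, y)) = y :=
  Subtype.ext (funext fun j => by simp [lerp_coe])

lemma lerp_self (t : unitInterval) (x : TopSimplex n) : lerp (t, (x, x)) = x :=
  Subtype.ext (funext fun j => by rw [lerp_coe]; ring)

lemma dist_lerp_le {t : unitInterval} {x y z : TopSimplex n} {r : ℝ} (hx : dist x z ≤ r)
    (hy : dist y z ≤ r) : dist (lerp (t, (x, y))) z ≤ r :=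
  convex_closedBall z.1 r (x := x.1) (y := y.1) hx hy (sub_nonneg.2 t.2.2) t.2.1
    (sub_add_cancel _ _)

lemma dist_lerp_left_le (t : unitInterval) (x y : TopSimplex n) :
    dist (lerp (t, (x, y))) x ≤ t := by
  refine (dist_pi_le_iff t.2.1).2 fun j => ?_
  rw [lerp_coe, Real.dist_eq, show (1 - (t : ℝ)) * x.1 j + t * y.1 j - x.1 j =
    t * (y.1 j - x.1 j) by ring, abs_mul, abs_of_nonneg t.2.1]
  refine mul_le_of_le_one_right t.2.1 (abs_le.2 ⟨?_, ?_⟩)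
  · linarith [y.2.1 j, (mem_Icc_of_mem_stdSimplex x.2 j).2]
  · linarith [x.2.1 j, (mem_Icc_of_mem_stdSimplex y.2 j).2]

/-- If an interior point of a segment lies on a face, so do the endpoints. -/
lemma mem_faceSet_of_lerp {t : unitInterval} (h0 : t ≠ 0) (h1 : t ≠ 1) {x y : TopSimplex n}
    {S : Finset (Fin (n + 1))} (h : lerp (t, (x, y)) ∈ faceSet n S) : x ∈ faceSet n S := by
  intro j hj
  have h2 := h j hj
  have h3 : (1 - (t : ℝ)) * x.1 j + t * y.1 j = 0 := h2
  have ht0 : 0 < (t : ℝ) := unitInterval.pos_iff_ne_zero.2 h0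
  have ht1 : (t : ℝ) < 1 := unitInterval.lt_one_iff_ne_one.2 h1
  have hx := x.2.1 j
  have hy := y.2.1 j
  have h5 : 0 ≤ (1 - (t : ℝ)) * x.1 j := mul_nonneg (by linarith) hx
  have h6 : 0 ≤ (t : ℝ) * y.1 j := mul_nonneg ht0.le hy
  have h7 : (1 - (t : ℝ)) * x.1 j = 0 := by linarith
  exact (mul_eq_zero.1 h7).resolve_left (by linarith)

lemma notMem_of_lerp {Y : Type*} [TopologicalSpace Y] {B : Set Y} {w : SingularSimplex Y n}
    (hw : Admissible B w) (t : unitInterval) {x y : TopSimplex n} (hx : w x ∉ B) (hy : w y ∉ B) :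
    w (lerp (t, (x, y))) ∉ B := by
  intro h
  obtain ⟨𝒮, h𝒮⟩ := hw
  by_cases h0 : t = 0
  · rw [h0, lerp_zero] at h
    exact hx h
  by_cases h1 : t = 1
  · rw [h1, lerp_one] at h
    exact hy h
  have h' : lerp (t, (x, y)) ∈ w ⁻¹' B := h
  rw [h𝒮] at h'
  obtain ⟨S, hS, hl⟩ := Set.mem_iUnion₂.1 h'
  refine hx (show x ∈ w ⁻¹' B from ?_)
  rw [h𝒮]
  exact Set.mem_iUnion₂.2 ⟨S, hS, mem_faceSet_of_lerp h0 h1 hl⟩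

variable {X : Type*} [TopologicalSpace X] {bd : Set X} {κ : Collar bd}

/-- Points within `ε` of the quarter collar lie in the half collar. -/
def IsFine (κ : Collar bd) (ε : ℝ) (w : SingularSimplex (Collapse X bd) m) : Prop :=
  ∀ x y, (κ.hgt (w x) : ℝ) < 1 / 4 → dist y x ≤ ε → (κ.hgt (w y) : ℝ) < 1 / 2

/-- `η` is a small perturbation of `e`, moving points only near the marked points, such that
`w ∘ η` avoids the marked points. -/
structure Approx (κ : Collar bd) (ε : ℝ) (w : SingularSimplex (Collapse X bd) m)
    (e η : C(TopSimplex n, TopSimplex m)) : Prop where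
  near : ∀ x, dist (η x) (e x) ≤ ε
  moved : ∀ x, η x = e x ∨ (κ.hgt (w (e x)) : ℝ) < 1 / 4
  avoid : ∀ x, w.comp η x ∉ collapsedBoundary X bd

lemma exists_isFine (κ : Collar bd) (w : SingularSimplex (Collapse X bd) m) :
    ∃ ε > 0, IsFine κ ε w := by
  have hc : Continuous fun x => (κ.hgt (w x) : ℝ) := by fun_prop
  obtain ⟨δ, hδ, h⟩ := Metric.uniformContinuous_iff.1
    (CompactSpace.uniformContinuous_of_continuous hc) (1 / 4) (by norm_num)
  refine ⟨δ / 2, half_pos hδ, fun x y hx hy => ?_⟩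
  have := h (a := y) (b := x) (by linarith)
  rw [Real.dist_eq] at this
  linarith [(abs_lt.1 this).2]

lemma IsFine.max {ε ε' : ℝ} {w : SingularSimplex (Collapse X bd) m} (h : IsFine κ ε w)
    (h' : IsFine κ ε' w) : IsFine κ (max ε ε') w := fun x y hx hy =>
  (le_max_iff.1 hy).elim (h x y hx) (h' x y hx)

lemma exists_approx {ε : ℝ} (hε : 0 < ε) {w : SingularSimplex (Collapse X bd) m}
    (hw : Admissible (collapsedBoundary X bd) w)
    (hw' : ¬ Set.range w ⊆ collapsedBoundary X bd) :
    ∃ η, Approx κ ε w (ContinuousMap.id _) η := by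
  let t : C(TopSimplex m, unitInterval) :=
    ⟨fun x => ⟨min 1 ε * max 0 (1 - 4 * (κ.hgt (w x) : ℝ)), by positivity,
      mul_le_one₀ (min_le_left _ _) (le_max_left _ _)
        (max_le zero_le_one (by linarith [(κ.hgt (w x)).2.1]))⟩, by fun_prop⟩
  have ht : ∀ x, (t x : ℝ) = min 1 ε * max 0 (1 - 4 * (κ.hgt (w x) : ℝ)) := fun _ => rfl
  have hmin : 0 < min 1 ε := lt_min one_pos hε
  refine ⟨⟨fun x => lerp (t x, (x, center m)), by fun_prop⟩, fun x => ?_, fun x => ?_, fun x => ?_⟩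
  · refine (dist_lerp_left_le _ _ _).trans ?_
    rw [ht]
    refine (mul_le_of_le_one_right hmin.le (max_le zero_le_one ?_)).trans (min_le_right _ _)
    linarith [(κ.hgt (w x)).2.1]
  · by_cases hx : (κ.hgt (w x) : ℝ) < 1 / 4
    · exact Or.inr hx
    · left
      have : t x = 0 := Subtype.ext (by
        rw [ht, max_eq_left (by linarith), mul_zero]; rfl)
      change lerp (t x, (x, center m)) = x
      rw [this, lerp_zero]
  · change w (lerp (t x, (x, center m))) ∉ _
    by_cases hx : (κ.hgt (w x) : ℝ) < 1 / 4
    · intro h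
      obtain ⟨𝒮, h𝒮⟩ := hw
      have h' : lerp (t x, (x, center m)) ∈ w ⁻¹' collapsedBoundary X bd := h
      rw [h𝒮] at h'
      obtain ⟨S, hS, hl⟩ := Set.mem_iUnion₂.1 h'
      have hpos : 0 < (t x : ℝ) := mul_pos hmin (lt_max_of_lt_right (by linarith))
      refine hw' ?_
      rintro _ ⟨y, rfl⟩
      change y ∈ w ⁻¹' collapsedBoundary X bd
      rw [h𝒮]
      refine Set.mem_iUnion₂.2 ⟨S, hS, fun j hj => absurd (hl j hj) ?_⟩
      change (1 - (t x : ℝ)) * x.1 j + t x * (1 / ((m : ℝ) + 1)) ≠ 0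
      have h1 : 0 ≤ (1 - (t x : ℝ)) * x.1 j := mul_nonneg (sub_nonneg.2 (t x).2.2) (x.2.1 j)
      positivity
    · have : t x = 0 := Subtype.ext (by
        rw [ht, max_eq_left (by linarith), mul_zero]; rfl)
      rw [this, lerp_zero, ← κ.hgt_eq_zero_iff]
      intro h
      rw [h] at hx
      norm_num at hx

end Approx

/-! ### Extending invariant cocycles to the collapsed space -/

section Admissible
variable {Y : Type*} [TopologicalSpace Y] {B : Set Y} {n m : ℕ}

lemma affS_mem_faceSet_iff {v : Fin (n + 1) → TopSimplex m} {S : Finset (Fin (m + 1))}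
    {x : TopSimplex n} :
    affS v x ∈ faceSet m S ↔ ∀ i, v i ∉ faceSet m S → x.1 i = 0 := by
  have key : ∀ j, (affS v x).1 j = 0 ↔ ∀ i, x.1 i * (v i).1 j = 0 := fun j => by
    rw [affS_coe, Finset.sum_eq_zero_iff_of_nonneg fun i _ => mul_nonneg (x.2.1 i) ((v i).2.1 j)]
    simp
  constructor
  · intro h i hi
    by_contra hx
    exact hi fun j hj => (mul_eq_zero.1 ((key j).1 (h j hj) i)).resolve_left hx
  · intro h j hj
    refine (key j).2 fun i => ?_
    by_cases hi : v i ∈ faceSet m S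
    · exact mul_eq_zero_of_right _ (hi j hj)
    · rw [h i hi, zero_mul]

lemma admissible_comp_affS {σ : SingularSimplex Y m} (hσ : Admissible B σ)
    (v : Fin (n + 1) → TopSimplex m) : Admissible B (σ.comp (affS v)) := by
  classical
  obtain ⟨𝒮, h𝒮⟩ := hσ
  refine ⟨(fun S => Finset.univ.filter fun i => v i ∈ faceSet m S) '' 𝒮, ?_⟩
  rw [Set.biUnion_image]
  ext x
  change affS v x ∈ σ ⁻¹' B ↔ _
  rw [h𝒮, Set.mem_iUnion₂, Set.mem_iUnion₂]
  refine exists₂_congr fun S _ => affS_mem_faceSet_iff.trans (forall_congr' fun i => ?_)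
  rw [Finset.mem_filter]
  simp only [Finset.mem_univ, true_and]
  rfl

lemma admissible_comp_coface {σ : SingularSimplex Y (n + 1)} (hσ : Admissible B σ)
    (i : Fin (n + 2)) : Admissible B (σ.comp (coface i)) := by
  rw [coface_eq_affS]
  exact admissible_comp_affS hσ _

lemma admissible_of_disjoint {σ : SingularSimplex Y n} (h : ∀ x, σ x ∉ B) : Admissible B σ :=
  ⟨∅, by
    ext x
    simpa using h x⟩

lemma dist_coface_le (i : Fin (n + 2)) (x y : TopSimplex n) :
    dist (coface i x) (coface i y) ≤ dist x y := by
  refine (dist_pi_le_iff dist_nonneg).2 fun j => ?_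
  rw [coface_eq_faceMap]
  by_cases hj : j ∈ Set.range i.succAbove
  · obtain ⟨k, rfl⟩ := hj
    rw [faceMap_apply_of_injective Fin.succAbove_right_injective,
      faceMap_apply_of_injective Fin.succAbove_right_injective]
    exact dist_le_pi_dist x.1 y.1 k
  · rw [faceMap_apply_of_notMem _ hj, faceMap_apply_of_notMem _ hj, dist_self]
    exact dist_nonneg

end Admissible

section Extend
variable {X : Type*} [TopologicalSpace X] {bd : Set X} {n m : ℕ}

/-- A relative cocycle invariant under homotopies supported in `bd`. -/
structure IsInvariantCocycle (bd : Set X) (f : SingularSimplex X n → ℝ) : Prop where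
  cocycle : ∀ c, ev f (boundary ℝ X n c) = 0
  vanish : ∀ σ : SingularSimplex X n, Set.range σ ⊆ bd → f σ = 0
  invariant : ∀ W : C(unitInterval × TopSimplex n, X), SupportedIn bd W →
    f (slice W 0) = f (slice W 1)

variable {κ : Collar bd} {f : SingularSimplex X n → ℝ} {ε ε' : ℝ}

lemma Approx.eq (hf : IsInvariantCocycle bd f) {w : SingularSimplex (Collapse X bd) m}
    (hw : Admissible (collapsedBoundary X bd) w) (hε : IsFine κ ε w) (hε' : IsFine κ ε' w)
    {e η η' : C(TopSimplex n, TopSimplex m)} (h : Approx κ ε w e η) (h' : Approx κ ε' w e η') :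
    f (κ.desing (w.comp η) h.avoid) = f (κ.desing (w.comp η') h'.avoid) := by
  let G : C(unitInterval × TopSimplex n, TopSimplex m) :=
    ⟨fun p => lerp (p.1, (η p.2, η' p.2)), by fun_prop⟩
  have hG : ∀ p, w.comp G p ∉ collapsedBoundary X bd := fun p =>
    notMem_of_lerp hw p.1 (h.avoid p.2) (h'.avoid p.2)
  have key := hf.invariant (κ.desing (w.comp G) hG) fun x => by
    have const : η x = e x → η' x = e x →
        ∀ t, κ.desing (w.comp G) hG (t, x) = κ.desing (w.comp G) hG (0, x) := fun h1 h2 t => by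
      have : G (t, x) = G (0, x) := by
        change lerp (t, (η x, η' x)) = lerp (0, (η x, η' x))
        rw [h1, h2, lerp_self, lerp_self]
      rw [κ.desing_apply, κ.desing_apply, ContinuousMap.comp_apply, ContinuousMap.comp_apply, this]
    have move : (κ.hgt (w (e x)) : ℝ) < 1 / 4 → ∀ t, κ.desing (w.comp G) hG (t, x) ∈ bd :=
      fun h1 t => κ.desing_mem ((hε.max hε') (e x) _ h1
        (dist_lerp_le ((h.near x).trans (le_max_left _ _)) ((h'.near x).trans (le_max_right _ _))))
    rcases h.moved x with h1 | h1
    · rcases h'.moved x with h2 | h2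
      · exact Or.inr (const h1 h2)
      · exact Or.inl (move h2)
    · exact Or.inl (move h1)
  have e0 : slice (κ.desing (w.comp G) hG) 0 = κ.desing (w.comp η) h.avoid := by
    ext x
    change κ.retr (1, Quot.out (w (lerp (0, (η x, η' x))))) = κ.retr (1, Quot.out (w (η x)))
    rw [lerp_zero]
  have e1 : slice (κ.desing (w.comp G) hG) 1 = κ.desing (w.comp η') h'.avoid := by
    ext x
    change κ.retr (1, Quot.out (w (lerp (1, (η x, η' x))))) = κ.retr (1, Quot.out (w (η' x)))
    rw [lerp_one]
  rwa [e0, e1] at key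

open Classical in
/-- The extension of an invariant cocycle to simplices of the collapsed space. -/
def Collar.extend (κ : Collar bd) (f : SingularSimplex X n → ℝ)
    (σ : SingularSimplex (Collapse X bd) n) : ℝ :=
  if h : Admissible (collapsedBoundary X bd) σ ∧
      ∃ η, ∃ ε, IsFine κ ε σ ∧ Approx κ ε σ (ContinuousMap.id _) η then
    f (κ.desing (σ.comp h.2.choose) h.2.choose_spec.choose_spec.2.avoid)
  else 0

lemma abs_extend_le {C : ℝ} (hC : 0 ≤ C) (hf : ∀ σ, |f σ| ≤ C)
    (σ : SingularSimplex (Collapse X bd) n) : |κ.extend f σ| ≤ C := by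
  unfold Collar.extend
  split_ifs
  · exact hf _
  · rwa [abs_zero]

lemma extend_eq (hf : IsInvariantCocycle bd f) {σ : SingularSimplex (Collapse X bd) n}
    (hσ : Admissible (collapsedBoundary X bd) σ) (hε : IsFine κ ε σ)
    {η : C(TopSimplex n, TopSimplex n)} (h : Approx κ ε σ (ContinuousMap.id _) η) :
    κ.extend f σ = f (κ.desing (σ.comp η) h.avoid) := by
  have hex : Admissible (collapsedBoundary X bd) σ ∧
      ∃ η, ∃ ε, IsFine κ ε σ ∧ Approx κ ε σ (ContinuousMap.id _) η := ⟨hσ, η, ε, hε, h⟩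
  rw [Collar.extend, dif_pos hex]
  exact Approx.eq hf hσ hex.2.choose_spec.choose_spec.1 hε
    hex.2.choose_spec.choose_spec.2 h

lemma extend_eq_zero (hf : IsInvariantCocycle bd f) {σ : SingularSimplex (Collapse X bd) n}
    (hσ : Set.range σ ⊆ {y | (κ.hgt y : ℝ) < 1 / 2}) : κ.extend f σ = 0 := by
  unfold Collar.extend
  split_ifs
  · refine hf.vanish _ ?_
    rintro _ ⟨x, rfl⟩
    exact κ.desing_mem (hσ ⟨_, rfl⟩)
  · rfl

lemma subset_hgt_lt : collapsedBoundary X bd ⊆ {y | (κ.hgt y : ℝ) < 1 / 2} := fun y hy => by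
  rw [Set.mem_ofPred_eq, κ.hgt_eq_zero_iff.2 hy]
  norm_num

lemma extend_comp_eq (hf : IsInvariantCocycle bd f) {w : SingularSimplex (Collapse X bd) m}
    (hw : Admissible (collapsedBoundary X bd) w) (hε0 : 0 < ε) (hε : IsFine κ ε w)
    {e η : C(TopSimplex n, TopSimplex m)} (h : Approx κ ε w e η)
    (he : ∀ x y, dist (e x) (e y) ≤ dist x y)
    (hwe : Admissible (collapsedBoundary X bd) (w.comp e)) :
    κ.extend f (w.comp e) = f (κ.desing (w.comp η) h.avoid) := by
  by_cases hB : Set.range (w.comp e) ⊆ collapsedBoundary X bd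
  · rw [extend_eq_zero hf (hB.trans subset_hgt_lt), hf.vanish]
    rintro _ ⟨x, rfl⟩
    refine κ.desing_mem (hε (e x) (η x) ?_ (h.near x))
    rw [κ.hgt_eq_zero_iff.2 (show w (e x) ∈ _ from hB ⟨x, rfl⟩)]
    norm_num
  · have hε2 : IsFine κ ε (w.comp e) := fun x y hx hy => hε _ _ hx ((he y x).trans hy)
    obtain ⟨ψ, hψ⟩ := exists_approx (κ := κ) hε0 hwe hB
    have h2 : Approx κ ε w e (e.comp ψ) :=
      ⟨fun x => (he _ _).trans (hψ.near x),
        fun x => (hψ.moved x).imp (fun h => congrArg e h) id, hψ.avoid⟩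
    rw [extend_eq hf hwe hε2 hψ]
    exact Approx.eq hf hw hε hε h2 h

lemma ev_extend_boundary_single (hf : IsInvariantCocycle bd f)
    {w : SingularSimplex (Collapse X bd) (n + 1)} (hw : Admissible (collapsedBoundary X bd) w) :
    ev (κ.extend f) (boundary ℝ _ n (Finsupp.single w 1)) = 0 := by
  by_cases hB : Set.range w ⊆ collapsedBoundary X bd
  · refine ev_eq_zero_of_span (P := fun σ => Set.range σ ⊆ collapsedBoundary X bd)
      (fun σ hσ => extend_eq_zero hf (hσ.trans subset_hgt_lt)) (boundary_mem_chainsIn ?_)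
    exact Submodule.subset_span ⟨w, hB, rfl⟩
  · obtain ⟨ε, hε0, hε⟩ := exists_isFine κ w
    obtain ⟨ψ, hψ⟩ := exists_approx (κ := κ) hε0 hw hB
    have key := hf.cocycle (Finsupp.single (κ.desing (w.comp ψ) hψ.avoid) 1)
    rw [boundary_single, map_sum] at key ⊢
    rw [← key]
    refine Finset.sum_congr rfl fun i _ => ?_
    have h2 : Approx κ ε w (coface i) (ψ.comp (coface i)) :=
      ⟨fun x => hψ.near _, fun x => hψ.moved _, fun x => hψ.avoid _⟩
    have h3 := extend_comp_eq hf hw hε0 hε h2 (dist_coface_le i) (admissible_comp_coface hw i)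
    rw [map_smul, map_smul, ev_single, ev_single, h3]
    rfl

lemma ev_extend_boundary (hf : IsInvariantCocycle bd f)
    {c : SingularChain ℝ (Collapse X bd) (n + 1)}
    (hc : c ∈ admissibleChains ℝ (Collapse X bd) (collapsedBoundary X bd) (n + 1)) :
    ev (κ.extend f) (boundary ℝ _ n c) = 0 := by
  have : admissibleChains ℝ (Collapse X bd) (collapsedBoundary X bd) (n + 1) ≤
      LinearMap.ker ((ev (κ.extend f)).comp (boundary ℝ _ n)) := by
    refine Submodule.span_le.2 ?_
    rintro _ ⟨w, hw, rfl⟩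
    exact ev_extend_boundary_single hf hw
  exact this hc

lemma extend_collapseMap (hf : IsInvariantCocycle bd f) {τ : SingularSimplex X n}
    (hτ : ∀ x, τ x ∉ bd) :
    κ.extend f ((collapseMap X bd).comp τ) = f ((slice κ.retr 1).comp τ) := by
  have h0 : ∀ x, (collapseMap X bd).comp τ x ∉ collapsedBoundary X bd :=
    fun x h => hτ x (mem_collapsedBoundary.1 h)
  obtain ⟨ε, hε0, hε⟩ := exists_isFine κ ((collapseMap X bd).comp τ)
  have h1 : Approx κ ε ((collapseMap X bd).comp τ) (ContinuousMap.id _) (ContinuousMap.id _) :=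
    ⟨fun x => by rw [dist_self]; exact hε0.le, fun x => Or.inl rfl, h0⟩
  rw [extend_eq hf (admissible_of_disjoint h0) hε h1]
  congr 1
  ext x
  change κ.retr (1, Quot.out (collapseMap X bd (τ x))) = κ.retr (1, τ x)
  rw [out_collapseMap (hτ x)]

end Extend

/-! ### Evaluating the extended cocycle on ideal representatives -/

section Evaluate
variable {Y : Type*} [TopologicalSpace Y] {A B : Set Y} {n : ℕ}

lemma relativeCycles_mono (h : A ⊆ B) : relativeCycles ℝ Y A n ≤ relativeCycles ℝ Y B n := by
  cases n with
  | zero => exact le_rfl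
  | succ n => exact Submodule.comap_mono (chainsIn_mono h)

lemma relativeBoundaries_mono (h : A ⊆ B) :
    relativeBoundaries ℝ Y A n ≤ relativeBoundaries ℝ Y B n :=
  sup_le_sup_left (chainsIn_mono h) _

lemma Sd_mem_relativeCycles {c : SingularChain ℝ Y n} (hc : c ∈ relativeCycles ℝ Y A n) :
    Sd Y n c ∈ relativeCycles ℝ Y A n := by
  cases n with
  | zero => trivial
  | succ n =>
    change boundary ℝ Y n (Sd Y (n + 1) c) ∈ chainsIn ℝ Y A n
    rw [boundary_Sd]
    exact Sd_mem_chainsIn hc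

lemma Sd_mem_admissibleChains {c : SingularChain ℝ Y n} (hc : c ∈ admissibleChains ℝ Y B n) :
    Sd Y n c ∈ admissibleChains ℝ Y B n :=
  span_induct (P := Admissible B) _ _ (fun σ hσ => by
    rw [Sd, natOp_single]
    exact Realization.chain_mem_span _ _ _ _ fun v _ => admissible_comp_affS hσ v) hc

lemma sdT_mem_admissibleChains {c : SingularChain ℝ Y n} (hc : c ∈ admissibleChains ℝ Y B n) :
    sdT Y n c ∈ admissibleChains ℝ Y B (n + 1) :=
  span_induct (P := Admissible B) _ _ (fun σ hσ => by
    rw [sdT, natOp_single]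
    exact Realization.chain_mem_span _ _ _ _ fun v _ => admissible_comp_affS hσ v) hc

lemma chainsIn_compl_le_admissibleChains :
    chainsIn ℝ Y Bᶜ n ≤ admissibleChains ℝ Y B n := by
  refine Submodule.span_mono ?_
  rintro _ ⟨σ, hσ, rfl⟩
  exact ⟨σ, admissible_of_disjoint fun x => hσ ⟨x, rfl⟩, rfl⟩

variable {X : Type*} [TopologicalSpace X] {bd : Set X} {κ : Collar bd}
  {f : SingularSimplex X n → ℝ}

/-- The half collar in the collapsed space. -/
def Collar.half (κ : Collar bd) : Set (Collapse X bd) := {y | (κ.hgt y : ℝ) < 1 / 2}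

lemma ev_extend_chainsIn (hf : IsInvariantCocycle bd f) {c : SingularChain ℝ (Collapse X bd) n}
    (hc : c ∈ chainsIn ℝ _ κ.half n) : ev (κ.extend f) c = 0 :=
  ev_eq_zero_of_span (P := fun σ => Set.range σ ⊆ κ.half) (fun _ hσ => extend_eq_zero hf hσ) hc

lemma ev_extend_Sd (hf : IsInvariantCocycle bd f) {c : SingularChain ℝ (Collapse X bd) n}
    (hc : c ∈ admissibleChains ℝ _ (collapsedBoundary X bd) n)
    (hc' : c ∈ relativeCycles ℝ _ κ.half n) :
    ev (κ.extend f) (Sd _ n c) = ev (κ.extend f) c := by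
  have key := ev_extend_boundary (κ := κ) hf (sdT_mem_admissibleChains hc)
  cases n with
  | zero =>
    rw [boundary_sdT_zero, map_sub] at key
    linarith
  | succ n =>
    rw [boundary_sdT_succ, map_sub, map_sub, ev_extend_chainsIn hf (sdT_mem_chainsIn hc')] at key
    linarith

lemma ev_extend_Sd_iterate (hf : IsInvariantCocycle bd f)
    {c : SingularChain ℝ (Collapse X bd) n}
    (hc : c ∈ admissibleChains ℝ _ (collapsedBoundary X bd) n)
    (hc' : c ∈ relativeCycles ℝ _ κ.half n) (k : ℕ) :
    ev (κ.extend f) ((Sd _ n)^[k] c) = ev (κ.extend f) c := by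
  induction k generalizing c with
  | zero => rfl
  | succ k ih =>
    rw [Function.iterate_succ_apply, ih (Sd_mem_admissibleChains hc) (Sd_mem_relativeCycles hc'),
      ev_extend_Sd hf hc hc']

lemma boundary_Sd_iterate (c : SingularChain ℝ Y (n + 1)) (k : ℕ) :
    (Sd Y n)^[k] (boundary ℝ Y n c) = boundary ℝ Y n ((Sd Y (n + 1))^[k] c) := by
  induction k generalizing c with
  | zero => rfl
  | succ k ih => rw [Function.iterate_succ_apply, Function.iterate_succ_apply, ← boundary_Sd, ih]

lemma Sd_iterate_mem_chainsIn {c : SingularChain ℝ Y n} (hc : c ∈ chainsIn ℝ Y A n) (k : ℕ) :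
    (Sd Y n)^[k] c ∈ chainsIn ℝ Y A n := by
  induction k generalizing c with
  | zero => exact hc
  | succ k ih => exact ih (Sd_mem_chainsIn hc)

lemma exists_ev_extend_Sd_iterate_eq_zero (hf : IsInvariantCocycle bd f)
    {c : SingularChain ℝ (Collapse X bd) n} (hc : c ∈ relativeBoundaries ℝ _ κ.half n) :
    ∃ k, ev (κ.extend f) ((Sd _ n)^[k] c) = 0 := by
  obtain ⟨_, ⟨w, -, rfl⟩, b, hb, rfl⟩ := Submodule.mem_sup.1 hc
  have hN : IsOpen κ.half := isOpen_lt (by fun_prop) continuous_const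
  have hO : IsOpen (collapsedBoundary X bd)ᶜ := by
    have : collapsedBoundary X bd = κ.hgt ⁻¹' {0} := by
      ext y
      exact κ.hgt_eq_zero_iff.symm
    rw [this]
    exact (isClosed_singleton.preimage κ.hgt.continuous).isOpen_compl
  have hNO : κ.half ∪ (collapsedBoundary X bd)ᶜ = Set.univ := by
    refine Set.eq_univ_of_forall fun y => ?_
    by_cases hy : y ∈ collapsedBoundary X bd
    · exact Or.inl (subset_hgt_lt hy)
    · exact Or.inr hy
  obtain ⟨k, hk⟩ := (eventually_Sd_small hN hO hNO w).exists
  refine ⟨k, ?_⟩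
  obtain ⟨w1, hw1, w2, hw2, hw⟩ := Submodule.mem_sup.1 hk
  have hadd : (Sd _ n)^[k] (boundary ℝ (Collapse X bd) n w + b) =
      (Sd _ n)^[k] (boundary ℝ (Collapse X bd) n w) + (Sd _ n)^[k] b := by
    rw [Sd_iterate_linear, map_add]
  rw [hadd, boundary_Sd_iterate, ← hw, map_add, map_add, map_add,
    ev_extend_chainsIn hf (boundary_mem_chainsIn hw1),
    ev_extend_boundary hf (chainsIn_compl_le_admissibleChains hw2),
    ev_extend_chainsIn hf (Sd_iterate_mem_chainsIn hb k), add_zero, add_zero]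

lemma ev_extend_eq_of_sub_mem (hf : IsInvariantCocycle bd f)
    {c d : SingularChain ℝ (Collapse X bd) n}
    (hc : c ∈ admissibleChains ℝ _ (collapsedBoundary X bd) n)
    (hc' : c ∈ relativeCycles ℝ _ κ.half n)
    (hd : d ∈ admissibleChains ℝ _ (collapsedBoundary X bd) n)
    (hd' : d ∈ relativeCycles ℝ _ κ.half n)
    (h : c - d ∈ relativeBoundaries ℝ _ κ.half n) :
    ev (κ.extend f) c = ev (κ.extend f) d := by
  obtain ⟨k, hk⟩ := exists_ev_extend_Sd_iterate_eq_zero hf h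
  rw [ev_extend_Sd_iterate hf (sub_mem hc hd) (sub_mem hc' hd'), map_sub] at hk
  exact sub_eq_zero.1 hk

/-- The homotopy pushing the quarter collar away from the boundary. -/
def Collar.pushOff (κ : Collar bd) : C(unitInterval × X, X) :=
  κ.push.comp ⟨fun p => (p.1 * (⟨1 / 4, by norm_num, by norm_num⟩ : unitInterval), p.2),
    by fun_prop⟩

lemma Collar.height_pushOff (t : unitInterval) (y : X) :
    κ.height (κ.pushOff (t, y)) = max (κ.height y) (t * ⟨1 / 4, by norm_num, by norm_num⟩) :=
  κ.height_push _ y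

lemma pushChain_mem_admissibleChains {g : C(X, Y)} (hg : ∀ x, g x ∉ B) (c : SingularChain ℝ X n) :
    pushChain ℝ g n c ∈ admissibleChains ℝ Y B n := by
  induction c using Finsupp.induction_linear with
  | zero => exact (map_zero (pushChain ℝ g n)).symm ▸ zero_mem _
  | add a b ha hb => exact (map_add (pushChain ℝ g n) a b).symm ▸ add_mem ha hb
  | single σ r =>
    rw [← mul_one r, ← smul_eq_mul, ← Finsupp.smul_single, map_smul, pushChain_single]
    exact Submodule.smul_mem _ _ (Submodule.subset_span
      ⟨_, admissible_of_disjoint fun x => hg (σ x), rfl⟩)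

lemma ev_extend_pushChain (hf : IsInvariantCocycle bd f) {g : C(X, X)} (hg : ∀ x, g x ∉ bd)
    (c : SingularChain ℝ X n) :
    ev (κ.extend f) (pushChain ℝ ((collapseMap X bd).comp g) n c) =
      ev f (pushChain ℝ ((slice κ.retr 1).comp g) n c) := by
  have : (ev (κ.extend f)).comp (pushChain ℝ ((collapseMap X bd).comp g) n) =
      (ev f).comp (pushChain ℝ ((slice κ.retr 1).comp g) n) :=
    ochain_hom_ext fun σ => by
      rw [LinearMap.comp_apply, LinearMap.comp_apply, pushChain_single, pushChain_single, ev_single,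
        ev_single, ContinuousMap.comp_assoc, ContinuousMap.comp_assoc]
      exact extend_collapseMap hf fun x => hg (σ x)
  exact LinearMap.congr_fun this c

lemma ev_relativeBoundaries (hf : IsInvariantCocycle bd f) {c : SingularChain ℝ X n}
    (hc : c ∈ relativeBoundaries ℝ X bd n) : ev f c = 0 := by
  obtain ⟨_, ⟨w, -, rfl⟩, b, hb, rfl⟩ := Submodule.mem_sup.1 hc
  rw [map_add, hf.cocycle, zero_add]
  exact ev_eq_zero_of_span (P := fun σ => Set.range σ ⊆ bd) hf.vanish hb

lemma ev_extend_of_idealRepresents (hf : IsInvariantCocycle bd f) {ζ : SingularChain ℝ X n}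
    (hζ : ζ ∈ relativeCycles ℝ X bd n) {z : SingularChain ℝ (Collapse X bd) n}
    (hz : IdealRepresents X bd n ζ z) : ev (κ.extend f) z = ev f ζ := by
  let g : C(X, X) := slice κ.pushOff 1
  have hg : ∀ x, g x ∉ bd := fun x h => by
    have h1 := congrArg Subtype.val ((κ.height_pushOff 1 x).symm.trans (κ.height_eq_zero_iff.2 h))
    have h2 : (1 / 4 : ℝ) ≤ 0 := by
      rw [← Set.Icc.coe_zero, ← h1, one_mul]
      exact le_max_right (κ.height x) (⟨1 / 4, by norm_num, by norm_num⟩ : unitInterval)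
    norm_num at h2
  have hq : ∀ t, ∀ x ∈ bd, (collapseMap X bd).comp κ.pushOff (t, x) ∈ κ.half := fun t x hx => by
    change (κ.height (κ.pushOff (t, x)) : ℝ) < 1 / 2
    rw [κ.height_pushOff, κ.height_eq_zero_iff.2 hx, max_eq_right unitInterval.nonneg']
    change (t : ℝ) * (1 / 4) < 1 / 2
    linarith [t.2.2]
  have h0 : slice ((collapseMap X bd).comp κ.pushOff) 0 = collapseMap X bd := by
    ext x
    change collapseMap X bd (κ.push (0 * _, x)) = _
    rw [zero_mul, κ.push_zero]
  have h1 : slice ((collapseMap X bd).comp κ.pushOff) 1 = (collapseMap X bd).comp g := rfl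
  have hhom := pushChain_slice_sub_mem _ hq hζ
  rw [h0, h1] at hhom
  obtain ⟨hz1, hz2⟩ := hz
  rw [mem_markedCycles_iff] at hz1
  have hsub : z - pushChain ℝ ((collapseMap X bd).comp g) n ζ ∈
      relativeBoundaries ℝ _ κ.half n := by
    have := sub_mem (relativeBoundaries_mono (subset_hgt_lt (κ := κ)) hz2) hhom
    rwa [idealFundamentalRep, sub_sub, add_sub_cancel] at this
  rw [ev_extend_eq_of_sub_mem hf hz1.1 (relativeCycles_mono subset_hgt_lt hz1.2)
    (pushChain_mem_admissibleChains (fun x h => hg x (mem_collapsedBoundary.1 h)) ζ)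
    (pushChain_mem_relativeCycles _ (fun x hx => hq 1 x hx) hζ) hsub, ev_extend_pushChain hf hg]
  have hr1 : (slice κ.retr 1).comp g = slice κ.retr 1 := by
    ext x
    refine κ.retr_push ?_ x
    change (1 : ℝ) * (1 / 4) ≤ 1 / 2
    norm_num
  have hr0 : slice κ.retr 0 = ContinuousMap.id X := by
    ext x
    exact κ.retr_zero x
  have hretr := ev_relativeBoundaries hf
    (pushChain_slice_sub_mem κ.retr (fun t x hx => κ.retr_mem t hx) hζ)
  rw [hr0, pushChain_id, map_sub] at hretr
  rw [hr1]
  exact sub_eq_zero.1 hretr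

end Evaluate

/-! ### Comparison of the simplicial volumes -/

section Main
variable {X : Type*} [TopologicalSpace X] {bd : Set X} {n : ℕ} {ζ : SingularChain ℝ X n}

lemma simplicialVolume_le_of_idealRepresents (κ : Collar bd)
    (hamen : ∀ (x : X) (hx : x ∈ bd), IsAmenable
      (FundamentalGroup (connectedComponentIn bd x) ⟨x, mem_connectedComponentIn hx⟩))
    (hζ : ζ ∈ relativeCycles ℝ X bd n) (hζ0 : ζ ≠ 0) {z : SingularChain ℝ (Collapse X bd) n}
    (hz : IdealRepresents X bd n ζ z) : simplicialVolume X bd n ζ ≤ l1Norm z := by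
  obtain ⟨f, hf1, hf2, hf3⟩ := exists_cochain_eq_quotNorm (relativeBoundaries ℝ X bd n) hζ0
  obtain ⟨f', h1, h2, h3, h4, h5⟩ := exists_invariant hamen hf1
    (fun c => hf2 _ (Submodule.mem_sup_left ⟨c, trivial, rfl⟩))
    (fun σ hσ => by
      rw [← ev_single f]
      exact hf2 _ (Submodule.mem_sup_right (Submodule.subset_span ⟨σ, hσ, rfl⟩)))
  calc simplicialVolume X bd n ζ ≤ quotNorm (relativeBoundaries ℝ X bd n) ζ :=
        simplicialVolume_le_quotNorm hζ
    _ = ev (κ.extend f') z := by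
      rw [ev_extend_of_idealRepresents ⟨h2, h3, h5⟩ hζ hz, h4 ζ hζ, hf3]
    _ ≤ 1 * l1Norm z := (le_abs_self _).trans (abs_ev_le (abs_extend_le zero_le_one h1) z)
    _ = l1Norm z := one_mul _

end Main

end SimplicialVolume

/-- **Theorem D.** If every boundary component of the compact connected oriented manifold
`M` has amenable fundamental group, then the ideal simplicial volume coincides with the
classical simplicial volume: `‖M‖_I = ‖M‖`. -/
theorem idealSimplicialVolume_eq_of_amenable_boundary {X : Type*} [TopologicalSpace X]
    (bd : Set X) (n : ℕ) (ζ : SingularChain ℝ X n) (hM : IsCptMfdBdry X bd n ζ)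
    (hamen : ∀ (x : X) (hx : x ∈ bd),
      IsAmenable (FundamentalGroup (connectedComponentIn bd x)
        ⟨x, mem_connectedComponentIn hx⟩)) :
    idealSimplicialVolume X bd n ζ = simplicialVolume X bd n ζ := by
  have := hM.compact
  obtain ⟨κ⟩ := SimplicialVolume.exists_collar hM.bd_closed hM.collar
  obtain ⟨hζ, hζ', -⟩ := hM.fund
  have hζ0 : ζ ≠ 0 := fun h => hζ' (h ▸ zero_mem _)
  have hself : ζ - ζ ∈ relativeBoundaries ℝ X bd n := by
    rw [sub_self]
    exact zero_mem _
  refine le_antisymm (le_csInf ⟨_, ζ, hζ, hself, rfl⟩ ?_) ?_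
  · rintro _ ⟨z, hz, hzζ, rfl⟩
    obtain ⟨z', hz', hle⟩ := SimplicialVolume.exists_idealRepresents κ hz hzζ
    refine le_trans (csInf_le ⟨0, ?_⟩ ⟨z', hz', rfl⟩) hle
    rintro _ ⟨y, -, rfl⟩
    exact SimplicialVolume.l1Norm_nonneg y
  · obtain ⟨z', hz', -⟩ := SimplicialVolume.exists_idealRepresents κ hζ hself
    refine le_csInf ⟨_, z', hz', rfl⟩ ?_
    rintro _ ⟨z, hz, rfl⟩
    exact SimplicialVolume.simplicialVolume_le_of_idealRepresents κ hamen hζ hζ0 hz
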